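/- Let W ∈ C¹((−∞,1],ℝ) satisfy W(0)=0, W(t)>0 for all t ∈ (−∞,1]\{0}, and W strictly convex, and let k ∈ ℤ\{0}. Consider the ODE system −f'' − (1/r) f' + (k²/r²) f = (1/ε²) f W'(1 − f² − g²), −g'' − (1/r) g' = (1/ε²) g W'(1 − f² − g²) on (0,1), with f(0)=0, f(1)=1, g'(0)=0, g(1)=0. Then there exists ε_k > 0 such that for every ε ∈ (0, ε_k) this system has a unique solution (f_ε, g_ε) with g_ε > 0 on (0,1), and for every ε ∈ [ε_k, ∞) no solution with g > 0 on (0,1) exists. -/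

import Mathlib

open MeasureTheory Set Bornology

noncomputable section

/-- Euclidean dot product on `Fin n → ℝ`. -/
def dotR {n : ℕ} (a b : Fin n → ℝ) : ℝ := ∑ j, a j * b j

/-- Squared Euclidean norm on `Fin n → ℝ`. -/
def normSq {n : ℕ} (a : Fin n → ℝ) : ℝ := ∑ j, a j ^ 2

/-- Pointwise (Frobenius) inner product of gradients `∇u · ∇v`. -/
def gradDot {m n : ℕ} (u v : (Fin m → ℝ) → Fin n → ℝ) (x : Fin m → ℝ) : ℝ :=
  ∑ i, ∑ j, fderiv ℝ u x (Pi.single i (1:ℝ)) j * fderiv ℝ v x (Pi.single i (1:ℝ)) j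

/-- `|∇u|²`. -/
def gradSq {m n : ℕ} (u : (Fin m → ℝ) → Fin n → ℝ) (x : Fin m → ℝ) : ℝ := gradDot u u x

/-- Scalar version of `gradDot`. -/
def gradDotS {m : ℕ} (φ ψ : (Fin m → ℝ) → ℝ) (x : Fin m → ℝ) : ℝ :=
  ∑ i, fderiv ℝ φ x (Pi.single i (1:ℝ)) * fderiv ℝ ψ x (Pi.single i (1:ℝ))

/-- `|∇φ|²` for scalar `φ`. -/
def gradSqS {m : ℕ} (φ : (Fin m → ℝ) → ℝ) (x : Fin m → ℝ) : ℝ := gradDotS φ φ x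

/-- `W'`, the (one-sided) derivative of the potential on `(-∞, 1]`. -/
def Wd (W : ℝ → ℝ) : ℝ → ℝ := derivWithin W (Iic (1:ℝ))

/-- The radial ODE system \eqref{syst:ode}-\eqref{syst:bc} for the profiles `(f, g)`. -/
def SolvesSystem (W : ℝ → ℝ) (ε : ℝ) (k : ℤ) (f g : ℝ → ℝ) : Prop :=
  ContinuousOn f (Icc 0 1) ∧ ContinuousOn g (Icc 0 1) ∧
  ContDiffOn ℝ 2 f (Ioo 0 1) ∧ ContDiffOn ℝ 2 g (Ioo 0 1) ∧
  (∀ r ∈ Ioo (0:ℝ) 1,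
    -deriv (deriv f) r - 1 / r * deriv f r + (k : ℝ) ^ 2 / r ^ 2 * f r
      = 1 / ε ^ 2 * f r * Wd W (1 - f r ^ 2 - g r ^ 2)) ∧
  (∀ r ∈ Ioo (0:ℝ) 1,
    -deriv (deriv g) r - 1 / r * deriv g r
      = 1 / ε ^ 2 * g r * Wd W (1 - f r ^ 2 - g r ^ 2)) ∧
  f 0 = 0 ∧ f 1 = 1 ∧ derivWithin g (Icc 0 1) 0 = 0 ∧ g 1 = 0

section ODE
open Filter Topology

lemma abs_deriv_le_of_abs_sub_le {u u' u'' : ℝ → ℝ} {B C x : ℝ} (hx : 0 < x)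
    (hu : ∀ y > 0, HasDerivAt u (u' y) y) (hu' : ∀ y > 0, HasDerivAt u' (u'' y) y)
    (hB : |u (x + 1) - u x| ≤ B) (hC : ∀ y ≥ x, |u'' y| ≤ C) : |u' x| ≤ B + C := by
  obtain ⟨ξ, hξ, hξe⟩ := exists_hasDerivAt_eq_slope u u' (show x < x + 1 by linarith)
    (fun y hy => (hu y (hx.trans_le hy.1)).continuousAt.continuousWithinAt)
    (fun y hy => hu y (hx.trans hy.1))
  obtain ⟨η, hη, hηe⟩ := exists_hasDerivAt_eq_slope u' u'' hξ.1
    (fun y hy => (hu' y (hx.trans_le hy.1)).continuousAt.continuousWithinAt)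
    (fun y hy => hu' y (hx.trans hy.1))
  have h1 : u' ξ = u (x + 1) - u x := by rw [hξe]; simp
  have hpos : 0 < ξ - x := sub_pos.2 hξ.1
  have h2 : u' ξ - u' x = u'' η * (ξ - x) := by rw [hηe]; field_simp
  have h3 : |u' ξ - u' x| ≤ C := by
    rw [h2, abs_mul, abs_of_pos hpos]
    have := hC η hη.1.le
    have h4 : ξ - x ≤ 1 := by linarith [hξ.2]
    nlinarith [abs_nonneg (u'' η)]
  rw [← h1] at hB
  have : u' x = u' ξ - (u' ξ - u' x) := by ring
  rw [this]
  exact (abs_sub _ _).trans (add_le_add hB h3)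

lemma exists_abs_le_of_tendsto {u : ℝ → ℝ} {l : ℝ} (hc : ContinuousOn u (Ici 0))
    (hl : Tendsto u atTop (𝓝 l)) : ∃ B, ∀ x ≥ 0, |u x| ≤ B := by
  have h1 : ∀ᶠ x in atTop, |u x| ≤ |l| + 1 :=
    (hl.abs.eventually (eventually_le_nhds (by linarith : |l| < |l| + 1)))
  obtain ⟨a, ha⟩ := eventually_atTop.1 h1
  obtain ⟨C, hC⟩ := (isCompact_Icc (a := (0 : ℝ)) (b := a)).exists_bound_of_continuousOn
    (hc.mono Icc_subset_Ici_self)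
  refine ⟨max C (|l| + 1), fun x hx => ?_⟩
  rcases le_total x a with h | h
  · exact (hC x ⟨hx, h⟩).trans (le_max_left _ _)
  · exact (ha x h).trans (le_max_right _ _)

lemma deriv_bounded_and_tendsto_zero {u u' u'' : ℝ → ℝ} {l : ℝ} (hc : ContinuousOn u (Ici 0))
    (hu : ∀ y > 0, HasDerivAt u (u' y) y) (hu' : ∀ y > 0, HasDerivAt u' (u'' y) y)
    (hl : Tendsto u atTop (𝓝 l)) (hC : ∃ C, ∀ y > 0, |u'' y| ≤ C)
    (h0 : Tendsto u'' atTop (𝓝 0)) :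
    (∃ C, ∀ y > 0, |u' y| ≤ C) ∧ Tendsto u' atTop (𝓝 0) := by
  obtain ⟨C, hC⟩ := hC
  obtain ⟨B, hB⟩ := exists_abs_le_of_tendsto hc hl
  refine ⟨⟨2 * B + C, fun y hy => abs_deriv_le_of_abs_sub_le hy hu hu' ?_
    fun z hz => hC z (hy.trans_le hz)⟩, ?_⟩
  · have := abs_sub (u (y + 1)) (u y)
    linarith [hB (y + 1) (by linarith), hB y hy.le]
  · rw [Metric.tendsto_atTop] at h0 ⊢
    intro ε hε
    have h1 : Tendsto (fun x => u (x + 1) - u x) atTop (𝓝 0) := by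
      have := (hl.comp (tendsto_atTop_add_const_right atTop (1 : ℝ) tendsto_id)).sub hl
      simpa using this
    rw [Metric.tendsto_atTop] at h1
    obtain ⟨a, ha⟩ := h0 (ε / 3) (by linarith)
    obtain ⟨b, hb⟩ := h1 (ε / 3) (by linarith)
    refine ⟨max 1 (max a b), fun x hx => ?_⟩
    have hx1 : 1 ≤ x := (le_max_left _ _).trans hx
    have hxa : a ≤ x := (le_max_left _ _).trans ((le_max_right _ _).trans hx)
    have hxb : b ≤ x := (le_max_right _ _).trans ((le_max_right _ _).trans hx)
    have := abs_deriv_le_of_abs_sub_le (u := u) (u' := u') (u'' := u'') (B := ε / 3) (C := ε / 3)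
      (x := x) (by linarith) hu hu'
      (by simpa [Real.dist_eq] using (hb x hxb).le)
      (fun y hy => by simpa [Real.dist_eq] using (ha y (hxa.trans hy)).le)
    rw [Real.dist_eq, sub_zero]
    linarith

lemma monotoneOn_Ioi_of_deriv_right_nonneg {B B' : ℝ → ℝ}
    (hc : ContinuousOn B (Ioi 0)) (hB : ∀ x > 0, HasDerivWithinAt B (B' x) (Ici x) x)
    (h0 : ∀ x > 0, 0 ≤ B' x) : MonotoneOn B (Ioi 0) := by
  intro a ha b hb hab
  have ha' : (0 : ℝ) < a := ha
  exact image_le_of_deriv_right_le_deriv_boundary (f := fun _ => B a) (f' := fun _ => 0)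
    (B := B) (B' := B') (a := a) (b := b) continuousOn_const
    (fun x _ => hasDerivWithinAt_const _ _ _) le_rfl
    (hc.mono fun x hx => ha'.trans_le hx.1) (fun x hx => hB x (ha'.trans_le hx.1))
    (fun x hx => h0 x (ha'.trans_le hx.1)) ⟨hab, le_rfl⟩

lemma MonotoneOn.le_of_tendsto_atTop {B : ℝ → ℝ} {l : ℝ} (hB : MonotoneOn B (Ioi 0))
    (hl : Tendsto B atTop (𝓝 l)) {x : ℝ} (hx : 0 < x) : B x ≤ l :=
  ge_of_tendsto hl <| (eventually_ge_atTop x).mono fun _ hy => hB hx (hx.trans_le hy) hy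

lemma MonotoneOn.ge_of_tendsto_zero {B : ℝ → ℝ} {l : ℝ} (hB : MonotoneOn B (Ioi 0))
    (hl : Tendsto B (𝓝[>] 0) (𝓝 l)) {x : ℝ} (hx : 0 < x) : l ≤ B x :=
  le_of_tendsto hl <| by
    filter_upwards [Ioc_mem_nhdsGT hx] with y hy using hB hy.1 hx hy.2

/-- The right derivative of the positive part of a function with value `v` and derivative `d`. -/
def posPartSlope (v d : ℝ) : ℝ := if 0 < v then d else if v < 0 then 0 else max d 0

lemma hasDerivWithinAt_posPart {u : ℝ → ℝ} {d x : ℝ} (hu : HasDerivAt u d x) :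
    HasDerivWithinAt (fun y => max (u y) 0) (posPartSlope (u x) d) (Ici x) x := by
  unfold posPartSlope
  split_ifs with h1 h2
  · refine (hu.congr_of_eventuallyEq ?_).hasDerivWithinAt
    filter_upwards [hu.continuousAt.eventually (lt_mem_nhds h1)] with y hy using max_eq_left hy.le
  · refine ((hasDerivAt_const x (0 : ℝ)).congr_of_eventuallyEq ?_).hasDerivWithinAt
    filter_upwards [hu.continuousAt.eventually (gt_mem_nhds h2)] with y hy using max_eq_right hy.le
  · have hux : u x = 0 := le_antisymm (not_lt.1 h1) (not_lt.1 h2)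
    rw [← hasDerivWithinAt_Ioi_iff_Ici, hasDerivWithinAt_iff_tendsto_slope' (by simp)]
    have h := (hasDerivWithinAt_iff_tendsto_slope' (s := Ioi x) (by simp)).1 hu.hasDerivWithinAt
    refine (h.max (tendsto_const_nhds (x := (0 : ℝ)))).congr' ?_
    filter_upwards [self_mem_nhdsWithin] with y hy
    have hy' : 0 < y - x := sub_pos.2 hy
    simp only [slope_def_field, hux, sub_zero, max_self]
    rw [← max_div_div_right hy'.le, zero_div]

lemma hasDerivWithinAt_posPart_mul {u u' : ℝ → ℝ} {d x : ℝ} (hu : HasDerivAt u (u' x) x)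
    (hu' : HasDerivAt u' d x) :
    HasDerivWithinAt (fun y => max (u y) 0 * u' y)
      (posPartSlope (u x) (u' x) ^ 2 + max (u x) 0 * d) (Ici x) x := by
  have h := (hasDerivWithinAt_posPart hu).mul hu'.hasDerivWithinAt
  refine h.congr_deriv ?_
  congr 1
  unfold posPartSlope
  split_ifs with h1 h2
  · ring
  · ring
  · rcases le_total (u' x) 0 with h | h
    · simp [h]
    · simp [h]; ring

end ODE

section Profile
open Filter Topology

/-- The system in the variable `x = -log r`: `f'' = (κ² - V) f`, `g'' = -V g` on `(0, ∞)` with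
`V x = lam e^{-2x} w(1 - f² - g²)`. -/
structure IsProfile (w : ℝ → ℝ) (lam κ : ℝ) (f f' g g' : ℝ → ℝ) : Prop where
  contf : ContinuousOn f (Ici 0)
  contg : ContinuousOn g (Ici 0)
  df : ∀ x > 0, HasDerivAt f (f' x) x
  ddf : ∀ x > 0, HasDerivAt f'
    ((κ ^ 2 - lam * Real.exp (-2 * x) * w (1 - f x ^ 2 - g x ^ 2)) * f x) x
  dg : ∀ x > 0, HasDerivAt g (g' x) x
  ddg : ∀ x > 0, HasDerivAt g' (-(lam * Real.exp (-2 * x) * w (1 - f x ^ 2 - g x ^ 2)) * g x) x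
  g0 : g 0 = 0
  limf : Tendsto f atTop (𝓝 0)
  limg : ∃ L, Tendsto g atTop (𝓝 L)
  wbdd : ∃ M, ∀ x ≥ 0, |w (1 - f x ^ 2 - g x ^ 2)| ≤ M

lemma tendsto_exp_neg_two_mul_atTop : Tendsto (fun x : ℝ => Real.exp (-2 * x)) atTop (𝓝 0) :=
  Real.tendsto_exp_atBot.comp (tendsto_id.const_mul_atTop_of_neg (by norm_num))

lemma tendsto_mul_zero_of_abs_le {u v : ℝ → ℝ} {F : Filter ℝ} {C : ℝ} (hu : Tendsto u F (𝓝 0))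
    (hv : ∀ᶠ x in F, |v x| ≤ C) : Tendsto (fun x => u x * v x) F (𝓝 0) := by
  refine squeeze_zero_norm' (a := fun x => |u x| * C) ?_ (by simpa using hu.abs.mul_const C)
  filter_upwards [hv] with x hx
  rw [Real.norm_eq_abs, abs_mul]
  gcongr

namespace IsProfile

variable {w : ℝ → ℝ} {lam κ : ℝ} {f f' g g' : ℝ → ℝ}

lemma exists_abs_f_le (h : IsProfile w lam κ f f' g g') : ∃ B, ∀ x ≥ 0, |f x| ≤ B :=
  exists_abs_le_of_tendsto h.contf h.limf

lemma exists_abs_g_le (h : IsProfile w lam κ f f' g g') : ∃ B, ∀ x ≥ 0, |g x| ≤ B :=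
  let ⟨_, hL⟩ := h.limg
  exists_abs_le_of_tendsto h.contg hL

lemma exists_abs_pot_le (h : IsProfile w lam κ f f' g g') :
    ∃ M ≥ 0, ∀ x ≥ 0, |lam * Real.exp (-2 * x) * w (1 - f x ^ 2 - g x ^ 2)|
      ≤ M * Real.exp (-2 * x) := by
  obtain ⟨M, hM⟩ := h.wbdd
  refine ⟨|lam| * M, mul_nonneg (abs_nonneg _) ((abs_nonneg _).trans (hM 0 le_rfl)),
    fun x hx => ?_⟩
  rw [abs_mul, abs_mul, Real.abs_exp]
  nlinarith [mul_le_mul_of_nonneg_left (hM x hx)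
    (mul_nonneg (abs_nonneg lam) (Real.exp_pos (-2 * x)).le)]

lemma f'_bounded_tendsto (h : IsProfile w lam κ f f' g g') :
    (∃ C, ∀ y > 0, |f' y| ≤ C) ∧ Tendsto f' atTop (𝓝 0) := by
  obtain ⟨M, hM0, hM⟩ := h.exists_abs_pot_le
  obtain ⟨B, hB⟩ := h.exists_abs_f_le
  have key : ∀ x ≥ 0, |κ ^ 2 - lam * Real.exp (-2 * x) * w (1 - f x ^ 2 - g x ^ 2)|
      ≤ κ ^ 2 + M := fun x hx => by
    refine (abs_sub _ _).trans ?_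
    rw [abs_of_nonneg (sq_nonneg κ)]
    have h1 := hM x hx
    have h2 : Real.exp (-2 * x) ≤ 1 := Real.exp_le_one_iff.2 (by linarith)
    nlinarith
  refine deriv_bounded_and_tendsto_zero h.contf h.df h.ddf h.limf
    ⟨(κ ^ 2 + M) * B, fun y hy => ?_⟩ ?_
  · rw [abs_mul]
    exact mul_le_mul (key y hy.le) (hB y hy.le) (abs_nonneg _) (by positivity)
  · refine (tendsto_mul_zero_of_abs_le (C := κ ^ 2 + M) h.limf ?_).congr (fun x => mul_comm _ _)
    filter_upwards [eventually_ge_atTop 0] with x hx using key x hx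

lemma g'_bounded_tendsto (h : IsProfile w lam κ f f' g g') :
    (∃ C, ∀ y > 0, |g' y| ≤ C) ∧ Tendsto g' atTop (𝓝 0) := by
  obtain ⟨M, hM0, hM⟩ := h.exists_abs_pot_le
  obtain ⟨B, hB⟩ := h.exists_abs_g_le
  obtain ⟨L, hL⟩ := h.limg
  have key : ∀ x ≥ 0, |-(lam * Real.exp (-2 * x) * w (1 - f x ^ 2 - g x ^ 2)) * g x|
      ≤ M * B * Real.exp (-2 * x) := fun x hx => by
    rw [abs_mul, abs_neg]
    have := mul_le_mul (hM x hx) (hB x hx) (abs_nonneg _) (by positivity)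
    linarith
  have hB0 : 0 ≤ B := (abs_nonneg _).trans (hB 0 le_rfl)
  refine deriv_bounded_and_tendsto_zero h.contg h.dg h.ddg hL ⟨M * B, fun y hy => ?_⟩ ?_
  · refine (key y hy.le).trans ?_
    have h2 : Real.exp (-2 * y) ≤ 1 := Real.exp_le_one_iff.2 (by linarith)
    exact mul_le_of_le_one_right (by positivity) h2
  · refine squeeze_zero_norm' (a := fun x => M * B * Real.exp (-2 * x)) ?_
      (by simpa using tendsto_exp_neg_two_mul_atTop.const_mul (M * B))
    filter_upwards [eventually_ge_atTop 0] with x hx using key x hx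

/-- Maximum principle. -/
lemma sq_add_sq_le_one (h : IsProfile w lam κ f f' g g') (hlam : 0 ≤ lam)
    (hw : ∀ t < 0, w t ≤ 0) (h0 : f 0 ^ 2 ≤ 1) : ∀ x ≥ 0, f x ^ 2 + g x ^ 2 ≤ 1 := by
  obtain ⟨Bf, hBf⟩ := h.exists_abs_f_le
  obtain ⟨Bg, hBg⟩ := h.exists_abs_g_le
  set u : ℝ → ℝ := fun x => f x ^ 2 + g x ^ 2 - 1 with hu
  set u' : ℝ → ℝ := fun x => 2 * (f x * f' x + g x * g' x) with hu'
  have du : ∀ x > 0, HasDerivAt u (u' x) x := fun x hx => by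
    refine ((((h.df x hx).pow 2).add ((h.dg x hx).pow 2)).sub_const 1).congr_deriv ?_
    simp [hu']; ring
  have du' : ∀ x > 0, HasDerivAt u' (2 * (f' x ^ 2 + g' x ^ 2 + κ ^ 2 * f x ^ 2
      - lam * Real.exp (-2 * x) * w (1 - f x ^ 2 - g x ^ 2) * (f x ^ 2 + g x ^ 2))) x :=
      fun x hx => by
    refine ((((h.df x hx).mul (h.ddf x hx)).add
      ((h.dg x hx).mul (h.ddg x hx))).const_mul 2).congr_deriv ?_
    ring
  have hmono : MonotoneOn (fun y => max (u y) 0 * u' y) (Ioi 0) := by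
    refine monotoneOn_Ioi_of_deriv_right_nonneg
      (fun x hx => ContinuousAt.continuousWithinAt ?_)
      (fun x hx => hasDerivWithinAt_posPart_mul (du x hx) (du' x hx)) fun x hx => ?_
    · exact ((du x hx).continuousAt.max continuousAt_const).mul (du' x hx).continuousAt
    · rcases le_or_gt (u x) 0 with hux | hux
      · rw [max_eq_right hux, zero_mul, add_zero]; positivity
      · have h1 : w (1 - f x ^ 2 - g x ^ 2) ≤ 0 := hw _ (by simp only [hu] at hux; linarith)
        have h2 : 0 ≤ -(lam * Real.exp (-2 * x) * w (1 - f x ^ 2 - g x ^ 2)) := by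
          rw [← mul_neg]
          exact mul_nonneg (mul_nonneg hlam (Real.exp_pos _).le) (by linarith)
        have h3 := mul_nonneg h2 (add_nonneg (sq_nonneg (f x)) (sq_nonneg (g x)))
        refine add_nonneg (sq_nonneg _) (mul_nonneg (le_max_right _ _) ?_)
        have := sq_nonneg (κ * f x)
        nlinarith [sq_nonneg (f' x), sq_nonneg (g' x)]
  have hlim : Tendsto (fun y => max (u y) 0 * u' y) atTop (𝓝 0) := by
    obtain ⟨L, hL⟩ := h.limg
    have h1 := ((((h.limf.pow 2).add (hL.pow 2)).sub_const 1).max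
      (tendsto_const_nhds (x := (0 : ℝ)))).mul
      (((h.limf.mul h.f'_bounded_tendsto.2).add (hL.mul h.g'_bounded_tendsto.2)).const_mul 2)
    simpa using h1
  have hle : ∀ x > 0, max (u x) 0 * u' x ≤ 0 := fun x hx => hmono.le_of_tendsto_atTop hlim hx
  have hcu : ContinuousOn u (Ici 0) := ((h.contf.pow 2).add (h.contg.pow 2)).sub continuousOn_const
  intro x hx
  have hanti : (fun y => max (u y) 0 ^ 2) x ≤ (fun y => max (u 0) 0 ^ 2) x := by
    have hc2 : ContinuousOn (fun y => max (u y) 0 ^ 2) (Icc 0 x) :=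
      ((hcu.mono Icc_subset_Ici_self).sup continuousOn_const).pow 2
    have hd : ∀ y > 0, HasDerivAt (fun y => max (u y) 0 ^ 2) (2 * (max (u y) 0 * u' y)) y := by
      intro y hy
      have hsq : ∀ t : ℝ, HasDerivAt (fun t : ℝ => max t 0 ^ 2) (2 * max t 0) t := by
        intro t
        rcases lt_trichotomy t 0 with ht | ht | ht
        · rw [max_eq_right ht.le]
          refine (((hasDerivAt_const t (0 : ℝ)).congr_of_eventuallyEq ?_)).congr_deriv (by ring)
          filter_upwards [gt_mem_nhds ht] with s hs
          simp [max_eq_right (le_of_lt hs)]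
        · subst ht
          rw [hasDerivAt_iff_isLittleO]
          simp only [max_self, sub_zero, mul_zero, smul_zero]
          have : (fun x : ℝ => max x 0 ^ 2 - 0 ^ 2) =O[𝓝 0] fun x => x ^ 2 := by
            refine Asymptotics.IsBigO.of_bound 1 (Eventually.of_forall fun s => ?_)
            simp only [Real.norm_eq_abs, one_mul]
            rcases le_total s 0 with hs | hs
            · simp [max_eq_right hs, sq_nonneg]
            · simp [max_eq_left hs]
          refine this.trans_isLittleO ?_
          exact Asymptotics.isLittleO_pow_id one_lt_two
        · rw [max_eq_left ht.le]
          refine (((hasDerivAt_pow 2 t).congr_of_eventuallyEq ?_)).congr_deriv (by simp)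
          filter_upwards [lt_mem_nhds ht] with s hs
          simp [max_eq_left (le_of_lt hs)]
      refine ((hsq (u y)).comp y (du y hy)).congr_deriv (by ring)
    have : AntitoneOn (fun y => max (u y) 0 ^ 2) (Icc 0 x) := by
      refine antitoneOn_of_deriv_nonpos (convex_Icc _ _) hc2 ?_ ?_
      · intro y hy
        rw [interior_Icc] at hy
        exact (hd y hy.1).differentiableAt.differentiableWithinAt
      · intro y hy
        rw [interior_Icc] at hy
        rw [(hd y hy.1).deriv]
        linarith [hle y hy.1]
    exact this ⟨le_rfl, hx⟩ ⟨hx, le_rfl⟩ hx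
  have hu0 : max (u 0) 0 = 0 := max_eq_right (by simp only [hu, h.g0]; nlinarith)
  simp only [hu0] at hanti
  have : max (u x) 0 ≤ 0 := by nlinarith [le_max_right (u x) 0]
  have := (le_max_left (u x) 0).trans this
  simp only [hu] at this
  linarith

/-- Two potentials that agree along the profile. -/
lemma congr_pot {w' : ℝ → ℝ} (h : IsProfile w lam κ f f' g g')
    (hw : ∀ x ≥ 0, w' (1 - f x ^ 2 - g x ^ 2) = w (1 - f x ^ 2 - g x ^ 2)) :
    IsProfile w' lam κ f f' g g' where
  contf := h.contf
  contg := h.contg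
  df := h.df
  ddf x hx := by rw [hw x hx.le]; exact h.ddf x hx
  dg := h.dg
  ddg x hx := by rw [hw x hx.le]; exact h.ddg x hx
  g0 := h.g0
  limf := h.limf
  limg := h.limg
  wbdd := let ⟨M, hM⟩ := h.wbdd; ⟨M, fun x hx => by rw [hw x hx]; exact hM x hx⟩

end IsProfile

end Profile

section Uniqueness
open Filter Topology

/-- A truncated potential derivative. -/
structure IsPot (w : ℝ → ℝ) : Prop where
  cont : Continuous w
  mono : Monotone w
  zero : ∀ t ≤ 0, w t = 0
  strict : StrictMonoOn w (Icc 0 1)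

lemma IsPot.nonneg {w : ℝ → ℝ} (hw : IsPot w) (t : ℝ) : 0 ≤ w t := by
  rcases le_total t 0 with h | h
  · exact (hw.zero t h).ge
  · exact (hw.zero 0 le_rfl).ge.trans (hw.mono h)

lemma le_mul_of_abs_deriv_le {u u' : ℝ → ℝ} {C : ℝ} (hc : ContinuousOn u (Ici 0))
    (hu : ∀ x > 0, HasDerivAt u (u' x) x) (hC : ∀ x > 0, |u' x| ≤ C) (h0 : u 0 ≤ 0) :
    ∀ x ≥ 0, u x ≤ C * x := by
  intro x hx
  rcases hx.eq_or_lt with rfl | hx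
  · simpa using h0
  obtain ⟨ξ, hξ, hξe⟩ := exists_hasDerivAt_eq_slope u u' hx (hc.mono Icc_subset_Ici_self)
    (fun y hy => hu y hy.1)
  have h1 : u x - u 0 = u' ξ * x := by rw [hξe]; field_simp; ring
  have h2 := (abs_le.1 (hC ξ hξ.1)).2
  nlinarith

/-- Picone's identity. -/
lemma hasDerivWithinAt_sq_mul_logDeriv {φ g g' : ℝ → ℝ} {p V x : ℝ}
    (hφ : HasDerivWithinAt φ p (Ici x) x) (hg : HasDerivAt g (g' x) x)
    (hg' : HasDerivAt g' (-V * g x) x) (hpos : 0 < g x) :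
    HasDerivWithinAt (fun y => φ y ^ 2 * (g' y / g y))
      (p ^ 2 - V * φ x ^ 2 - (p - φ x * (g' x / g x)) ^ 2) (Ici x) x := by
  refine ((hφ.pow 2).mul (hg'.div hg hpos.ne').hasDerivWithinAt).congr_deriv ?_
  simp only [Nat.cast_ofNat, Nat.add_one_sub_one, pow_one, Pi.div_apply, Pi.pow_apply]
  have := hpos.ne'
  field_simp
  ring

namespace IsProfile

variable {w : ℝ → ℝ} {lam κ : ℝ} {f f' g g' : ℝ → ℝ}

lemma g'_nonneg (h : IsProfile w lam κ f f' g g') (hlam : 0 ≤ lam) (hw : IsPot w)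
    (hg : ∀ x > 0, 0 < g x) : ∀ x > 0, 0 ≤ g' x := by
  have hmono : MonotoneOn (fun x => -g' x) (Ioi 0) := by
    refine monotoneOn_Ioi_of_deriv_right_nonneg
      (B' := fun x => lam * Real.exp (-2 * x) * w (1 - f x ^ 2 - g x ^ 2) * g x)
      (fun x hx => (h.ddg x hx).neg.continuousAt.continuousWithinAt)
      (fun x hx => ((h.ddg x hx).neg.congr_deriv (by ring)).hasDerivWithinAt) fun x hx => ?_
    exact mul_nonneg (mul_nonneg (mul_nonneg hlam (Real.exp_pos _).le) (hw.nonneg _)) (hg x hx).le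
  intro x hx
  have := hmono.le_of_tendsto_atTop (by simpa using h.g'_bounded_tendsto.2.neg) hx
  linarith

lemma mul_g'_le (h : IsProfile w lam κ f f' g g') (hlam : 0 ≤ lam) (hw : IsPot w)
    (hg : ∀ x > 0, 0 < g x) : ∀ x > 0, x * g' x ≤ g x := by
  have hmono : MonotoneOn (fun x => g x - x * g' x) (Ioi 0) := by
    refine monotoneOn_Ioi_of_deriv_right_nonneg
      (B' := fun x => x * (lam * Real.exp (-2 * x) * w (1 - f x ^ 2 - g x ^ 2) * g x))
      (fun x hx => ((h.dg x hx).sub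
        ((hasDerivAt_id x).mul (h.ddg x hx))).continuousAt.continuousWithinAt)
      (fun x hx => (((h.dg x hx).sub
        ((hasDerivAt_id x).mul (h.ddg x hx))).congr_deriv (by simp)).hasDerivWithinAt)
      fun x hx => ?_
    exact mul_nonneg hx.le (mul_nonneg (mul_nonneg (mul_nonneg hlam (Real.exp_pos _).le)
      (hw.nonneg _)) (hg x hx).le)
  obtain ⟨C, hC⟩ := h.g'_bounded_tendsto.1
  have hlim : Tendsto (fun x => g x - x * g' x) (𝓝[>] 0) (𝓝 0) := by
    have h1 : Tendsto g (𝓝[>] 0) (𝓝 0) := by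
      have := (h.contg 0 self_mem_Ici).mono_left (nhdsWithin_mono 0 Ioi_subset_Ici_self)
      rwa [h.g0] at this
    have h2 : Tendsto (fun x => x * g' x) (𝓝[>] 0) (𝓝 0) :=
      tendsto_mul_zero_of_abs_le (C := C) (tendsto_id.mono_left nhdsWithin_le_nhds)
        (by filter_upwards [self_mem_nhdsWithin] with x hx using hC x hx)
    simpa using h1.sub h2
  intro x hx
  linarith [hmono.ge_of_tendsto_zero hlim hx]

lemma logDeriv_nonneg (h : IsProfile w lam κ f f' g g') (hlam : 0 ≤ lam) (hw : IsPot w)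
    (hg : ∀ x > 0, 0 < g x) {x : ℝ} (hx : 0 < x) : 0 ≤ g' x / g x :=
  div_nonneg (h.g'_nonneg hlam hw hg x hx) (hg x hx).le

lemma logDeriv_le (h : IsProfile w lam κ f f' g g') (hlam : 0 ≤ lam) (hw : IsPot w)
    (hg : ∀ x > 0, 0 < g x) {x : ℝ} (hx : 0 < x) : g' x / g x ≤ 1 / x := by
  rw [div_le_div_iff₀ (hg x hx) hx]
  linarith [h.mul_g'_le hlam hw hg x hx]

/-- `g` is close to its limit at infinity. -/
lemma limit_sub_le (h : IsProfile w lam κ f f' g g') (hlam : 0 ≤ lam) (hw : IsPot w)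
    (hg : ∀ x > 0, 0 < g x) {L : ℝ} (hL : Tendsto g atTop (𝓝 L)) :
    0 < L ∧ ∀ x ≥ 0, g x ≤ L ∧ L - g x ≤ lam * w 1 * L / 4 * Real.exp (-2 * x) := by
  have hgm : MonotoneOn g (Ioi 0) := monotoneOn_Ioi_of_deriv_right_nonneg
    (fun x hx => (h.dg x hx).continuousAt.continuousWithinAt)
    (fun x hx => (h.dg x hx).hasDerivWithinAt) (h.g'_nonneg hlam hw hg)
  have hgL : ∀ x > 0, g x ≤ L := fun x hx => hgm.le_of_tendsto_atTop hL hx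
  have hL0 : 0 < L := (hg 1 one_pos).trans_le (hgL 1 one_pos)
  have hE : ∀ x : ℝ, HasDerivAt (fun x : ℝ => Real.exp (-2 * x)) (-2 * Real.exp (-2 * x)) x :=
    fun x => (((hasDerivAt_id x).const_mul (-2)).exp).congr_deriv (by simp; ring)
  set A := lam * w 1 * L with hA
  have hm1 : MonotoneOn (fun x => g' x - A / 2 * Real.exp (-2 * x)) (Ioi 0) := by
    refine monotoneOn_Ioi_of_deriv_right_nonneg
      (fun x hx => ((h.ddg x hx).sub ((hE x).const_mul (A / 2))).continuousAt.continuousWithinAt)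
      (fun x hx => ((h.ddg x hx).sub ((hE x).const_mul (A / 2))).hasDerivWithinAt) fun x hx => ?_
    have h1 : w (1 - f x ^ 2 - g x ^ 2) * g x ≤ w 1 * L :=
      mul_le_mul (hw.mono (by nlinarith)) (hgL x hx) (hg x hx).le (hw.nonneg _)
    have h2 := mul_le_mul_of_nonneg_left h1 (mul_nonneg hlam (Real.exp_pos (-2 * x)).le)
    rw [hA]
    nlinarith
  have hg' : ∀ x > 0, g' x ≤ A / 2 * Real.exp (-2 * x) := fun x hx => by
    have := hm1.le_of_tendsto_atTop (l := 0) (by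
      simpa using h.g'_bounded_tendsto.2.sub (tendsto_exp_neg_two_mul_atTop.const_mul (A / 2))) hx
    linarith
  have hm2 : MonotoneOn (fun x => -(g x + A / 4 * Real.exp (-2 * x))) (Ioi 0) := by
    refine monotoneOn_Ioi_of_deriv_right_nonneg
      (fun x hx => ((h.dg x hx).add ((hE x).const_mul (A / 4))).neg.continuousAt.continuousWithinAt)
      (fun x hx => ((h.dg x hx).add ((hE x).const_mul (A / 4))).neg.hasDerivWithinAt) fun x hx => ?_
    linarith [hg' x hx]
  have hfin : ∀ x > 0, g x ≤ L ∧ L - g x ≤ A / 4 * Real.exp (-2 * x) := fun x hx => by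
    have := hm2.le_of_tendsto_atTop (l := -L) (by
      simpa using (hL.add (tendsto_exp_neg_two_mul_atTop.const_mul (A / 4))).neg) hx
    exact ⟨hgL x hx, by linarith⟩
  refine ⟨hL0, fun x hx => ?_⟩
  rcases hx.eq_or_lt with rfl | hx
  · have hcg : Tendsto g (𝓝[>] 0) (𝓝 (g 0)) :=
      (h.contg 0 self_mem_Ici).mono_left (nhdsWithin_mono 0 Ioi_subset_Ici_self)
    have hce : Tendsto (fun x => A / 4 * Real.exp (-2 * x)) (𝓝[>] 0)
        (𝓝 (A / 4 * Real.exp (-2 * 0))) :=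
      ((hE 0).continuousAt.tendsto.const_mul (A / 4)).mono_left nhdsWithin_le_nhds
    refine ⟨le_of_tendsto hcg ?_, le_of_tendsto_of_tendsto (hcg.const_sub L) hce ?_⟩
    · filter_upwards [self_mem_nhdsWithin] with x hx using hgL x hx
    · filter_upwards [self_mem_nhdsWithin] with x hx using (hfin x hx).2
  · exact hfin x hx

lemma four_le_of_pos (h : IsProfile w lam κ f f' g g') (hlam : 0 ≤ lam) (hw : IsPot w)
    (hg : ∀ x > 0, 0 < g x) : 4 ≤ lam * w 1 := by
  obtain ⟨L, hL⟩ := h.limg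
  obtain ⟨hL0, h1⟩ := h.limit_sub_le hlam hw hg hL
  have := (h1 0 le_rfl).2
  rw [h.g0, mul_zero, Real.exp_zero] at this
  by_contra hlt
  nlinarith

lemma pot_sub_mul_le {r s : ℝ} (hw : IsPot w) : (w (1 - r) - w (1 - s)) * (r - s) ≤ 0 := by
  rcases le_total r s with h | h
  · exact mul_nonpos_of_nonneg_of_nonpos
      (sub_nonneg.2 (hw.mono (by linarith))) (by linarith)
  · exact mul_nonpos_of_nonpos_of_nonneg
      (sub_nonpos.2 (hw.mono (by linarith))) (by linarith)

/-- Uniqueness of profiles with positive second component. -/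
theorem unique {f₁ f₁' g₁ g₁' f₂ f₂' g₂ g₂' : ℝ → ℝ} (h₁ : IsProfile w lam κ f₁ f₁' g₁ g₁')
    (h₂ : IsProfile w lam κ f₂ f₂' g₂ g₂') (hlam : 0 < lam) (hκ : 0 < κ) (hw : IsPot w)
    (hf₁ : f₁ 0 = 1) (hf₂ : f₂ 0 = 1) (hg₁ : ∀ x > 0, 0 < g₁ x) (hg₂ : ∀ x > 0, 0 < g₂ x) :
    ∀ x > 0, f₁ x = f₂ x ∧ g₁ x = g₂ x := by
  have hw' : ∀ t < 0, w t ≤ 0 := fun t ht => (hw.zero t ht.le).le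
  have hρ₁ := h₁.sq_add_sq_le_one hlam.le hw' (by rw [hf₁]; norm_num)
  have hρ₂ := h₂.sq_add_sq_le_one hlam.le hw' (by rw [hf₂]; norm_num)
  set φ : ℝ → ℝ := fun x => f₁ x - f₂ x with hφ
  set φ' : ℝ → ℝ := fun x => f₁' x - f₂' x with hφ'
  set ψ : ℝ → ℝ := fun x => g₁ x - g₂ x with hψ
  set ψ' : ℝ → ℝ := fun x => g₁' x - g₂' x with hψ'
  have dφ : ∀ x > 0, HasDerivAt φ (φ' x) x := fun x hx => (h₁.df x hx).sub (h₂.df x hx)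
  have dψ : ∀ x > 0, HasDerivAt ψ (ψ' x) x := fun x hx => (h₁.dg x hx).sub (h₂.dg x hx)
  have dφ' := fun x (hx : x > 0) => (h₁.ddf x hx).sub (h₂.ddf x hx)
  have dψ' := fun x (hx : x > 0) => (h₁.ddg x hx).sub (h₂.ddg x hx)
  set N : ℝ → ℝ := fun x => 2 * (φ x * φ' x + ψ x * ψ' x) with hN
  set Z : ℝ → ℝ := fun x => N x - (φ x ^ 2 * (g₁' x / g₁ x) + φ x ^ 2 * (g₂' x / g₂ x)
      + ψ x ^ 2 * (g₁' x / g₁ x) + ψ x ^ 2 * (g₂' x / g₂ x)) with hZ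
  set S : ℝ → ℝ := fun x => (φ' x - φ x * (g₁' x / g₁ x)) ^ 2 + (φ' x - φ x * (g₂' x / g₂ x)) ^ 2
    + (ψ' x - ψ x * (g₁' x / g₁ x)) ^ 2 + (ψ' x - ψ x * (g₂' x / g₂ x)) ^ 2 with hS
  set J : ℝ → ℝ := fun x => lam * Real.exp (-2 * x) *
    ((w (1 - (f₁ x ^ 2 + g₁ x ^ 2)) - w (1 - (f₂ x ^ 2 + g₂ x ^ 2))) *
      ((f₁ x ^ 2 + g₁ x ^ 2) - (f₂ x ^ 2 + g₂ x ^ 2))) with hJ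
  have hJ0 : ∀ x, J x ≤ 0 := fun x =>
    mul_nonpos_of_nonneg_of_nonpos (by positivity) (pot_sub_mul_le hw)
  have hS0 : ∀ x, 0 ≤ S x := fun x => by simp only [hS]; positivity
  have dZ : ∀ x > 0, HasDerivWithinAt Z (2 * κ ^ 2 * φ x ^ 2 - J x + S x) (Ici x) x := by
    intro x hx
    have hA := hasDerivWithinAt_sq_mul_logDeriv (dφ x hx).hasDerivWithinAt
      (h₁.dg x hx) (h₁.ddg x hx) (hg₁ x hx)
    have hB := hasDerivWithinAt_sq_mul_logDeriv (dφ x hx).hasDerivWithinAt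
      (h₂.dg x hx) (h₂.ddg x hx) (hg₂ x hx)
    have hC := hasDerivWithinAt_sq_mul_logDeriv (dψ x hx).hasDerivWithinAt
      (h₁.dg x hx) (h₁.ddg x hx) (hg₁ x hx)
    have hD := hasDerivWithinAt_sq_mul_logDeriv (dψ x hx).hasDerivWithinAt
      (h₂.dg x hx) (h₂.ddg x hx) (hg₂ x hx)
    have hE := ((((dφ x hx).mul (dφ' x hx)).add ((dψ x hx).mul (dψ' x hx))).const_mul
      2).hasDerivWithinAt (s := Ici x)
    refine (hE.sub (((hA.add hB).add hC).add hD)).congr_deriv ?_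
    simp only [hJ, hS, hφ, hψ, hφ', hψ', Pi.sub_apply, sub_sub]
    ring
  have cZ : ContinuousOn Z (Ioi 0) := fun x hx => by
    have hx : 0 < x := hx
    have c1 := (h₁.ddg x hx).continuousAt.div (h₁.dg x hx).continuousAt (hg₁ x hx).ne'
    have c2 := (h₂.ddg x hx).continuousAt.div (h₂.dg x hx).continuousAt (hg₂ x hx).ne'
    have c3 := (dφ x hx).continuousAt
    have c4 := (dψ x hx).continuousAt
    have c5 : ContinuousAt φ' x := (dφ' x hx).continuousAt
    have c6 : ContinuousAt ψ' x := (dψ' x hx).continuousAt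
    refine ContinuousAt.continuousWithinAt ?_
    exact (((c3.mul c5).add (c4.mul c6)).const_mul 2).sub
      (((((c3.pow 2).mul c1).add ((c3.pow 2).mul c2)).add ((c4.pow 2).mul c1)).add
        ((c4.pow 2).mul c2))
  have hmono : MonotoneOn Z (Ioi 0) := monotoneOn_Ioi_of_deriv_right_nonneg cZ dZ fun x hx => by
    have := hJ0 x; have := hS0 x; have := mul_nonneg (sq_nonneg κ) (sq_nonneg (φ x)); linarith
  obtain ⟨C₁, hC₁⟩ := h₁.f'_bounded_tendsto.1
  obtain ⟨C₂, hC₂⟩ := h₂.f'_bounded_tendsto.1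
  obtain ⟨D₁, hD₁⟩ := h₁.g'_bounded_tendsto.1
  obtain ⟨D₂, hD₂⟩ := h₂.g'_bounded_tendsto.1
  have hφ'b : ∀ x > 0, |φ' x| ≤ C₁ + C₂ := fun x hx =>
    (abs_sub _ _).trans (add_le_add (hC₁ x hx) (hC₂ x hx))
  have hψ'b : ∀ x > 0, |ψ' x| ≤ D₁ + D₂ := fun x hx =>
    (abs_sub _ _).trans (add_le_add (hD₁ x hx) (hD₂ x hx))
  have hφb : ∀ x > 0, |φ x| ≤ (C₁ + C₂) * x := fun x hx => by
    have h1 := le_mul_of_abs_deriv_le (h₁.contf.sub h₂.contf) dφ hφ'b (by simp [hf₁, hf₂]) x hx.le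
    have h2 := le_mul_of_abs_deriv_le (h₁.contf.sub h₂.contf).neg (fun y hy => (dφ y hy).neg)
      (fun y hy => by rw [abs_neg]; exact hφ'b y hy) (by simp [hf₁, hf₂]) x hx.le
    exact abs_le.2 ⟨by simp only [Pi.neg_apply, Pi.sub_apply] at h2; simp only [hφ]; linarith, h1⟩
  have hψb : ∀ x > 0, |ψ x| ≤ (D₁ + D₂) * x := fun x hx => by
    have h1 := le_mul_of_abs_deriv_le (h₁.contg.sub h₂.contg) dψ hψ'b (by simp [h₁.g0, h₂.g0])
      x hx.le
    have h2 := le_mul_of_abs_deriv_le (h₁.contg.sub h₂.contg).neg (fun y hy => (dψ y hy).neg)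
      (fun y hy => by rw [abs_neg]; exact hψ'b y hy) (by simp [h₁.g0, h₂.g0]) x hx.le
    exact abs_le.2 ⟨by simp only [Pi.neg_apply, Pi.sub_apply] at h2; simp only [hψ]; linarith, h1⟩
  have hZN : ∀ x > 0, Z x ≤ N x := fun x hx => by
    have l1 := h₁.logDeriv_nonneg hlam.le hw hg₁ hx
    have l2 := h₂.logDeriv_nonneg hlam.le hw hg₂ hx
    simp only [hZ]
    have : 0 ≤ φ x ^ 2 * (g₁' x / g₁ x) + φ x ^ 2 * (g₂' x / g₂ x)
      + ψ x ^ 2 * (g₁' x / g₁ x) + ψ x ^ 2 * (g₂' x / g₂ x) := by positivity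
    linarith
  have hZ_le : ∀ x > 0, Z x ≤ 0 := by
    intro x hx
    obtain ⟨L₁, hL₁⟩ := h₁.limg
    obtain ⟨L₂, hL₂⟩ := h₂.limg
    have hNlim : Tendsto N atTop (𝓝 0) := by
      have := (((h₁.limf.sub h₂.limf).mul (h₁.f'_bounded_tendsto.2.sub h₂.f'_bounded_tendsto.2)).add
        ((hL₁.sub hL₂).mul (h₁.g'_bounded_tendsto.2.sub h₂.g'_bounded_tendsto.2))).const_mul 2
      simpa using this
    refine ge_of_tendsto hNlim ?_
    filter_upwards [eventually_ge_atTop x] with y hy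
    exact (hmono hx (hx.trans_le hy) hy).trans (hZN y (hx.trans_le hy))
  have hZ_ge : ∀ x > 0, 0 ≤ Z x := by
    intro x hx
    set K := 4 * ((C₁ + C₂) ^ 2 + (D₁ + D₂) ^ 2) with hK
    have hlow : ∀ y > 0, -(K * y) ≤ Z y := by
      intro y hy
      have l1 := h₁.logDeriv_le hlam.le hw hg₁ hy
      have l2 := h₂.logDeriv_le hlam.le hw hg₂ hy
      have sφ : φ y ^ 2 ≤ ((C₁ + C₂) * y) ^ 2 := sq_le_sq' (by linarith [(abs_le.1 (hφb y hy)).1])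
        (abs_le.1 (hφb y hy)).2
      have sψ : ψ y ^ 2 ≤ ((D₁ + D₂) * y) ^ 2 := sq_le_sq' (by linarith [(abs_le.1 (hψb y hy)).1])
        (abs_le.1 (hψb y hy)).2
      have b : ∀ {a c l : ℝ}, a ^ 2 ≤ (c * y) ^ 2 → l ≤ 1 / y → a ^ 2 * l ≤ c ^ 2 * y := by
        intro a c l ha hl
        calc a ^ 2 * l ≤ a ^ 2 * (1 / y) := mul_le_mul_of_nonneg_left hl (sq_nonneg _)
          _ ≤ (c * y) ^ 2 * (1 / y) := mul_le_mul_of_nonneg_right ha (by positivity)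
          _ = c ^ 2 * y := by field_simp
      have p1 : -((C₁ + C₂) ^ 2 * y) ≤ φ y * φ' y := by
        have := mul_le_mul (hφb y hy) (hφ'b y hy) (abs_nonneg _) ((abs_nonneg _).trans (hφb y hy))
        rw [← abs_mul] at this
        linarith [neg_abs_le (φ y * φ' y)]
      have p2 : -((D₁ + D₂) ^ 2 * y) ≤ ψ y * ψ' y := by
        have := mul_le_mul (hψb y hy) (hψ'b y hy) (abs_nonneg _) ((abs_nonneg _).trans (hψb y hy))
        rw [← abs_mul] at this
        linarith [neg_abs_le (ψ y * ψ' y)]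
      simp only [hZ, hN]
      linarith [b sφ l1, b sφ l2, b sψ l1, b sψ l2]
    have hlim : Tendsto (fun y => -(K * y)) (𝓝[>] 0) (𝓝 0) := by
      have : Tendsto (fun y => -(K * y)) (𝓝 0) (𝓝 (-(K * 0))) :=
        (continuous_const.mul continuous_id).neg.tendsto 0
      rw [mul_zero, neg_zero] at this
      exact this.mono_left nhdsWithin_le_nhds
    refine le_of_tendsto hlim ?_
    filter_upwards [Ioc_mem_nhdsGT hx] with y hy
    exact (hlow y hy.1).trans (hmono hy.1 hx hy.2)
  intro x hx
  have hZ0 : ∀ y > 0, Z y = 0 := fun y hy => le_antisymm (hZ_le y hy) (hZ_ge y hy)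
  have hd0 : HasDerivWithinAt Z 0 (Ici x) x :=
    (hasDerivWithinAt_const x (Ici x) (0 : ℝ)).congr (fun y hy => hZ0 y (hx.trans_le hy)) (hZ0 x hx)
  have heq := (uniqueDiffWithinAt_Ici x).eq_deriv _ (dZ x hx) hd0
  have hJx := hJ0 x
  have hSx := hS0 x
  have hκφ : 0 ≤ κ ^ 2 * φ x ^ 2 := by positivity
  have hφ0 : φ x = 0 := by
    have : κ ^ 2 * φ x ^ 2 = 0 := by linarith
    simpa [hκ.ne'] using this
  have hJ00 : J x = 0 := by linarith
  have hff : f₁ x = f₂ x := sub_eq_zero.1 hφ0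
  refine ⟨hff, ?_⟩
  have hρ : f₁ x ^ 2 + g₁ x ^ 2 = f₂ x ^ 2 + g₂ x ^ 2 := by
    by_contra hne
    have he : lam * Real.exp (-2 * x) ≠ 0 := by positivity
    have hww : w (1 - (f₁ x ^ 2 + g₁ x ^ 2)) = w (1 - (f₂ x ^ 2 + g₂ x ^ 2)) := by
      have := (mul_eq_zero.1 hJ00).resolve_left he
      exact sub_eq_zero.1 ((mul_eq_zero.1 this).resolve_right (sub_ne_zero.2 hne))
    have := hw.strict.injOn ⟨by linarith [hρ₁ x hx.le], by nlinarith⟩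
      ⟨by linarith [hρ₂ x hx.le], by nlinarith⟩ hww
    exact hne (by linarith)
  rw [hff] at hρ
  exact (sq_eq_sq₀ (hg₁ x hx).le (hg₂ x hx).le).1 (by linarith)

end IsProfile

end Uniqueness

section Kernel
open Filter Topology

/-- The Hilbert space of (weighted) derivatives. -/
abbrev HilbertL2 : Type := Lp ℝ 2 (volume : Measure ℝ)

lemma memLp_indicator_exp (m x : ℝ) :
    MemLp (indicator (Ioc 0 x) fun y => Real.exp (m * (y - x))) 2 (volume : Measure ℝ) := by
  rw [memLp_indicator_iff_restrict measurableSet_Ioc]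
  have : IsFiniteMeasure (volume.restrict (Ioc 0 x)) := ⟨by simp⟩
  have hcont : Continuous fun y => Real.exp (m * (y - x)) := by fun_prop
  refine MemLp.of_bound hcont.aestronglyMeasurable (Real.exp (|m| * |x|)) ?_
  filter_upwards [ae_restrict_mem measurableSet_Ioc] with y hy
  rw [Real.norm_eq_abs, Real.abs_exp]
  refine Real.exp_le_exp.2 ((le_abs_self _).trans ?_)
  rw [abs_mul]
  refine mul_le_mul_of_nonneg_left ?_ (abs_nonneg m)
  rw [abs_le, abs_of_pos (hy.1.trans_le hy.2)]
  constructor <;> linarith [hy.1, hy.2]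

/-- The vector representing `z ↦ ∫₀ˣ e^{m(y-x)} z y dy`. -/
def expVec (m x : ℝ) : HilbertL2 := (memLp_indicator_exp m x).toLp _

lemma inner_expVec (m x : ℝ) (z : HilbertL2) :
    inner ℝ (expVec m x) z = ∫ y in Ioc 0 x, Real.exp (m * (y - x)) * z y := by
  rw [L2.inner_def, ← integral_indicator measurableSet_Ioc]
  refine integral_congr_ae ?_
  filter_upwards [(memLp_indicator_exp m x).coeFn_toLp] with y hy
  rw [expVec, hy]
  by_cases h : y ∈ Ioc 0 x <;> simp [h, mul_comm]

/-- The primitive of `e^{2mt}` vanishing at the origin. -/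
def expPrim (m c : ℝ) : ℝ := ∫ t in (0 : ℝ)..c, Real.exp (2 * m * t)

lemma hasDerivAt_expPrim (m c : ℝ) : HasDerivAt (expPrim m) (Real.exp (2 * m * c)) c := by
  have h : Continuous fun t => Real.exp (2 * m * t) := by fun_prop
  exact intervalIntegral.integral_hasDerivAt_right (h.intervalIntegrable _ _)
    h.stronglyMeasurable.stronglyMeasurableAtFilter h.continuousAt

lemma continuous_expPrim (m : ℝ) : Continuous (expPrim m) :=
  continuous_iff_continuousAt.2 fun c => (hasDerivAt_expPrim m c).continuousAt

@[simp] lemma expPrim_zero_right (m : ℝ) : expPrim m 0 = 0 := by simp [expPrim]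

@[simp] lemma expPrim_zero_left (c : ℝ) : expPrim 0 c = c := by simp [expPrim]

lemma expPrim_le {m c : ℝ} (hm : 0 ≤ m) (hc : 0 ≤ c) :
    expPrim m c ≤ c * Real.exp (2 * m * c) := by
  have h : Continuous fun t => Real.exp (2 * m * t) := by fun_prop
  calc expPrim m c ≤ ∫ t in (0 : ℝ)..c, Real.exp (2 * m * c) := by
        refine intervalIntegral.integral_mono_on hc (h.intervalIntegrable _ _)
          intervalIntegrable_const fun t ht => Real.exp_le_exp.2 ?_
        have := ht.2
        gcongr
    _ = _ := by simp

lemma mul_expPrim (m c : ℝ) : 2 * m * expPrim m c = Real.exp (2 * m * c) - 1 := by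
  simp [expPrim]

lemma inner_expVec_expVec (m x y : ℝ) : inner ℝ (expVec m x) (expVec m y) =
    Real.exp (-m * (x + y)) * expPrim m (max 0 (min x y)) := by
  have h1 : inner ℝ (expVec m x) (expVec m y) = ∫ t in Ioc 0 (max 0 (min x y)),
      Real.exp (m * (t - x)) * Real.exp (m * (t - y)) := by
    have hset : Ioc 0 (max 0 (min x y)) = Ioc 0 x ∩ Ioc 0 y := by
      ext t
      simp only [mem_Ioc, mem_inter_iff, le_max_iff, le_min_iff]
      constructor
      · rintro ⟨h0, h | h⟩
        · linarith
        · exact ⟨⟨h0, h.1⟩, h0, h.2⟩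
      · rintro ⟨⟨h0, h1⟩, -, h2⟩
        exact ⟨h0, Or.inr ⟨h1, h2⟩⟩
    rw [inner_expVec, hset, ← setIntegral_indicator measurableSet_Ioc]
    refine setIntegral_congr_ae measurableSet_Ioc ?_
    filter_upwards [(memLp_indicator_exp m y).coeFn_toLp] with t ht _
    rw [expVec, ht]
    by_cases h : t ∈ Ioc 0 y <;> simp [h]
  rw [h1, expPrim, ← intervalIntegral.integral_of_le (le_max_left _ _),
    ← intervalIntegral.integral_const_mul]
  congr 1
  ext t
  rw [← Real.exp_add, ← Real.exp_add]
  congr 1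
  ring

lemma continuous_expVec (m : ℝ) : Continuous (expVec m) := by
  rw [continuous_iff_continuousAt]
  intro x
  have h : Tendsto (fun y => ‖expVec m y - expVec m x‖ ^ 2) (𝓝 x) (𝓝 0) := by
    have hc : Continuous fun y => Real.exp (-m * (y + y)) * expPrim m (max 0 (min y y))
        - 2 * (Real.exp (-m * (y + x)) * expPrim m (max 0 (min y x)))
        + Real.exp (-m * (x + x)) * expPrim m (max 0 (min x x)) := by
      have := continuous_expPrim m
      fun_prop
    have h2 := hc.tendsto x
    convert h2 using 2
    · rw [norm_sub_sq_real, ← real_inner_self_eq_norm_sq, ← real_inner_self_eq_norm_sq]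
      simp only [inner_expVec_expVec]
    · ring
  rw [ContinuousAt, tendsto_iff_norm_sub_tendsto_zero]
  have h3 := h.sqrt
  simpa [Real.sqrt_sq] using h3

lemma norm_expVec_sq_le {m x : ℝ} (hm : 0 ≤ m) (hx : 0 ≤ x) : ‖expVec m x‖ ^ 2 ≤ x := by
  rw [← real_inner_self_eq_norm_sq, inner_expVec_expVec, min_self, max_eq_right hx]
  calc _ ≤ Real.exp (-m * (x + x)) * (x * Real.exp (2 * m * x)) := by
        gcongr
        exact expPrim_le hm hx
    _ = x * (Real.exp (-m * (x + x)) * Real.exp (2 * m * x)) := by ring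
    _ = x := by
        rw [← Real.exp_add, show -m * (x + x) + 2 * m * x = 0 by ring, Real.exp_zero, mul_one]

lemma norm_expVec_le {m x : ℝ} (hm : 0 ≤ m) (hx : 0 ≤ x) : ‖expVec m x‖ ≤ Real.exp (x / 2) := by
  refine le_of_sq_le_sq ?_ (Real.exp_pos _).le
  rw [← Real.exp_nat_mul, show ((2 : ℕ) : ℝ) * (x / 2) = x by push_cast; ring]
  linarith [norm_expVec_sq_le hm hx, Real.add_one_le_exp x]

lemma abs_inner_expVec_le {m x : ℝ} (hm : 0 ≤ m) (hx : 0 ≤ x) (v : HilbertL2) :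
    |inner ℝ (expVec m x) v| ≤ ‖v‖ * Real.exp (x / 2) := by
  refine (abs_real_inner_le_norm _ _).trans ?_
  rw [mul_comm]
  gcongr
  exact norm_expVec_le hm hx

/-- The solution of `u' + m u = q`, `u 0 = a`, on the half line. -/
def prof (a m : ℝ) (q : HilbertL2) (x : ℝ) : ℝ := Real.exp (-m * x) * a + inner ℝ (expVec m x) q

lemma continuous_prof (a m : ℝ) (q : HilbertL2) : Continuous (prof a m q) := by
  have := continuous_expVec m
  unfold prof
  fun_prop

lemma expVec_zero_right (m : ℝ) : expVec m 0 = 0 := by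
  rw [← norm_eq_zero, ← sq_eq_zero_iff, ← real_inner_self_eq_norm_sq, inner_expVec_expVec]
  simp

lemma prof_zero (a m : ℝ) (q : HilbertL2) : prof a m q 0 = a := by
  simp [prof, expVec_zero_right]

lemma abs_prof_le {a m x : ℝ} (hm : 0 ≤ m) (hx : 0 ≤ x) (q : HilbertL2) :
    |prof a m q x| ≤ (|a| + ‖q‖) * Real.exp (x / 2) := by
  refine (abs_add_le _ _).trans ?_
  rw [add_mul]
  refine add_le_add ?_ (abs_inner_expVec_le hm hx q)
  rw [abs_mul, Real.abs_exp, mul_comm]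
  gcongr
  nlinarith

lemma prof_add_smul (a m t : ℝ) (q v : HilbertL2) (x : ℝ) :
    prof a m (q + t • v) x = prof a m q x + t * inner ℝ (expVec m x) v := by
  simp only [prof, inner_add_right, inner_smul_right]
  ring

end Kernel

section Energy
open Filter Topology

/-- The potential with derivative `w`. -/
def potential (w : ℝ → ℝ) (t : ℝ) : ℝ := ∫ s in (0 : ℝ)..t, w s

namespace IsPot

variable {w : ℝ → ℝ}

lemma potential_sub_eq (hw : IsPot w) (a b : ℝ) :
    potential w b - potential w a = ∫ s in a..b, w s :=
  intervalIntegral.integral_interval_sub_left (hw.cont.intervalIntegrable _ _)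
    (hw.cont.intervalIntegrable _ _)

lemma potential_sub_le (hw : IsPot w) (a b : ℝ) :
    potential w b - potential w a ≤ w b * (b - a) := by
  rw [hw.potential_sub_eq]
  rcases le_total a b with h | h
  · calc _ ≤ ∫ _ in a..b, w b := intervalIntegral.integral_mono_on h
          (hw.cont.intervalIntegrable _ _) intervalIntegrable_const fun s hs => hw.mono hs.2
      _ = _ := by simp [mul_comm]
  · rw [intervalIntegral.integral_symm]
    have : ∫ _ in b..a, w b ≤ ∫ s in b..a, w s := intervalIntegral.integral_mono_on h
      intervalIntegrable_const (hw.cont.intervalIntegrable _ _) fun s hs => hw.mono hs.1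
    simp only [intervalIntegral.integral_const, smul_eq_mul] at this
    linarith

lemma continuous_potential (hw : IsPot w) : Continuous (potential w) :=
  intervalIntegral.continuous_primitive (fun _ _ => hw.cont.intervalIntegrable _ _) 0

@[simp] lemma potential_zero : potential w 0 = 0 := by simp [potential]

lemma potential_nonneg (hw : IsPot w) (t : ℝ) : 0 ≤ potential w t := by
  have := hw.potential_sub_le t 0
  rw [potential_zero, hw.zero 0 le_rfl] at this
  linarith

lemma potential_eq_zero (hw : IsPot w) {t : ℝ} (ht : t ≤ 0) : potential w t = 0 := by
  have := hw.potential_sub_le 0 t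
  rw [potential_zero, hw.zero t ht] at this
  linarith [hw.potential_nonneg t]

lemma potential_pos (hw : IsPot w) {t : ℝ} (ht : 0 < t) (ht1 : t ≤ 1) : 0 < potential w t := by
  have h := hw.potential_sub_le t (t / 2)
  have h2 : 0 < w (t / 2) := by
    rw [← hw.zero 0 le_rfl]
    exact hw.strict ⟨le_rfl, by norm_num⟩ ⟨by linarith, by linarith⟩ (by linarith)
  nlinarith [hw.potential_nonneg (t / 2)]

lemma potential_le (hw : IsPot w) {t : ℝ} (ht : t ≤ 1) : potential w t ≤ w 1 := by
  rcases le_total t 0 with h | h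
  · rw [hw.potential_eq_zero h]
    exact hw.nonneg 1
  · have h1 := hw.potential_sub_le 0 t
    rw [potential_zero, sub_zero, sub_zero] at h1
    nlinarith [hw.mono ht, hw.nonneg t, hw.nonneg 1]

end IsPot

lemma integrableOn_exp_neg_mul {u : ℝ → ℝ} {C : ℝ} (hu : Continuous u)
    (hC : ∀ x ≥ 0, |u x| ≤ C * Real.exp x) :
    IntegrableOn (fun x => u x * Real.exp (-2 * x)) (Ioi 0) := by
  refine Integrable.mono' ((integrableOn_exp_neg_Ioi 0).const_mul C)
    (by fun_prop) ?_
  filter_upwards [ae_restrict_mem measurableSet_Ioi] with x hx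
  rw [Real.norm_eq_abs, abs_mul, Real.abs_exp]
  calc _ ≤ C * Real.exp x * Real.exp (-2 * x) := by
        gcongr
        exact hC x (le_of_lt hx)
    _ = C * Real.exp (-x) := by
        rw [mul_assoc, ← Real.exp_add]
        ring_nf

/-- The density of the potential energy. -/
def potDensity (w : ℝ → ℝ) (κ : ℝ) (q p : HilbertL2) (x : ℝ) : ℝ :=
  potential w (1 - prof 1 κ q x ^ 2 - prof 0 0 p x ^ 2)

/-- The potential energy. -/
def potEnergy (w : ℝ → ℝ) (κ : ℝ) (q p : HilbertL2) : ℝ :=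
  ∫ x in Ioi 0, potDensity w κ q p x * Real.exp (-2 * x)

/-- The energy, in terms of `q = f' + κ f` and `p = g'`. -/
def energy (w : ℝ → ℝ) (lam κ : ℝ) (q p : HilbertL2) : ℝ :=
  ‖q‖ ^ 2 + ‖p‖ ^ 2 + lam * potEnergy w κ q p

section
variable {w : ℝ → ℝ} {lam κ : ℝ}

lemma continuous_potDensity (hw : IsPot w) (q p : HilbertL2) :
    Continuous (potDensity w κ q p) := by
  have h1 := continuous_prof 1 κ q
  have h2 := continuous_prof 0 0 p
  have h3 := hw.continuous_potential
  unfold potDensity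
  fun_prop

lemma potDensity_nonneg (hw : IsPot w) (q p : HilbertL2) (x : ℝ) :
    0 ≤ potDensity w κ q p x := hw.potential_nonneg _

lemma potDensity_le (hw : IsPot w) (q p : HilbertL2) (x : ℝ) : potDensity w κ q p x ≤ w 1 :=
  hw.potential_le (by nlinarith [sq_nonneg (prof 1 κ q x), sq_nonneg (prof 0 0 p x)])

lemma abs_potDensity_le (hw : IsPot w) (q p : HilbertL2) (x : ℝ) :
    |potDensity w κ q p x| ≤ w 1 := by
  rw [abs_of_nonneg (potDensity_nonneg hw q p x)]
  exact potDensity_le hw q p x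

lemma integrableOn_potDensity (hw : IsPot w) (q p : HilbertL2) :
    IntegrableOn (fun x => potDensity w κ q p x * Real.exp (-2 * x)) (Ioi 0) :=
  integrableOn_exp_neg_mul (C := w 1) (continuous_potDensity hw q p) fun x hx =>
    (abs_potDensity_le hw q p x).trans
      (le_mul_of_one_le_right (hw.nonneg 1) (Real.one_le_exp hx))

lemma potEnergy_nonneg (hw : IsPot w) (q p : HilbertL2) : 0 ≤ potEnergy w κ q p :=
  integral_nonneg fun x => mul_nonneg (potDensity_nonneg hw q p x) (Real.exp_pos _).le

lemma energy_nonneg (hw : IsPot w) (hlam : 0 ≤ lam) (q p : HilbertL2) :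
    0 ≤ energy w lam κ q p := by
  have := potEnergy_nonneg (κ := κ) hw q p
  unfold energy
  positivity

lemma norm_sq_le_energy (hw : IsPot w) (hlam : 0 ≤ lam) (q p : HilbertL2) :
    ‖q‖ ^ 2 ≤ energy w lam κ q p ∧ ‖p‖ ^ 2 ≤ energy w lam κ q p := by
  have := mul_nonneg hlam (potEnergy_nonneg (κ := κ) hw q p)
  unfold energy
  constructor <;> nlinarith [sq_nonneg ‖q‖, sq_nonneg ‖p‖]

lemma tendsto_potEnergy (hw : IsPot w) {qn pn : ℕ → HilbertL2} {q p : HilbertL2}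
    (hq : ∀ v, Tendsto (fun n => inner ℝ v (qn n)) atTop (𝓝 (inner ℝ v q)))
    (hp : ∀ v, Tendsto (fun n => inner ℝ v (pn n)) atTop (𝓝 (inner ℝ v p))) :
    Tendsto (fun n => potEnergy w κ (qn n) (pn n)) atTop (𝓝 (potEnergy w κ q p)) := by
  refine tendsto_integral_of_dominated_convergence (fun x => w 1 * Real.exp (-2 * x))
    (fun n => (integrableOn_potDensity hw _ _).aestronglyMeasurable) ?_ ?_ ?_
  · exact integrableOn_exp_neg_mul (C := w 1) continuous_const fun x hx => by
      rw [abs_of_nonneg (hw.nonneg 1)]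
      exact le_mul_of_one_le_right (hw.nonneg 1) (Real.one_le_exp hx)
  · refine fun n => ae_of_all _ fun x => ?_
    rw [Real.norm_eq_abs, abs_mul, Real.abs_exp]
    gcongr
    exact abs_potDensity_le hw _ _ x
  · refine ae_of_all _ fun x => Tendsto.mul_const _ ?_
    refine (hw.continuous_potential.tendsto _).comp ?_
    exact (tendsto_const_nhds.sub (((hq _).const_add _).pow 2)).sub (((hp _).const_add _).pow 2)

/-- Weak sequential compactness of balls. -/
lemma exists_weak_subseq_limit {qn : ℕ → HilbertL2} {R : ℝ} (hR : ∀ n, ‖qn n‖ ≤ R) :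
    ∃ (q : HilbertL2) (φ : ℕ → ℕ), StrictMono φ ∧
      ∀ v, Tendsto (fun n => inner ℝ v (qn (φ n))) atTop (𝓝 (inner ℝ v q)) := by
  have : Fact ((2 : ENNReal) ≠ ⊤) := ⟨by norm_num⟩
  have hc := WeakDual.isSeqCompact_closedBall ℝ HilbertL2 0 R
  obtain ⟨y, -, φ, hφ, hy⟩ := hc (x := fun n =>
    StrongDual.toWeakDual (InnerProductSpace.toDual ℝ HilbertL2 (qn n))) fun n => by
      simpa using hR n
  refine ⟨(InnerProductSpace.toDual ℝ HilbertL2).symm (WeakDual.toStrongDual y), φ, hφ,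
    fun v => ?_⟩
  have h1 := (WeakDual.eval_continuous v).continuousAt.tendsto.comp hy
  rw [real_inner_comm, InnerProductSpace.toDual_symm_apply]
  refine h1.congr fun n => ?_
  simp [real_inner_comm]

/-- Compactness of energy-bounded sequences and lower semicontinuity of the energy. -/
lemma exists_weak_limit (hw : IsPot w) {lamn : ℕ → ℝ} (hl : Tendsto lamn atTop (𝓝 lam))
    {qn pn : ℕ → HilbertL2} {R : ℝ} (hq : ∀ n, ‖qn n‖ ≤ R) (hp : ∀ n, ‖pn n‖ ≤ R)
    {An : ℕ → ℝ} {A : ℝ} (hA : Tendsto An atTop (𝓝 A))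
    (hE : ∀ n, energy w (lamn n) κ (qn n) (pn n) ≤ An n) :
    ∃ q p : HilbertL2, energy w lam κ q p ≤ A ∧ ((∀ n, pn n = 0) → p = 0) := by
  obtain ⟨q, φ, hφ, hqφ⟩ := exists_weak_subseq_limit hq
  obtain ⟨p, ψ, hψ, hpψ⟩ := exists_weak_subseq_limit fun n => hp (φ n)
  have hqψ : ∀ v, Tendsto (fun n => inner ℝ v (qn (φ (ψ n)))) atTop (𝓝 (inner ℝ v q)) :=
    fun v => (hqφ v).comp hψ.tendsto_atTop
  have hsub : Tendsto (fun n => φ (ψ n)) atTop atTop := hφ.tendsto_atTop.comp hψ.tendsto_atTop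
  refine ⟨q, p, ?_, fun h0 => ?_⟩
  · have hlim := ((((hqψ q).const_mul 2).sub_const (‖q‖ ^ 2)).add
      (((hpψ p).const_mul 2).sub_const (‖p‖ ^ 2))).add
      ((hl.comp hsub).mul (tendsto_potEnergy (κ := κ) hw hqψ hpψ))
    rw [real_inner_self_eq_norm_sq, real_inner_self_eq_norm_sq] at hlim
    have := le_of_tendsto_of_tendsto' hlim (hA.comp hsub) fun n => by
      refine le_trans ?_ (hE (φ (ψ n)))
      have h1 := norm_sub_sq_real q (qn (φ (ψ n)))
      have h2 := norm_sub_sq_real p (pn (φ (ψ n)))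
      simp only [energy, Function.comp]
      nlinarith [sq_nonneg ‖q - qn (φ (ψ n))‖, sq_nonneg ‖p - pn (φ (ψ n))‖]
    unfold energy
    linarith
  · have h1 := hpψ p
    simp only [h0, inner_zero_right] at h1
    exact inner_self_eq_zero.1 (tendsto_nhds_unique h1 tendsto_const_nhds)

/-- Global minimality. -/
def IsMinimizer (w : ℝ → ℝ) (lam κ : ℝ) (q p : HilbertL2) : Prop :=
  ∀ q' p', energy w lam κ q p ≤ energy w lam κ q' p'

theorem exists_isMinimizer (hw : IsPot w) (hlam : 0 ≤ lam) :
    ∃ q p, IsMinimizer w lam κ q p := by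
  set S : Set ℝ := range fun z : HilbertL2 × HilbertL2 => energy w lam κ z.1 z.2
  have hne : S.Nonempty := range_nonempty _
  have hbd : BddBelow S := ⟨0, by rintro _ ⟨z, rfl⟩; exact energy_nonneg hw hlam _ _⟩
  obtain ⟨u, hu, hlim, hmem⟩ := exists_seq_tendsto_sInf hne hbd
  choose z hz using hmem
  have hu1 : ∀ n, u n ≤ u 0 := fun n => hu (Nat.zero_le n)
  have hR : ∀ n, ‖(z n).1‖ ≤ Real.sqrt (u 0) ∧ ‖(z n).2‖ ≤ Real.sqrt (u 0) := fun n => by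
    have h := norm_sq_le_energy (κ := κ) hw hlam (z n).1 (z n).2
    have h2 := hz n
    simp only at h2
    rw [h2] at h
    exact ⟨Real.le_sqrt_of_sq_le (h.1.trans (hu1 n)), Real.le_sqrt_of_sq_le (h.2.trans (hu1 n))⟩
  obtain ⟨q, p, hqp, -⟩ := exists_weak_limit (κ := κ) hw tendsto_const_nhds
    (fun n => (hR n).1) (fun n => (hR n).2) hlim fun n => (hz n).le
  exact ⟨q, p, fun q' p' => hqp.trans (csInf_le hbd ⟨(q', p'), rfl⟩)⟩

end

end Energy

section Variation
open Filter Topology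

variable {w : ℝ → ℝ} {lam κ : ℝ}

lemma IsPot.abs_le {w : ℝ → ℝ} (hw : IsPot w) {a b : ℝ} : |w (1 - a ^ 2 - b ^ 2)| ≤ w 1 := by
  rw [abs_of_nonneg (hw.nonneg _)]
  exact hw.mono (by nlinarith [sq_nonneg a, sq_nonneg b])

lemma abs_pot_mul_le (hw : IsPot w) {a b s B : ℝ} (hs : |s| ≤ B) :
    |w (1 - a ^ 2 - b ^ 2) * s| ≤ w 1 * B := by
  rw [abs_mul]
  exact mul_le_mul hw.abs_le hs (abs_nonneg _) (hw.nonneg 1)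

lemma integrableOn_pot_mul (hw : IsPot w) {f g s : ℝ → ℝ} (hf : Continuous f) (hg : Continuous g)
    (hs : Continuous s) {C : ℝ} (hC : ∀ x ≥ 0, |s x| ≤ C * Real.exp x) :
    IntegrableOn (fun x => w (1 - f x ^ 2 - g x ^ 2) * s x * Real.exp (-2 * x)) (Ioi 0) := by
  have := hw.cont
  refine integrableOn_exp_neg_mul (C := w 1 * C) (by fun_prop) fun x hx => ?_
  rw [mul_assoc]
  exact abs_pot_mul_le hw (hC x hx)

lemma tendsto_integral_pot_mul (hw : IsPot w) {f g a c s : ℝ → ℝ} (hf : Continuous f)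
    (hg : Continuous g) (ha : Continuous a) (hc : Continuous c)
    (hs : Continuous s) {C : ℝ} (hC : ∀ x ≥ 0, |s x| ≤ C * Real.exp x) :
    Tendsto (fun t => ∫ x in Ioi 0, w (1 - (f x + t * a x) ^ 2 - (g x + t * c x) ^ 2) * s x *
      Real.exp (-2 * x)) (𝓝 0)
      (𝓝 (∫ x in Ioi 0, w (1 - f x ^ 2 - g x ^ 2) * s x * Real.exp (-2 * x))) := by
  have hwc := hw.cont
  refine tendsto_integral_filter_of_dominated_convergence
    (fun x => w 1 * (C * Real.exp x) * Real.exp (-2 * x)) ?_ ?_ ?_ ?_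
  · exact Eventually.of_forall fun t => (Continuous.aestronglyMeasurable (by fun_prop))
  · refine Eventually.of_forall fun t => ?_
    filter_upwards [ae_restrict_mem measurableSet_Ioi] with x hx
    rw [Real.norm_eq_abs, abs_mul _ (Real.exp _), Real.abs_exp]
    gcongr
    exact abs_pot_mul_le hw (hC x (le_of_lt hx))
  · refine integrableOn_exp_neg_mul (C := |w 1 * C|) (by fun_prop) fun x _ => ?_
    rw [← mul_assoc, abs_mul _ (Real.exp x), Real.abs_exp]
  · refine ae_of_all _ fun x => ?_
    have h : Continuous fun t => w (1 - (f x + t * a x) ^ 2 - (g x + t * c x) ^ 2) * s x *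
      Real.exp (-2 * x) := by fun_prop
    simpa using h.tendsto 0

lemma abs_mul_le_exp {a b A B x : ℝ} (ha : |a| ≤ A * Real.exp (x / 2))
    (hb : |b| ≤ B * Real.exp (x / 2)) : |a * b| ≤ A * B * Real.exp x := by
  rw [abs_mul]
  calc _ ≤ A * Real.exp (x / 2) * (B * Real.exp (x / 2)) :=
        mul_le_mul ha hb (abs_nonneg _) ((abs_nonneg _).trans ha)
    _ = A * B * (Real.exp (x / 2) * Real.exp (x / 2)) := by ring
    _ = _ := by rw [← Real.exp_add, add_halves]

lemma abs_mul_add_mul_le_exp {a b c d A B C D x : ℝ} (ha : |a| ≤ A * Real.exp (x / 2))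
    (hb : |b| ≤ B * Real.exp (x / 2)) (hc : |c| ≤ C * Real.exp (x / 2))
    (hd : |d| ≤ D * Real.exp (x / 2)) : |a * b + c * d| ≤ (A * B + C * D) * Real.exp x := by
  rw [add_mul]
  exact (abs_add_le _ _).trans (add_le_add (abs_mul_le_exp ha hb) (abs_mul_le_exp hc hd))

lemma continuous_inner_expVec (m : ℝ) (v : HilbertL2) :
    Continuous fun x => inner ℝ (expVec m x) v := by
  have := continuous_expVec m
  fun_prop

namespace IsMinimizer

/-- The variational inequality at a finite step `t`. -/
lemma variation_le {q p : HilbertL2} (h : IsMinimizer w lam κ q p) (hw : IsPot w) (hlam : 0 ≤ lam)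
    (hκ : 0 ≤ κ) (v z : HilbertL2) {t : ℝ} (ht : 0 < t) :
    lam * (∫ x in Ioi 0, w (1 - (prof 1 κ q x + t * inner ℝ (expVec κ x) v) ^ 2 -
        (prof 0 0 p x + t * inner ℝ (expVec 0 x) z) ^ 2) *
        (prof 1 κ q x * inner ℝ (expVec κ x) v + prof 0 0 p x * inner ℝ (expVec 0 x) z) *
        Real.exp (-2 * x)) * 2 +
      t * (lam * ∫ x in Ioi 0, w (1 - (prof 1 κ q x + t * inner ℝ (expVec κ x) v) ^ 2 -
        (prof 0 0 p x + t * inner ℝ (expVec 0 x) z) ^ 2) *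
        (inner ℝ (expVec κ x) v * inner ℝ (expVec κ x) v +
          inner ℝ (expVec 0 x) z * inner ℝ (expVec 0 x) z) * Real.exp (-2 * x)) ≤
      2 * (inner ℝ q v + inner ℝ p z) + t * (‖v‖ ^ 2 + ‖z‖ ^ 2) := by
  have hfc := continuous_prof 1 κ q
  have hgc := continuous_prof 0 0 p
  have hac := continuous_inner_expVec κ v
  have hcc := continuous_inner_expVec 0 z
  have hfb := fun x hx => abs_prof_le (a := 1) (x := x) hκ hx q
  have hgb := fun x hx => abs_prof_le (a := 0) (x := x) le_rfl hx p
  have hab := fun x hx => abs_inner_expVec_le (x := x) hκ hx v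
  have hcb := fun x hx => abs_inner_expVec_le (x := x) le_rfl hx z
  have hInt : potEnergy w κ (q + t • v) (p + t • z) - potEnergy w κ q p ≤ -(t * (
      (∫ x in Ioi 0, w (1 - (prof 1 κ q x + t * inner ℝ (expVec κ x) v) ^ 2 -
        (prof 0 0 p x + t * inner ℝ (expVec 0 x) z) ^ 2) *
        (prof 1 κ q x * inner ℝ (expVec κ x) v + prof 0 0 p x * inner ℝ (expVec 0 x) z) *
        Real.exp (-2 * x)) * 2 +
      t * ∫ x in Ioi 0, w (1 - (prof 1 κ q x + t * inner ℝ (expVec κ x) v) ^ 2 -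
        (prof 0 0 p x + t * inner ℝ (expVec 0 x) z) ^ 2) *
        (inner ℝ (expVec κ x) v * inner ℝ (expVec κ x) v +
          inner ℝ (expVec 0 x) z * inner ℝ (expVec 0 x) z) * Real.exp (-2 * x))) := by
    have i1 := integrableOn_pot_mul hw (f := fun x => prof 1 κ q x + t * inner ℝ (expVec κ x) v)
      (g := fun x => prof 0 0 p x + t * inner ℝ (expVec 0 x) z)
      (s := fun x => prof 1 κ q x * inner ℝ (expVec κ x) v +
        prof 0 0 p x * inner ℝ (expVec 0 x) z) (by fun_prop) (by fun_prop) (by fun_prop)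
      fun x hx => abs_mul_add_mul_le_exp (hfb x hx) (hab x hx) (hgb x hx) (hcb x hx)
    have i2 := integrableOn_pot_mul hw (f := fun x => prof 1 κ q x + t * inner ℝ (expVec κ x) v)
      (g := fun x => prof 0 0 p x + t * inner ℝ (expVec 0 x) z)
      (s := fun x => inner ℝ (expVec κ x) v * inner ℝ (expVec κ x) v +
        inner ℝ (expVec 0 x) z * inner ℝ (expVec 0 x) z) (by fun_prop) (by fun_prop)
      (by fun_prop)
      fun x hx => abs_mul_add_mul_le_exp (hab x hx) (hab x hx) (hcb x hx) (hcb x hx)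
    unfold potEnergy
    rw [← integral_sub (integrableOn_potDensity hw _ _) (integrableOn_potDensity hw _ _),
      ← integral_mul_const, ← integral_const_mul, ← integral_add (i1.mul_const 2) (i2.const_mul t),
      ← integral_const_mul, ← integral_neg]
    refine integral_mono ((integrableOn_potDensity hw _ _).sub (integrableOn_potDensity hw _ _))
      (((i1.mul_const 2).add (i2.const_mul t)).const_mul t).neg fun x => ?_
    have h3 := hw.potential_sub_le (1 - prof 1 κ q x ^ 2 - prof 0 0 p x ^ 2)
      (1 - (prof 1 κ q x + t * inner ℝ (expVec κ x) v) ^ 2 -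
        (prof 0 0 p x + t * inner ℝ (expVec 0 x) z) ^ 2)
    have h4 := mul_le_mul_of_nonneg_right h3 (Real.exp_pos (-2 * x)).le
    simp only [potDensity, prof_add_smul]
    linarith
  have h1 := h (q + t • v) (p + t • z)
  have h2 := mul_le_mul_of_nonneg_left hInt hlam
  unfold energy at h1
  rw [norm_add_sq_real, norm_add_sq_real, inner_smul_right, inner_smul_right, norm_smul, norm_smul,
    mul_pow, mul_pow, Real.norm_eq_abs, sq_abs] at h1
  refine le_of_mul_le_mul_left ?_ ht
  linarith

/-- Euler–Lagrange inequality. -/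
lemma euler_lagrange_le {q p : HilbertL2} (h : IsMinimizer w lam κ q p) (hw : IsPot w)
    (hlam : 0 ≤ lam) (hκ : 0 ≤ κ) (v z : HilbertL2) :
    lam * (∫ x in Ioi 0, w (1 - prof 1 κ q x ^ 2 - prof 0 0 p x ^ 2) *
        (prof 1 κ q x * inner ℝ (expVec κ x) v + prof 0 0 p x * inner ℝ (expVec 0 x) z) *
        Real.exp (-2 * x)) ≤ inner ℝ q v + inner ℝ p z := by
  have hfc := continuous_prof 1 κ q
  have hgc := continuous_prof 0 0 p
  have hac := continuous_inner_expVec κ v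
  have hcc := continuous_inner_expVec 0 z
  have hfb := fun x hx => abs_prof_le (a := 1) (x := x) hκ hx q
  have hgb := fun x hx => abs_prof_le (a := 0) (x := x) le_rfl hx p
  have hab := fun x hx => abs_inner_expVec_le (x := x) hκ hx v
  have hcb := fun x hx => abs_inner_expVec_le (x := x) le_rfl hx z
  have i1 := tendsto_integral_pot_mul hw hfc hgc hac hcc
    (s := fun x => prof 1 κ q x * inner ℝ (expVec κ x) v +
      prof 0 0 p x * inner ℝ (expVec 0 x) z) (by fun_prop)
    fun x hx => abs_mul_add_mul_le_exp (hfb x hx) (hab x hx) (hgb x hx) (hcb x hx)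
  have i2 := tendsto_integral_pot_mul hw hfc hgc hac hcc
    (s := fun x => inner ℝ (expVec κ x) v * inner ℝ (expVec κ x) v +
      inner ℝ (expVec 0 x) z * inner ℝ (expVec 0 x) z) (by fun_prop)
    fun x hx => abs_mul_add_mul_le_exp (hab x hx) (hab x hx) (hcb x hx) (hcb x hx)
  have hl := ((i1.const_mul lam).mul_const 2).add ((tendsto_id (x := 𝓝 (0 : ℝ))).mul
    (i2.const_mul lam))
  have hr := ((tendsto_id (x := 𝓝 (0 : ℝ))).mul_const (‖v‖ ^ 2 + ‖z‖ ^ 2)).const_add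
    (2 * (inner ℝ q v + inner ℝ p z))
  have := le_of_tendsto_of_tendsto (hl.mono_left nhdsWithin_le_nhds)
    (hr.mono_left nhdsWithin_le_nhds) (b := 𝓝[>] (0 : ℝ)) (by
      filter_upwards [self_mem_nhdsWithin] with t ht
      exact h.variation_le hw hlam hκ v z ht)
  simp only [zero_mul, add_zero] at this
  linarith

/-- Euler–Lagrange equation. -/
lemma euler_lagrange {q p : HilbertL2} (h : IsMinimizer w lam κ q p) (hw : IsPot w)
    (hlam : 0 ≤ lam) (hκ : 0 ≤ κ) (v z : HilbertL2) :
    inner ℝ q v + inner ℝ p z = lam * (∫ x in Ioi 0, w (1 - prof 1 κ q x ^ 2 - prof 0 0 p x ^ 2) *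
        (prof 1 κ q x * inner ℝ (expVec κ x) v + prof 0 0 p x * inner ℝ (expVec 0 x) z) *
        Real.exp (-2 * x)) := by
  refine le_antisymm ?_ (h.euler_lagrange_le hw hlam hκ v z)
  have := h.euler_lagrange_le hw hlam hκ (-v) (-z)
  simp only [inner_neg_right, mul_neg, ← neg_add, neg_mul, integral_neg] at this
  simp only [neg_mul]
  linarith

/-- Stability of a minimiser with vanishing second component. -/
lemma stable {q : HilbertL2} (h : IsMinimizer w lam κ q 0) (hw : IsPot w)
    (hlam : 0 ≤ lam) (hκ : 0 ≤ κ) (z : HilbertL2) :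
    lam * (∫ x in Ioi 0, w (1 - prof 1 κ q x ^ 2) * inner ℝ (expVec 0 x) z ^ 2 *
        Real.exp (-2 * x)) ≤ ‖z‖ ^ 2 := by
  have hfc := continuous_prof 1 κ q
  have hcc := continuous_inner_expVec 0 z
  have hcb := fun x hx => abs_inner_expVec_le (x := x) le_rfl hx z
  have i2 := tendsto_integral_pot_mul hw hfc (continuous_const (y := 0))
    (continuous_const (y := 0)) hcc
    (s := fun x => inner ℝ (expVec 0 x) z ^ 2) (by fun_prop)
    fun x hx => by rw [sq]; exact abs_mul_le_exp (hcb x hx) (hcb x hx)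
  have := le_of_tendsto ((i2.const_mul lam).mono_left nhdsWithin_le_nhds)
    (b := ‖z‖ ^ 2) (x := 𝓝[>] (0 : ℝ)) (by
      filter_upwards [self_mem_nhdsWithin] with t ht
      have h1 := h.variation_le hw hlam hκ 0 z ht
      refine le_of_mul_le_mul_left ?_ ht
      simpa [prof, sq] using h1)
  simpa using this

end IsMinimizer

end Variation

section Regularity
open Filter Topology

/-- Second-order equation for a weak solution on the half line. -/
lemma exists_deriv_of_weak {F : ℝ → ℝ} (hF : Continuous F) {a m C : ℝ} (hm : 0 ≤ m)
    (hC : ∀ y ≥ 0, |F y| ≤ C * Real.exp (-y)) {q : HilbertL2}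
    (hq : ∀ b, inner ℝ q (expVec m b) = ∫ y in Ioi 0, F y * inner ℝ (expVec m y) (expVec m b)) :
    ∃ u' : ℝ → ℝ, (∀ x > 0, HasDerivAt (prof a m q) (u' x) x) ∧
      (∀ x > 0, HasDerivAt u' (m ^ 2 * prof a m q x - F x) x) ∧
      ∀ x > 0, |u' x + m * prof a m q x| ≤ C * Real.exp (-x) := by
  set G : ℝ → ℝ := fun y => Real.exp (-m * y) * F y with hG
  have hGc : Continuous G := by fun_prop
  have hGb : ∀ y ≥ 0, |G y| ≤ C * Real.exp (-y) := fun y hy => by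
    rw [hG, abs_mul, Real.abs_exp]
    refine (mul_le_of_le_one_left (abs_nonneg _) (Real.exp_le_one_iff.2 ?_)).trans (hC y hy)
    nlinarith
  have hGi : ∀ b ≥ 0, IntegrableOn G (Ioi b) := fun b hb => by
    refine Integrable.mono' ((integrableOn_exp_neg_Ioi b).const_mul C) hGc.aestronglyMeasurable ?_
    filter_upwards [ae_restrict_mem measurableSet_Ioi] with y hy
    exact hGb y (hb.trans (le_of_lt hy))
  set I : ℝ → ℝ := fun b => (∫ y in Ioi 0, G y) - ∫ y in (0 : ℝ)..b, G y with hI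
  have hIeq : ∀ b ≥ 0, I b = ∫ y in Ioi b, G y := fun b hb => by
    rw [hI]
    simp only
    rw [intervalIntegral.integral_of_le hb, ← Ioc_union_Ioi_eq_Ioi hb,
      setIntegral_union Ioc_disjoint_Ioi_same measurableSet_Ioi
        ((hGi 0 le_rfl).mono_set Ioc_subset_Ioi_self) (hGi b hb)]
    ring
  have hId : ∀ b, HasDerivAt I (-G b) b := fun b =>
    (hGc.integral_hasStrictDerivAt 0 b).hasDerivAt.const_sub _
  have hDc := continuous_expPrim m
  have hformula : ∀ b ≥ 0, prof a m q b =
      Real.exp (-m * b) * (a + ((∫ y in (0 : ℝ)..b, G y * expPrim m y) + expPrim m b * I b)) := by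
    intro b hb
    rw [prof, real_inner_comm, hq b, mul_add]
    congr 1
    have hcongr1 : ∀ y ∈ Ioc 0 b, F y * inner ℝ (expVec m y) (expVec m b) =
        Real.exp (-m * b) * (G y * expPrim m y) := fun y hy => by
      rw [inner_expVec_expVec, min_eq_left hy.2, max_eq_right hy.1.le, mul_add, Real.exp_add, hG]
      ring
    have hcongr2 : ∀ y ∈ Ioi b, F y * inner ℝ (expVec m y) (expVec m b) =
        Real.exp (-m * b) * (expPrim m b * G y) := fun y hy => by
      rw [inner_expVec_expVec, min_eq_right (le_of_lt hy), max_eq_right hb, mul_add, Real.exp_add,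
        hG]
      ring
    have i1 : IntegrableOn (fun y => F y * inner ℝ (expVec m y) (expVec m b)) (Ioc 0 b) :=
      (Continuous.integrableOn_Icc (by
        have := continuous_expVec m
        fun_prop)).mono_set Ioc_subset_Icc_self
    have i2 : IntegrableOn (fun y => F y * inner ℝ (expVec m y) (expVec m b)) (Ioi b) :=
      IntegrableOn.congr_fun (((hGi b hb).const_mul (expPrim m b)).const_mul (Real.exp (-m * b)))
        (fun y hy => (hcongr2 y hy).symm) measurableSet_Ioi
    rw [← Ioc_union_Ioi_eq_Ioi hb, setIntegral_union Ioc_disjoint_Ioi_same measurableSet_Ioi i1 i2,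
      setIntegral_congr_fun measurableSet_Ioc hcongr1,
      setIntegral_congr_fun measurableSet_Ioi hcongr2, integral_const_mul, integral_const_mul,
      integral_const_mul, hIeq b hb, intervalIntegral.integral_of_le hb]
    ring
  set P : ℝ → ℝ := fun x => Real.exp (m * x) * I x with hP
  have hPd : ∀ x, HasDerivAt P (m * P x - F x) x := fun x => by
    have h1 := (((hasDerivAt_id x).const_mul m).exp).mul (hId x)
    refine h1.congr_deriv ?_
    have : Real.exp (m * x) * Real.exp (-m * x) = 1 := by rw [← Real.exp_add]; simp
    simp only [hP, hG, id, mul_one]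
    linear_combination (-F x) * this
  have hud : ∀ x > 0, HasDerivAt (prof a m q) (P x - m * prof a m q x) x := fun x hx => by
    have h0 : Continuous fun y => G y * expPrim m y := by fun_prop
    have h1 := (((hasDerivAt_id x).const_mul (-m)).exp).mul
      (((h0.integral_hasStrictDerivAt 0 x).hasDerivAt.add
        ((hasDerivAt_expPrim m x).mul (hId x))).const_add a)
    refine (h1.congr_of_eventuallyEq ?_).congr_deriv ?_
    · filter_upwards [lt_mem_nhds hx] with y hy
      exact hformula y hy.le
    · rw [hformula x hx.le]
      have : Real.exp (m * x) = Real.exp (-m * x) * Real.exp (2 * m * x) := by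
        rw [← Real.exp_add]; ring_nf
      simp only [hP, id, this]
      simp
      ring
  refine ⟨fun x => P x - m * prof a m q x, hud, fun x hx => ?_, fun x hx => ?_⟩
  · exact ((hPd x).sub ((hud x hx).const_mul m)).congr_deriv (by ring)
  · have hIb : |I x| ≤ C * (Real.exp (-m * x) * Real.exp (-x)) := by
      rw [hIeq x hx.le]
      have hi := ((integrableOn_exp_neg_Ioi x).const_mul (C * Real.exp (-m * x)))
      have h1 : |∫ y in Ioi x, G y| ≤ ∫ y in Ioi x, C * Real.exp (-m * x) * Real.exp (-y) := by
        rw [← Real.norm_eq_abs]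
        refine norm_integral_le_of_norm_le hi ?_
        filter_upwards [ae_restrict_mem measurableSet_Ioi] with y hy
        have hy' : x < y := hy
        rw [Real.norm_eq_abs, hG, abs_mul, Real.abs_exp]
        have h2 : Real.exp (-m * y) ≤ Real.exp (-m * x) := Real.exp_le_exp.2 (by nlinarith)
        have h3 := hC y (hx.le.trans hy'.le)
        calc _ ≤ Real.exp (-m * x) * (C * Real.exp (-y)) :=
              mul_le_mul h2 h3 (abs_nonneg _) (Real.exp_pos _).le
          _ = _ := by ring
      rw [integral_const_mul, integral_exp_neg_Ioi] at h1
      linarith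
    rw [sub_add_cancel, hP, abs_mul, Real.abs_exp]
    calc _ ≤ Real.exp (m * x) * (C * (Real.exp (-m * x) * Real.exp (-x))) := by gcongr
      _ = C * (Real.exp (m * x) * Real.exp (-m * x)) * Real.exp (-x) := by ring
      _ = _ := by rw [← Real.exp_add]; simp

lemma tendsto_zero_of_deriv_add_le {u u' : ℝ → ℝ} {κ C : ℝ} (hκ : 1 ≤ κ)
    (hu : ContinuousOn u (Ici 0)) (hd : ∀ x > 0, HasDerivAt u (u' x) x)
    (hb : ∀ x > 0, |u' x + κ * u x| ≤ C * Real.exp (-x)) : Tendsto u atTop (𝓝 0) := by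
  have key : ∀ s : ℝ, |s| = 1 → ∀ x ≥ 0,
      s * u x ≤ s * u 0 * Real.exp (-κ * x) + C * x * Real.exp (-x) := by
    intro s hs x hx
    have hanti : AntitoneOn (fun x => Real.exp (κ * x) * (s * u x) -
        C * x * Real.exp ((κ - 1) * x)) (Ici 0) := by
      refine antitoneOn_of_hasDerivWithinAt_nonpos (convex_Ici 0) (by fun_prop)
        (f' := fun x => Real.exp (κ * x) * (s * (u' x + κ * u x)) -
          (C * Real.exp ((κ - 1) * x) + C * x * ((κ - 1) * Real.exp ((κ - 1) * x))))
        (fun y hy => ?_) fun y hy => ?_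
      · rw [interior_Ici] at hy
        have h1 := ((((hasDerivAt_id y).const_mul κ).exp).mul ((hd y hy).const_mul s)).sub
          (((hasDerivAt_id y).const_mul C).mul ((hasDerivAt_id y).const_mul (κ - 1)).exp)
        refine (h1.congr_deriv ?_).hasDerivWithinAt
        simp only [id]
        ring
      · rw [interior_Ici] at hy
        have hy' : 0 < y := hy
        have h1 : s * (u' y + κ * u y) ≤ C * Real.exp (-y) := by
          refine (le_abs_self _).trans ?_
          rw [abs_mul, hs, one_mul]
          exact hb y hy
        have hC : 0 ≤ C := by
          have := (abs_nonneg _).trans (hb y hy)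
          exact nonneg_of_mul_nonneg_left this (Real.exp_pos _)
        have h2 : Real.exp ((κ - 1) * y) = Real.exp (κ * y) * Real.exp (-y) := by
          rw [← Real.exp_add]; ring_nf
        have h3 := mul_le_mul_of_nonneg_left h1 (Real.exp_pos (κ * y)).le
        have h4 : 0 ≤ C * y * ((κ - 1) * Real.exp ((κ - 1) * y)) := by
          have : 0 ≤ κ - 1 := by linarith
          positivity
        have h5 := h2
        nlinarith
    have h1 := hanti (mem_Ici.2 le_rfl) (mem_Ici.2 hx) hx
    simp only [mul_zero, Real.exp_zero, one_mul, zero_mul, sub_zero] at h1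
    have h2 := mul_le_mul_of_nonneg_left h1 (Real.exp_pos (-κ * x)).le
    have e1 : Real.exp (-κ * x) * Real.exp (κ * x) = 1 := by rw [← Real.exp_add]; simp
    have e2 : Real.exp (-κ * x) * Real.exp ((κ - 1) * x) = Real.exp (-x) := by
      rw [← Real.exp_add]; ring_nf
    have e3 : Real.exp (-κ * x) * (Real.exp (κ * x) * (s * u x) -
        C * x * Real.exp ((κ - 1) * x)) = s * u x - C * x * Real.exp (-x) := by
      linear_combination (s * u x) * e1 - C * x * e2
    linarith
  have lim : ∀ s : ℝ, Tendsto (fun x => s * u 0 * Real.exp (-κ * x) + C * x * Real.exp (-x)) atTop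
      (𝓝 0) := fun s => by
    have h1 : Tendsto (fun x => Real.exp (-κ * x)) atTop (𝓝 0) :=
      Real.tendsto_exp_atBot.comp (tendsto_id.const_mul_atTop_of_neg (by linarith))
    have h2 := (Real.tendsto_pow_mul_exp_neg_atTop_nhds_zero 1)
    simpa [mul_assoc] using (h1.const_mul (s * u 0)).add (h2.const_mul C)
  have l1 := lim 1
  have l2 := (lim (-1)).neg
  rw [neg_zero] at l2
  refine tendsto_of_tendsto_of_tendsto_of_le_of_le' l2 l1 ?_ ?_
  · filter_upwards [eventually_ge_atTop 0] with x hx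
    linarith [key (-1) (by simp) x hx]
  · filter_upwards [eventually_ge_atTop 0] with x hx
    linarith [key 1 (by simp) x hx]

end Regularity

section Minimizers
open Filter Topology

variable {w : ℝ → ℝ} {lam κ : ℝ}

/-- Minimisers are profiles. -/
theorem IsMinimizer.exists_isProfile {q p : HilbertL2} (h : IsMinimizer w lam κ q p)
    (hw : IsPot w) (hlam : 0 ≤ lam) (hκ : 1 ≤ κ) :
    ∃ f' g', IsProfile w lam κ (prof 1 κ q) f' (prof 0 0 p) g' := by
  have hκ0 : 0 ≤ κ := by linarith
  have hfc := continuous_prof 1 κ q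
  have hgc := continuous_prof 0 0 p
  have hwc := hw.cont
  have hbound : ∀ {u : ℝ → ℝ} {B : ℝ}, (∀ x ≥ 0, |u x| ≤ B * Real.exp (x / 2)) → ∀ x ≥ 0,
      |lam * Real.exp (-2 * x) * w (1 - prof 1 κ q x ^ 2 - prof 0 0 p x ^ 2) * u x| ≤
        lam * w 1 * B * Real.exp (-x) := by
    intro u B hu x hx
    have h1 := abs_pot_mul_le (a := prof 1 κ q x) (b := prof 0 0 p x) hw (hu x hx)
    have hB : 0 ≤ B := nonneg_of_mul_nonneg_left ((abs_nonneg _).trans (hu x hx)) (Real.exp_pos _)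
    rw [mul_assoc, abs_mul, abs_mul, Real.abs_exp, abs_of_nonneg hlam]
    calc _ ≤ lam * Real.exp (-2 * x) * (w 1 * (B * Real.exp (x / 2))) := by gcongr
      _ = lam * w 1 * B * (Real.exp (-2 * x) * Real.exp (x / 2)) := by ring
      _ ≤ _ := by
        rw [← Real.exp_add]
        have := hw.nonneg 1
        gcongr
        linarith
  have hf : ∀ b, inner ℝ q (expVec κ b) = ∫ y in Ioi 0, (lam * Real.exp (-2 * y) *
      w (1 - prof 1 κ q y ^ 2 - prof 0 0 p y ^ 2) * prof 1 κ q y) *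
        inner ℝ (expVec κ y) (expVec κ b) := fun b => by
    have h1 := h.euler_lagrange hw hlam hκ0 (expVec κ b) 0
    simp only [inner_zero_right, add_zero, mul_zero] at h1
    rw [h1, ← integral_const_mul]
    congr 1
    ext y
    ring
  have hg : ∀ b, inner ℝ p (expVec 0 b) = ∫ y in Ioi 0, (lam * Real.exp (-2 * y) *
      w (1 - prof 1 κ q y ^ 2 - prof 0 0 p y ^ 2) * prof 0 0 p y) *
        inner ℝ (expVec 0 y) (expVec 0 b) := fun b => by
    have h1 := h.euler_lagrange hw hlam hκ0 0 (expVec 0 b)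
    simp only [inner_zero_right, zero_add, mul_zero] at h1
    rw [h1, ← integral_const_mul]
    congr 1
    ext y
    ring
  obtain ⟨f', df, ddf, hf'⟩ := exists_deriv_of_weak (a := 1) (by fun_prop) hκ0
    (hbound fun x hx => abs_prof_le hκ0 hx q) hf
  obtain ⟨g', dg, ddg, hg'⟩ := exists_deriv_of_weak (a := 0) (by fun_prop) le_rfl
    (hbound fun x hx => abs_prof_le le_rfl hx p) hg
  refine ⟨f', g', hfc.continuousOn, hgc.continuousOn, df,
    fun x hx => (ddf x hx).congr_deriv (by ring), dg,
    fun x hx => (ddg x hx).congr_deriv (by ring), prof_zero _ _ _,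
    tendsto_zero_of_deriv_add_le hκ hfc.continuousOn df hf', ?_, w 1, fun x _ => hw.abs_le⟩
  refine ⟨_, tendsto_limUnder_of_hasDerivAt_of_integrableOn_Ioi dg ?_⟩
  have hg'c : ContinuousOn g' (Ioi 0) := fun x hx =>
    (ddg x hx).continuousAt.continuousWithinAt
  refine Integrable.mono' ((integrableOn_exp_neg_Ioi 0).const_mul (lam * w 1 * (|0| + ‖p‖)))
    (hg'c.aestronglyMeasurable measurableSet_Ioi) ?_
  filter_upwards [ae_restrict_mem measurableSet_Ioi] with x hx
  have := hg' x hx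
  rwa [zero_mul, add_zero] at this

lemma memLp_flip (c : ℝ) (q : HilbertL2) :
    MemLp (fun y => (if y ≤ c then (1 : ℝ) else -1) * q y) 2 (volume : Measure ℝ) := by
  refine (Lp.memLp q).of_le (AEStronglyMeasurable.mul ?_ (Lp.aestronglyMeasurable q))
    (ae_of_all _ fun y => ?_)
  · exact (Measurable.ite measurableSet_Iic measurable_const
      measurable_const).aestronglyMeasurable
  · split_ifs <;> simp

/-- Change of sign to the right of `c`. -/
def flipAfter (c : ℝ) (q : HilbertL2) : HilbertL2 := (memLp_flip c q).toLp _

lemma norm_flip (c : ℝ) (q : HilbertL2) : ‖flipAfter c q‖ = ‖q‖ := by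
  rw [flipAfter, Lp.norm_toLp, Lp.norm_def]
  congr 1
  refine eLpNorm_congr_norm_ae (ae_of_all _ fun y => ?_)
  split_ifs <;> simp

lemma inner_expVec_flip_of_le {m c x : ℝ} (hx : x ≤ c) (q : HilbertL2) :
    inner ℝ (expVec m x) (flipAfter c q) = inner ℝ (expVec m x) q := by
  rw [inner_expVec, inner_expVec]
  refine setIntegral_congr_ae measurableSet_Ioc ?_
  filter_upwards [(memLp_flip c q).coeFn_toLp] with y hy hyx
  rw [flipAfter, hy, if_pos (hyx.2.trans hx), one_mul]

lemma inner_expVec_flip_of_ge {m c x : ℝ} (hc : 0 ≤ c) (hx : c ≤ x) (q : HilbertL2) :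
    inner ℝ (expVec m x) (flipAfter c q) =
      2 * Real.exp (-m * (x - c)) * inner ℝ (expVec m c) q - inner ℝ (expVec m x) q := by
  have hInt : ∀ z : HilbertL2, IntegrableOn (fun y => Real.exp (m * (y - x)) * z y) (Ioc 0 x) :=
    fun z => by
      refine IntegrableOn.mono_set (t := Icc 0 x) ?_ Ioc_subset_Icc_self
      refine IntegrableOn.continuousOn_mul (by fun_prop) ?_ isCompact_Icc
      exact ((Lp.memLp z).locallyIntegrable (by norm_num)).integrableOn_isCompact isCompact_Icc
  have hsplit : ∀ z : HilbertL2, inner ℝ (expVec m x) z =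
      Real.exp (-m * (x - c)) * inner ℝ (expVec m c) z +
        ∫ y in Ioc c x, Real.exp (m * (y - x)) * z y := fun z => by
    rw [inner_expVec, inner_expVec, ← Ioc_union_Ioc_eq_Ioc hc hx,
      setIntegral_union (Ioc_disjoint_Ioc_of_le le_rfl) measurableSet_Ioc
        ((hInt z).mono_set (Ioc_subset_Ioc_right hx)) ((hInt z).mono_set (Ioc_subset_Ioc_left hc)),
      ← integral_const_mul]
    congr 2
    ext y
    rw [← mul_assoc, ← Real.exp_add]
    ring_nf
  have hright : ∫ y in Ioc c x, Real.exp (m * (y - x)) * flipAfter c q y =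
      -∫ y in Ioc c x, Real.exp (m * (y - x)) * q y := by
    rw [← integral_neg]
    refine setIntegral_congr_ae measurableSet_Ioc ?_
    filter_upwards [(memLp_flip c q).coeFn_toLp] with y hy hyx
    rw [flipAfter, hy, if_neg (not_le.2 hyx.1)]
    ring
  rw [hsplit (flipAfter c q), hsplit q, hright, inner_expVec_flip_of_le le_rfl]
  ring

lemma prof_flip_of_le {a m c x : ℝ} (hx : x ≤ c) (q : HilbertL2) :
    prof a m (flipAfter c q) x = prof a m q x := by
  rw [prof, prof, inner_expVec_flip_of_le hx]

lemma prof_flip_of_ge {a m c x : ℝ} (hc : 0 ≤ c) (hx : c ≤ x) {q : HilbertL2}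
    (h0 : prof a m q c = 0) : prof a m (flipAfter c q) x = -prof a m q x := by
  unfold prof at *
  rw [inner_expVec_flip_of_ge hc hx]
  have : Real.exp (-m * x) = Real.exp (-m * (x - c)) * Real.exp (-m * c) := by
    rw [← Real.exp_add]; ring_nf
  linear_combination 2 * Real.exp (-m * (x - c)) * h0 + 2 * a * this

lemma prof_flip_sq {a m c : ℝ} (hc : 0 ≤ c) {q : HilbertL2} (h0 : prof a m q c = 0) (x : ℝ) :
    prof a m (flipAfter c q) x ^ 2 = prof a m q x ^ 2 := by
  rcases le_total x c with h | h
  · rw [prof_flip_of_le h]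
  · rw [prof_flip_of_ge hc h h0, neg_sq]

lemma IsMinimizer.flip_left {q p : HilbertL2} (h : IsMinimizer w lam κ q p) {c : ℝ} (hc : 0 ≤ c)
    (h0 : prof 1 κ q c = 0) : IsMinimizer w lam κ (flipAfter c q) p := fun q' p' => by
  refine le_trans (le_of_eq ?_) (h q' p')
  simp only [energy, norm_flip, potEnergy, potDensity, prof_flip_sq hc h0]

lemma IsMinimizer.flip_right {q p : HilbertL2} (h : IsMinimizer w lam κ q p) {c : ℝ} (hc : 0 ≤ c)
    (h0 : prof 0 0 p c = 0) : IsMinimizer w lam κ q (flipAfter c p) := fun q' p' => by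
  refine le_trans (le_of_eq ?_) (h q' p')
  simp only [energy, norm_flip, potEnergy, potDensity, prof_flip_sq hc h0]

lemma deriv_eq_zero_of_flip {u v : ℝ → ℝ} {d e c : ℝ} (hu : HasDerivAt u d c)
    (hv : HasDerivAt v e c) (hle : ∀ x ≤ c, v x = u x) (hge : ∀ x ≥ c, v x = -u x) : d = 0 := by
  have h1 : e = d := (uniqueDiffOn_Iic c c (mem_Iic.2 le_rfl)).eq_deriv _ hv.hasDerivWithinAt
    (hu.hasDerivWithinAt.congr (fun x hx => hle x hx) (hle c le_rfl))
  have h2 : e = -d := (uniqueDiffOn_Ici c c (mem_Ici.2 le_rfl)).eq_deriv _ hv.hasDerivWithinAt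
    (hu.neg.hasDerivWithinAt.congr (fun x hx => hge x hx) (hge c le_rfl))
  linarith

/-- Uniqueness for the linear Cauchy problem `u'' = V u`. -/
lemma eq_zero_of_deriv_eq_zero {u u' V : ℝ → ℝ} {M c : ℝ} (hc : 0 < c)
    (hu : ∀ x > 0, HasDerivAt u (u' x) x) (hu' : ∀ x > 0, HasDerivAt u' (V x * u x) x)
    (hV : ∀ x > 0, |V x| ≤ M) (h0 : u c = 0) (h0' : u' c = 0) : ∀ x > 0, u x = 0 := by
  have bound : ∀ x > 0, ‖((u' x, V x * u x) : ℝ × ℝ)‖ ≤ max 1 M * ‖((u x, u' x) : ℝ × ℝ)‖ := by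
    intro x hx
    rw [Prod.norm_def, Prod.norm_def]
    have hm : 0 ≤ max 1 M := zero_le_one.trans (le_max_left _ _)
    refine max_le ?_ ?_
    · calc ‖u' x‖ ≤ 1 * max ‖u x‖ ‖u' x‖ := by rw [one_mul]; exact le_max_right _ _
        _ ≤ _ := by gcongr; exact le_max_left _ _
    · rw [norm_mul]
      have h2 : ‖V x‖ ≤ max 1 M := (hV x hx).trans (le_max_right _ _)
      exact mul_le_mul h2 (le_max_left _ _) (norm_nonneg _) hm
  have hd : ∀ x > 0, HasDerivAt (fun y => ((u y, u' y) : ℝ × ℝ)) (u' x, V x * u x) x :=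
    fun x hx => (hu x hx).prodMk (hu' x hx)
  intro x hx
  rcases le_total c x with hcx | hcx
  · have := eq_zero_of_abs_deriv_le_mul_abs_self_of_eq_zero_right
      (f := fun y => ((u y, u' y) : ℝ × ℝ)) (f' := fun y => (u' y, V y * u y)) (K := max 1 M)
      (a := c) (b := x)
      (fun y hy => (hd y (hc.trans_le hy.1)).continuousAt.continuousWithinAt)
      (fun y hy => (hd y (hc.trans_le hy.1)).hasDerivWithinAt) (by simp [h0, h0'])
      (fun y hy => bound y (hc.trans_le hy.1)) x ⟨hcx, le_rfl⟩
    exact congrArg Prod.fst this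
  · have := eq_zero_of_abs_deriv_le_mul_abs_self_of_eq_zero_right
      (f := fun y => ((u (-y), u' (-y)) : ℝ × ℝ))
      (f' := fun y => -((u' (-y), V (-y) * u (-y)) : ℝ × ℝ)) (K := max 1 M)
      (a := -c) (b := -x)
      (fun y hy => ((hd (-y) (by linarith [hy.2])).scomp y
        (hasDerivAt_neg y)).continuousAt.continuousWithinAt)
      (fun y hy => (((hd (-y) (by linarith [hy.2])).scomp y
        (hasDerivAt_neg y)).congr_deriv (by simp)).hasDerivWithinAt) (by simp [h0, h0'])
      (fun y hy => by rw [norm_neg]; exact bound (-y) (by linarith [hy.2])) (-x)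
      ⟨by linarith, le_rfl⟩
    simpa using congrArg Prod.fst this

lemma IsProfile.neg_right {f f' g g' : ℝ → ℝ} (h : IsProfile w lam κ f f' g g') :
    IsProfile w lam κ f f' (fun x => -g x) (fun x => -g' x) where
  contf := h.contf
  contg := h.contg.neg
  df := h.df
  ddf x hx := by simpa using h.ddf x hx
  dg x hx := (h.dg x hx).neg
  ddg x hx := by simpa [Pi.neg_def] using (h.ddg x hx).neg
  g0 := by simp [h.g0]
  limf := h.limf
  limg := let ⟨L, hL⟩ := h.limg; ⟨-L, hL.neg⟩
  wbdd := by simpa using h.wbdd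

lemma IsMinimizer.pos_left {q p : HilbertL2} (h : IsMinimizer w lam κ q p)
    (hw : IsPot w) (hlam : 0 ≤ lam) (hκ : 1 ≤ κ) : ∀ x ≥ 0, 0 < prof 1 κ q x := by
  obtain ⟨f', g', hP⟩ := h.exists_isProfile hw hlam hκ
  have hne : ∀ x > 0, prof 1 κ q x ≠ 0 := fun c hc h0 => by
    obtain ⟨v', _, hPv⟩ := (h.flip_left hc.le h0).exists_isProfile hw hlam hκ
    have h0' := deriv_eq_zero_of_flip (hP.df c hc) (hPv.df c hc)
      (fun x hx => prof_flip_of_le hx q) (fun x hx => prof_flip_of_ge hc.le hx h0)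
    obtain ⟨M, hM0, hM⟩ := hP.exists_abs_pot_le
    have hz := eq_zero_of_deriv_eq_zero hc hP.df hP.ddf (M := κ ^ 2 + M) (fun x hx => by
      refine (abs_sub _ _).trans ?_
      rw [abs_of_nonneg (sq_nonneg κ)]
      have h1 := hM x hx.le
      have h2 : Real.exp (-2 * x) ≤ 1 := Real.exp_le_one_iff.2 (by linarith)
      nlinarith) h0 h0'
    have hlim : Tendsto (prof 1 κ q) (𝓝[>] 0) (𝓝 1) := by
      have := (continuous_prof 1 κ q).tendsto 0
      rw [prof_zero] at this
      exact this.mono_left nhdsWithin_le_nhds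
    have hlim0 : Tendsto (prof 1 κ q) (𝓝[>] 0) (𝓝 0) :=
      tendsto_const_nhds.congr' (by
        filter_upwards [self_mem_nhdsWithin] with x hx using (hz x hx).symm)
    exact one_ne_zero (tendsto_nhds_unique hlim hlim0)
  intro x hx
  by_contra hneg
  have hx0 : x ≠ 0 := by
    rintro rfl
    rw [prof_zero] at hneg
    exact hneg one_pos
  obtain ⟨y, hy, hy0⟩ := intermediate_value_Icc' hx (continuous_prof 1 κ q).continuousOn
    (⟨not_lt.1 hneg, by rw [prof_zero]; exact zero_le_one⟩ : (0 : ℝ) ∈ Icc _ _)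
  have : y ≠ 0 := by
    rintro rfl
    rw [prof_zero] at hy0
    exact one_ne_zero hy0
  exact hne y (lt_of_le_of_ne hy.1 this.symm) hy0

lemma IsMinimizer.right_eq_zero {q p : HilbertL2} (h : IsMinimizer w lam κ q p)
    (hw : IsPot w) (hlam : 0 ≤ lam) (hκ : 1 ≤ κ) {c : ℝ} (hc : 0 < c)
    (h0 : prof 0 0 p c = 0) : IsMinimizer w lam κ q 0 := by
  obtain ⟨f', g', hP⟩ := h.exists_isProfile hw hlam hκ
  obtain ⟨_, v', hPv⟩ := (h.flip_right hc.le h0).exists_isProfile hw hlam hκ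
  have h0' := deriv_eq_zero_of_flip (hP.dg c hc) (hPv.dg c hc)
    (fun x hx => prof_flip_of_le hx p) (fun x hx => prof_flip_of_ge hc.le hx h0)
  obtain ⟨M, hM0, hM⟩ := hP.exists_abs_pot_le
  have hz := eq_zero_of_deriv_eq_zero hc hP.dg hP.ddg (M := M) (fun x hx => by
    rw [abs_neg]
    have h1 := hM x hx.le
    have h2 : Real.exp (-2 * x) ≤ 1 := Real.exp_le_one_iff.2 (by linarith)
    nlinarith) h0 h0'
  intro q' p'
  refine le_trans ?_ (h q' p')
  have : potEnergy w κ q 0 = potEnergy w κ q p := by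
    refine setIntegral_congr_fun measurableSet_Ioi fun x hx => ?_
    simp only [potDensity, hz x hx]
    simp [prof]
  unfold energy
  rw [this]
  simp

/-- Existence of a positive profile, i.e. `lam` belongs to the symmetry-breaking range. -/
def HasPosProfile (w : ℝ → ℝ) (lam κ : ℝ) : Prop :=
  ∃ f f' g g', IsProfile w lam κ f f' g g' ∧ f 0 = 1 ∧ ∀ x > 0, 0 < g x

theorem hasPosProfile_or_isMinimizer (hw : IsPot w) (hlam : 0 ≤ lam) (hκ : 1 ≤ κ) :
    HasPosProfile w lam κ ∨ ∃ q, IsMinimizer w lam κ q 0 := by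
  obtain ⟨q, p, h⟩ := exists_isMinimizer (κ := κ) hw hlam
  by_cases hz : ∃ c > 0, prof 0 0 p c = 0
  · obtain ⟨c, hc, h0⟩ := hz
    exact Or.inr ⟨q, h.right_eq_zero hw hlam hκ hc h0⟩
  push Not at hz
  left
  obtain ⟨f', g', hP⟩ := h.exists_isProfile hw hlam hκ
  have hgc := continuous_prof 0 0 p
  have hsign : (∀ x > 0, 0 < prof 0 0 p x) ∨ ∀ x > 0, prof 0 0 p x < 0 := by
    by_contra hcon
    push Not at hcon
    obtain ⟨⟨x, hx, hx0⟩, y, hy, hy0⟩ := hcon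
    obtain ⟨c, hc, hc0⟩ := isPreconnected_Ioi.intermediate_value (mem_Ioi.2 hx) (mem_Ioi.2 hy)
      hgc.continuousOn (⟨hx0, hy0⟩ : (0 : ℝ) ∈ Icc _ _)
    exact hz c hc hc0
  rcases hsign with hs | hs
  · exact ⟨_, _, _, _, hP, prof_zero _ _ _, hs⟩
  · exact ⟨_, _, _, _, hP.neg_right, prof_zero _ _ _, fun x hx => neg_pos.2 (hs x hx)⟩

end Minimizers

section Stability
open Filter Topology

lemma integrableOn_sq_of_le_deriv_right {s s' p : ℝ → ℝ} {M C P : ℝ}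
    (hs : ContinuousOn s (Ioi 0)) (hd : ∀ x > 0, HasDerivWithinAt s (s' x) (Ici x) x)
    (hM : ∀ x > 0, |s x| ≤ M) (hp : AEStronglyMeasurable p (volume.restrict (Ioi 0)))
    (hP : ∀ x > 0, |p x| ≤ P) (hle : ∀ x > 0, p x ^ 2 ≤ s' x + C * Real.exp (-2 * x)) :
    IntegrableOn (fun x => p x ^ 2) (Ioi 0) := by
  have hfin : ∀ t ⊆ Ioi (0 : ℝ), MeasurableSet t → volume t < ⊤ →
      IntegrableOn (fun x => p x ^ 2) t := fun t ht hm ht' => by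
    have : IsFiniteMeasure (volume.restrict t) := ⟨by simpa using ht'⟩
    refine Integrable.of_bound ((hp.mono_measure (Measure.restrict_mono ht le_rfl)).pow 2)
      (P ^ 2) ?_
    filter_upwards [ae_restrict_mem hm] with x hx
    rw [Real.norm_eq_abs, abs_pow]
    gcongr
    exact hP x (ht hx)
  rw [← Ioc_union_Ioi_eq_Ioi zero_le_one]
  refine (hfin _ Ioc_subset_Ioi_self measurableSet_Ioc (by simp)).union ?_
  have hE : ∀ x : ℝ, HasDerivAt (fun x : ℝ => C / 2 * Real.exp (-2 * x))
      (-(C * Real.exp (-2 * x))) x :=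
    fun x => ((((hasDerivAt_id x).const_mul (-2)).exp).const_mul (C / 2)).congr_deriv
      (by simp; ring)
  refine integrableOn_Ioi_of_intervalIntegral_norm_bounded (l := atTop) (b := fun X : ℝ => X)
    (2 * M + |C|) 1 (fun X => hfin _ (fun x hx => zero_lt_one.trans hx.1) measurableSet_Ioc
      (by simp)) tendsto_id ?_
  filter_upwards [eventually_ge_atTop (1 : ℝ)] with X hX
  have h1 := intervalIntegral.integral_le_sub_of_hasDeriv_right_of_le (a := 1) (b := X)
    (g := fun x => s x - C / 2 * Real.exp (-2 * x)) (φ := fun x => p x ^ 2) hX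
    ((hs.mono fun x hx => zero_lt_one.trans_le hx.1).sub (by fun_prop))
    (fun x hx => ((hd x (zero_lt_one.trans hx.1)).sub
      (hE x).hasDerivWithinAt).mono Ioi_subset_Ici_self)
    (hfin _ (fun x hx => zero_lt_one.trans_le hx.1) measurableSet_Icc (by simp))
    (fun x hx => by rw [sub_neg_eq_add]; exact hle x (zero_lt_one.trans hx.1))
  simp only [norm_pow, Real.norm_eq_abs, sq_abs]
  refine h1.trans ?_
  have h2 := abs_le.1 (hM X (zero_lt_one.trans_le hX))
  have h3 := abs_le.1 (hM 1 zero_lt_one)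
  have h4 : ∀ x : ℝ, 0 < x → |C / 2 * Real.exp (-2 * x)| ≤ |C| / 2 := fun x hx => by
    rw [abs_mul, Real.abs_exp, abs_div, abs_two]
    exact mul_le_of_le_one_right (by positivity) (Real.exp_le_one_iff.2 (by linarith))
  have h5 := abs_le.1 (h4 X (zero_lt_one.trans_le hX))
  have h6 := abs_le.1 (h4 1 zero_lt_one)
  linarith [h2.1, h2.2, h3.1, h3.2, h5.1, h6.2]

lemma setIntegral_Ioi_comp_add_right (G : ℝ → ℝ) (c : ℝ) :
    ∫ x in Ioi 0, G (x + c) = ∫ x in Ioi c, G x := by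
  rw [← integral_indicator measurableSet_Ioi, ← integral_indicator measurableSet_Ioi,
    ← integral_add_right_eq_self ((Ioi c).indicator G) c]
  congr 1 with x
  simp [indicator_apply]

/-- Stability of a minimiser with vanishing second component, tested on a function shifted
by `c`. -/
lemma IsMinimizer.stable_comp_add {w : ℝ → ℝ} {lam κ c : ℝ} {q : HilbertL2}
    (h : IsMinimizer w lam κ q 0) (hw : IsPot w) (hlam : 0 ≤ lam) (hκ : 0 ≤ κ) (hc : 0 ≤ c)
    {φ p : ℝ → ℝ} (hφ : ContinuousOn φ (Ici 0)) (h0 : φ 0 = 0)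
    (hd : ∀ x > 0, HasDerivWithinAt φ (p x) (Ici x) x)
    (hp : MemLp p 2 (volume.restrict (Ioi 0))) :
    ∫ x in Ioi 0, lam * Real.exp (-2 * (x + c)) * w (1 - prof 1 κ q (x + c) ^ 2) * φ x ^ 2 ≤
      ∫ x in Ioi 0, p x ^ 2 := by
  set P : ℝ → ℝ := (Ioi 0).indicator p
  have hP : MemLp P 2 volume := (memLp_indicator_iff_restrict measurableSet_Ioi).2 hp
  have hPc : MemLp (fun y => P (y - c)) 2 volume :=
    hP.comp_measurePreserving (measurePreserving_sub_right volume c)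
  set z : HilbertL2 := hPc.toLp _
  have hz : ∀ᵐ y, z y = P (y - c) := hPc.coeFn_toLp
  have hnorm : ‖z‖ ^ 2 = ∫ x in Ioi 0, p x ^ 2 := by
    rw [← real_inner_self_eq_norm_sq, L2.inner_def]
    calc _ = ∫ y, P (y - c) ^ 2 := by
          refine integral_congr_ae ?_
          filter_upwards [hz] with y hy
          simp [hy, sq]
      _ = ∫ y, P y ^ 2 := integral_sub_right_eq_self (fun y => P y ^ 2) c
      _ = _ := by
          rw [← integral_indicator measurableSet_Ioi]
          congr 1 with y
          by_cases hy : y ∈ Ioi 0 <;> simp [P, hy]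
  have hin : ∀ x ≥ 0, inner ℝ (expVec 0 (x + c)) z = φ x := fun x hx => by
    have hloc : ∀ a b, IntervalIntegrable P volume a b := fun a b =>
      ((hP.locallyIntegrable (by norm_num)).integrableOn_isCompact
        isCompact_uIcc).intervalIntegrable
    rw [inner_expVec]
    calc _ = ∫ y in Ioc 0 (x + c), P (y - c) := by
          refine setIntegral_congr_ae measurableSet_Ioc ?_
          filter_upwards [hz] with y hy _
          simp [hy]
      _ = ∫ y in (-c)..x, P y := by
          rw [← intervalIntegral.integral_of_le (by linarith),
            intervalIntegral.integral_comp_sub_right]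
          simp
      _ = (∫ y in (-c)..0, P y) + ∫ y in 0..x, P y :=
          (intervalIntegral.integral_add_adjacent_intervals (hloc _ _) (hloc _ _)).symm
      _ = 0 + (φ x - φ 0) := by
          congr 1
          · rw [intervalIntegral.integral_of_le (by linarith)]
            refine setIntegral_eq_zero_of_forall_eq_zero fun y hy => ?_
            exact indicator_of_notMem (not_lt.2 hy.2) _
          · refine intervalIntegral.integral_eq_sub_of_hasDeriv_right_of_le hx
              (hφ.mono Icc_subset_Ici_self) (fun y hy => ?_) (hloc _ _)
            rw [show P y = p y from indicator_of_mem (mem_Ioi.2 hy.1) _]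
            exact (hd y hy.1).mono Ioi_subset_Ici_self
      _ = φ x := by rw [h0]; ring
  set G : ℝ → ℝ := fun x => w (1 - prof 1 κ q x ^ 2) * inner ℝ (expVec 0 x) z ^ 2 *
    Real.exp (-2 * x) with hG
  have hGi : IntegrableOn G (Ioi 0) := by
    have hcc := continuous_inner_expVec 0 z
    have := integrableOn_pot_mul hw (continuous_prof 1 κ q) (continuous_const (y := 0))
      (hcc.pow 2) (C := ‖z‖ * ‖z‖) fun x hx => by
        rw [sq]
        exact abs_mul_le_exp (abs_inner_expVec_le le_rfl hx z) (abs_inner_expVec_le le_rfl hx z)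
    simpa [hG] using this
  have hG0 : ∀ x, 0 ≤ G x := fun x =>
    mul_nonneg (mul_nonneg (hw.nonneg _) (sq_nonneg _)) (Real.exp_pos _).le
  rw [← hnorm]
  refine le_trans ?_ (h.stable hw hlam hκ z)
  calc _ = ∫ x in Ioi 0, lam * G (x + c) := by
        refine setIntegral_congr_fun measurableSet_Ioi fun x hx => ?_
        simp only [hG]
        rw [hin x (le_of_lt hx)]
        ring
    _ = lam * ∫ x in Ioi c, G x := by
        rw [integral_const_mul, setIntegral_Ioi_comp_add_right]
    _ ≤ _ := by
        refine mul_le_mul_of_nonneg_left ?_ hlam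
        exact setIntegral_mono_set hGi (ae_of_all _ hG0) (Ioi_subset_Ioi hc).eventuallyLE

end Stability

section Comparison
open Filter Topology

lemma abs_posPartSlope_le (v d : ℝ) : |posPartSlope v d| ≤ |d| := by
  unfold posPartSlope
  split_ifs
  · exact le_rfl
  · simp
  · rcases le_total d 0 with h | h <;> simp [h]

lemma measurable_posPartSlope : Measurable fun v : ℝ × ℝ => posPartSlope v.1 v.2 := by
  unfold posPartSlope
  refine Measurable.ite (measurableSet_lt measurable_const measurable_fst) measurable_snd ?_
  exact Measurable.ite (measurableSet_lt measurable_fst measurable_const) measurable_const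
    (measurable_snd.max measurable_const)

lemma integrableOn_of_abs_le_exp {u : ℝ → ℝ} {M : ℝ} (hu : ContinuousOn u (Ioi 0))
    (hM : ∀ x > 0, |u x| ≤ M * Real.exp (-2 * x)) : IntegrableOn u (Ioi 0) := by
  refine Integrable.mono' ((exp_neg_integrableOn_Ioi 0 two_pos).const_mul M)
    (hu.aestronglyMeasurable measurableSet_Ioi) ?_
  filter_upwards [ae_restrict_mem measurableSet_Ioi] with x hx using hM x hx

lemma integral_neg_of_le_deriv_right {B R Q : ℝ → ℝ} {B' S : ℝ → ℝ}
    (hBc : ContinuousOn B (Ioi 0)) (hB : ∀ x > 0, HasDerivWithinAt B (B' x) (Ici x) x)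
    (hB' : ∀ x > 0, R x + Q x ≤ B' x) (hR : IntegrableOn R (Ioi 0))
    (hQc : ContinuousOn Q (Ioi 0)) (hQ : ∀ x > 0, 0 < Q x)
    (hB0 : Tendsto B (𝓝[>] 0) (𝓝 0)) (hBS : ∀ x > 0, B x ≤ S x) (hS : Tendsto S atTop (𝓝 0)) :
    ∫ x in Ioi 0, R x < 0 := by
  by_contra! hRint
  have hRi : ∀ a b, 0 ≤ a → 0 ≤ b → IntervalIntegrable R volume a b := fun a b ha hb =>
    ⟨hR.mono_set fun x hx => ha.trans_lt hx.1, hR.mono_set fun x hx => hb.trans_lt hx.1⟩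
  have hInt : ∀ a > 0, ∀ b ≥ a, ∀ φ : ℝ → ℝ, IntervalIntegrable φ volume a b →
      (∀ x > 0, φ x ≤ B' x) → ∫ x in a..b, φ x ≤ B b - B a := fun a ha b hab φ hφ hle =>
    intervalIntegral.integral_le_sub_of_hasDeriv_right_of_le hab
      (hBc.mono fun x hx => ha.trans_le hx.1)
      (fun x hx => (hB x (ha.trans hx.1)).mono Ioi_subset_Ici_self)
      ((intervalIntegrable_iff_integrableOn_Icc_of_le hab enorm_ne_top).1 hφ)
      fun x hx => hle x (ha.trans hx.1)
  set D : ℝ → ℝ := fun x => B x - ∫ y in (0 : ℝ)..x, R y with hD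
  have hDm : MonotoneOn D (Ioi 0) := fun a ha b hb hab => by
    have h1 := hInt a ha b hab R (hRi a b (le_of_lt ha) (le_of_lt hb))
      fun x hx => (le_add_of_nonneg_right (hQ x hx).le).trans (hB' x hx)
    have h2 := intervalIntegral.integral_add_adjacent_intervals
      (hRi 0 a le_rfl (le_of_lt ha)) (hRi a b (le_of_lt ha) (le_of_lt hb))
    simp only [hD]
    linarith
  have hD0 : Tendsto D (𝓝[>] 0) (𝓝 0) := by
    have h1 : ContinuousOn (fun x => ∫ y in (0 : ℝ)..x, R y) (uIcc 0 1) :=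
      intervalIntegral.continuousOn_primitive_interval
        (by rw [uIcc_of_le zero_le_one]
            exact (intervalIntegrable_iff_integrableOn_Icc_of_le zero_le_one enorm_ne_top).1
              (hRi 0 1 le_rfl zero_le_one))
    have h2 := (h1 0 (by simp)).tendsto.mono_left (nhdsWithin_mono (s := Ioc 0 1) 0
      (by rw [uIcc_of_le zero_le_one]; exact Ioc_subset_Icc_self))
    rw [nhdsWithin_Ioc_eq_nhdsGT zero_lt_one, intervalIntegral.integral_same] at h2
    simpa [hD] using hB0.sub h2
  have hDle : ∀ x > 0, D x ≤ 0 := fun x hx => by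
    have h1 : Tendsto (fun X => S X - ∫ y in (0 : ℝ)..X, R y) atTop
        (𝓝 (0 - ∫ x in Ioi 0, R x)) :=
      hS.sub (intervalIntegral_tendsto_integral_Ioi 0 hR tendsto_id)
    have h2 := ge_of_tendsto h1 ((eventually_ge_atTop x).mono fun X hX =>
      (hDm hx (hx.trans_le hX) hX).trans
        (sub_le_sub_right (hBS X (hx.trans_le hX)) (∫ y in (0 : ℝ)..X, R y)))
    linarith
  have hDz : ∀ x > 0, D x = 0 := fun x hx =>
    le_antisymm (hDle x hx) (hDm.ge_of_tendsto_zero hD0 hx)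
  have hQi : IntervalIntegrable Q volume 1 2 :=
    (hQc.mono fun x hx => by
      rw [uIcc_of_le (by norm_num)] at hx
      exact zero_lt_one.trans_le hx.1).intervalIntegrable
  have hR12 := hRi 1 2 zero_le_one zero_le_two
  have h1 := hInt 1 one_pos 2 (by norm_num) (fun x => R x + Q x) (hR12.add hQi) hB'
  rw [intervalIntegral.integral_add hR12 hQi] at h1
  have h2 : 0 < ∫ x in (1 : ℝ)..2, Q x :=
    intervalIntegral.intervalIntegral_pos_of_pos_on hQi (fun x hx => hQ x (one_pos.trans hx.1))
      (by norm_num)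
  have h3 := intervalIntegral.integral_add_adjacent_intervals
    (hRi 0 1 le_rfl zero_le_one) hR12
  have h4 := hDz 1 one_pos
  have h5 := hDz 2 two_pos
  simp only [hD] at h4 h5
  linarith

end Comparison

section Exclusion
open Filter Topology

variable {w : ℝ → ℝ} {lam κ : ℝ}

lemma pot_comparison_pos {E f g H : ℝ} (hw : IsPot w) (hE : 0 < E) (hκ : 0 < κ) (hH : 0 ≤ H)
    (hg : 0 < g) (hρ : f ^ 2 + g ^ 2 ≤ 1) :
    0 < 2 * κ ^ 2 * max (H - f) 0 ^ 2 + (E * w (1 - f ^ 2 - g ^ 2) - E * w (1 - H ^ 2)) *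
      (2 * f * max (H - f) 0 + max (H - f) 0 ^ 2 - g ^ 2) := by
  rw [← mul_sub, sub_sub 1]
  rcases lt_or_ge 0 (H - f) with hux | hux
  · rw [max_eq_left hux.le, show 2 * f * (H - f) + (H - f) ^ 2 - g ^ 2 =
      H ^ 2 - (f ^ 2 + g ^ 2) by ring]
    have e1 := IsProfile.pot_sub_mul_le (r := f ^ 2 + g ^ 2) (s := H ^ 2) hw
    have e2 : 0 < 2 * κ ^ 2 * (H - f) ^ 2 := by positivity
    have e3 := mul_nonneg hE.le (neg_nonneg.2 e1)
    linarith
  · rw [max_eq_right hux]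
    have e2 : H ≤ f := by linarith
    have e3 : H ^ 2 ≤ f ^ 2 := by gcongr
    have e4 : 0 < g ^ 2 := by positivity
    have e5 : w (1 - (f ^ 2 + g ^ 2)) < w (1 - H ^ 2) :=
      hw.strict ⟨by linarith, by linarith [sq_nonneg f]⟩ ⟨by linarith, by linarith [sq_nonneg H]⟩
        (by linarith)
    have e6 := mul_pos (mul_pos hE (sub_pos.2 e5)) e4
    linarith

set_option maxHeartbeats 1000000 in
-- many elementary estimates in one context
/-- A profile with positive second component excludes a stable profile of the form `(H, 0)`. -/
theorem IsProfile.not_stable {f f' g g' H H' : ℝ → ℝ} (h₁ : IsProfile w lam κ f f' g g')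
    (h₂ : IsProfile w lam κ H H' (fun _ => 0) fun _ => 0) (hlam : 0 < lam) (hκ : 0 < κ)
    (hw : IsPot w) (hf0 : f 0 = 1) (hg : ∀ x > 0, 0 < g x) (hH0 : H 0 ^ 2 ≤ 1)
    (hH : ∀ x ≥ 0, 0 ≤ H x) :
    ¬ ∀ φ p : ℝ → ℝ, ContinuousOn φ (Ici 0) → φ 0 = 0 →
      (∀ x > 0, HasDerivWithinAt φ (p x) (Ici x) x) → MemLp p 2 (volume.restrict (Ioi 0)) →
      ∫ x in Ioi 0, lam * Real.exp (-2 * x) * w (1 - H x ^ 2) * φ x ^ 2 ≤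
        ∫ x in Ioi 0, p x ^ 2 := by
  intro hst
  have hw' : ∀ t < 0, w t ≤ 0 := fun t ht => (hw.zero t ht.le).le
  have hρ := h₁.sq_add_sq_le_one hlam.le hw' (by rw [hf0]; norm_num)
  have hσ : ∀ x ≥ 0, H x ^ 2 ≤ 1 := fun x hx => by
    simpa using h₂.sq_add_sq_le_one hlam.le hw' hH0 x hx
  set M := lam * w 1 with hM
  have hM0 : 0 ≤ M := mul_nonneg hlam.le (hw.nonneg 1)
  set V₁ : ℝ → ℝ := fun x => lam * Real.exp (-2 * x) * w (1 - f x ^ 2 - g x ^ 2) with hV₁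
  set V₂ : ℝ → ℝ := fun x => lam * Real.exp (-2 * x) * w (1 - H x ^ 2) with hV₂
  have hV : ∀ x t, t ≤ 1 → 0 ≤ lam * Real.exp (-2 * x) * w t ∧
      lam * Real.exp (-2 * x) * w t ≤ M * Real.exp (-2 * x) := fun x t ht =>
    ⟨mul_nonneg (mul_nonneg hlam.le (Real.exp_pos _).le) (hw.nonneg _), by
      rw [hM, mul_right_comm]
      exact mul_le_mul_of_nonneg_right (mul_le_mul_of_nonneg_left (hw.mono ht) hlam.le)
        (Real.exp_pos _).le⟩
  have hV₁b : ∀ x, 0 ≤ V₁ x ∧ V₁ x ≤ M * Real.exp (-2 * x) := fun x =>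
    hV x _ (by nlinarith [sq_nonneg (f x), sq_nonneg (g x)])
  have hV₂b : ∀ x, 0 ≤ V₂ x ∧ V₂ x ≤ M * Real.exp (-2 * x) := fun x =>
    hV x _ (by nlinarith [sq_nonneg (H x)])
  have hf1 : ∀ x ≥ 0, |f x| ≤ 1 := fun x hx => by
    rw [← sq_le_one_iff_abs_le_one]; nlinarith [hρ x hx, sq_nonneg (g x)]
  have hg1 : ∀ x ≥ 0, |g x| ≤ 1 := fun x hx => by
    rw [← sq_le_one_iff_abs_le_one]; nlinarith [hρ x hx, sq_nonneg (f x)]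
  have hH1 : ∀ x ≥ 0, |H x| ≤ 1 := fun x hx => by
    rw [← sq_le_one_iff_abs_le_one]; exact hσ x hx
  set u : ℝ → ℝ := fun x => H x - f x with hu
  set u' : ℝ → ℝ := fun x => H' x - f' x with hu'
  set φ : ℝ → ℝ := fun x => max (u x) 0 with hφ
  set p : ℝ → ℝ := fun x => posPartSlope (u x) (u' x) with hp
  have du : ∀ x > 0, HasDerivAt u (u' x) x := fun x hx => (h₂.df x hx).sub (h₁.df x hx)
  have du' : ∀ x > 0, HasDerivAt u' ((κ ^ 2 - V₂ x) * H x - (κ ^ 2 - V₁ x) * f x) x :=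
    fun x hx => ((h₂.ddf x hx).sub (h₁.ddf x hx)).congr_deriv (by simp [hV₁, hV₂])
  have dg' : ∀ x > 0, HasDerivAt g' (-V₁ x * g x) x := h₁.ddg
  have huc : ContinuousOn u (Ici 0) := h₂.contf.sub h₁.contf
  have hu0 : u 0 ≤ 0 := by
    have := (abs_le.1 (hH1 0 le_rfl)).2
    simp only [hu, hf0]; linarith
  obtain ⟨⟨C₁, hC₁⟩, hl₁⟩ := h₁.f'_bounded_tendsto
  obtain ⟨⟨C₂, hC₂⟩, hl₂⟩ := h₂.f'_bounded_tendsto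
  obtain ⟨⟨C₃, hC₃⟩, hl₃⟩ := h₁.g'_bounded_tendsto
  set C := C₂ + C₁ with hC
  have hu'b : ∀ x > 0, |u' x| ≤ C := fun x hx =>
    (abs_sub _ _).trans (add_le_add (hC₂ x hx) (hC₁ x hx))
  have hu'l : Tendsto u' atTop (𝓝 0) := by simpa using hl₂.sub hl₁
  have hC0 : 0 ≤ C := (abs_nonneg _).trans (hu'b 1 one_pos)
  have hφ0 : ∀ x, 0 ≤ φ x := fun x => le_max_right _ _
  have hφx : ∀ x ≥ 0, φ x ≤ C * x := fun x hx =>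
    max_le (le_mul_of_abs_deriv_le huc du hu'b hu0 x hx) (mul_nonneg hC0 hx)
  have hφ2 : ∀ x ≥ 0, φ x ≤ 2 := fun x hx => max_le (by
    have := (abs_le.1 (hH1 x hx)).2
    have := (abs_le.1 (hf1 x hx)).1
    simp only [hu]; linarith) zero_le_two
  have hφu : ∀ x, φ x * u x = φ x ^ 2 := fun x => by
    rcases le_total (u x) 0 with h | h <;> simp [hφ, h, sq]
  have hφc : ContinuousOn φ (Ici 0) := huc.sup continuousOn_const
  have hz : φ 0 = 0 := max_eq_right hu0
  have dφ : ∀ x > 0, HasDerivWithinAt φ (p x) (Ici x) x := fun x hx =>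
    hasDerivWithinAt_posPart (du x hx)
  have dφu : ∀ x > 0, HasDerivWithinAt (fun y => φ y * u' y) (p x ^ 2 + φ x *
      ((κ ^ 2 - V₂ x) * H x - (κ ^ 2 - V₁ x) * f x)) (Ici x) x := fun x hx =>
    hasDerivWithinAt_posPart_mul (du x hx) (du' x hx)
  have hI : Ioi (0 : ℝ) ⊆ Ici 0 := Ioi_subset_Ici_self
  have hu'c : ContinuousOn u' (Ioi 0) := fun x hx => (du' x hx).continuousAt.continuousWithinAt
  have hg'c : ContinuousOn g' (Ioi 0) := fun x hx => (dg' x hx).continuousAt.continuousWithinAt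
  have hpm : AEStronglyMeasurable p (volume.restrict (Ioi 0)) :=
    (measurable_posPartSlope.comp_aemeasurable
      (((huc.mono hI).aemeasurable measurableSet_Ioi).prodMk
        (hu'c.aemeasurable measurableSet_Ioi))).aestronglyMeasurable
  have hg'm : AEStronglyMeasurable g' (volume.restrict (Ioi 0)) :=
    hg'c.aestronglyMeasurable measurableSet_Ioi
  have hp2 : IntegrableOn (fun x => p x ^ 2) (Ioi 0) := by
    refine integrableOn_sq_of_le_deriv_right (M := 2 * C) (C := 4 * M) (P := C)
      ((hφc.mono hI).mul hu'c) dφu (fun x hx => ?_) hpm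
      (fun x hx => (abs_posPartSlope_le _ _).trans (hu'b x hx)) fun x hx => ?_
    · rw [Pi.mul_apply, abs_mul, abs_of_nonneg (hφ0 x)]
      exact mul_le_mul (hφ2 x (le_of_lt hx)) (hu'b x hx) (abs_nonneg _) zero_le_two
    · have e1 : |V₂ x * H x - V₁ x * f x| ≤ 2 * (M * Real.exp (-2 * x)) := by
        refine (abs_sub _ _).trans ?_
        rw [abs_mul (V₂ x), abs_mul (V₁ x), abs_of_nonneg (hV₂b x).1, abs_of_nonneg (hV₁b x).1]
        nlinarith [hV₂b x, hV₁b x, hH1 x (le_of_lt hx), hf1 x (le_of_lt hx),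
          abs_nonneg (H x), abs_nonneg (f x)]
      have e2 : φ x * (V₂ x * H x - V₁ x * f x) ≤ 2 * (2 * (M * Real.exp (-2 * x))) :=
        (mul_le_mul_of_nonneg_left ((le_abs_self _).trans e1) (hφ0 x)).trans
          (mul_le_mul_of_nonneg_right (hφ2 x (le_of_lt hx))
            (mul_nonneg zero_le_two (mul_nonneg hM0 (Real.exp_pos _).le)))
      have e3 : φ x * ((κ ^ 2 - V₂ x) * H x - (κ ^ 2 - V₁ x) * f x) =
          κ ^ 2 * (φ x * u x) - φ x * (V₂ x * H x - V₁ x * f x) := by simp only [hu]; ring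
      rw [e3, hφu]
      nlinarith [sq_nonneg (κ * φ x)]
  have hg2 : IntegrableOn (fun x => g' x ^ 2) (Ioi 0) := by
    refine integrableOn_sq_of_le_deriv_right (s := fun x => g x * g' x)
      (s' := fun x => g' x * g' x + g x * (-V₁ x * g x)) (M := C₃) (C := M) (P := C₃)
      ((h₁.contg.mono hI).mul hg'c)
      (fun x hx => ((h₁.dg x hx).mul (dg' x hx)).hasDerivWithinAt) (fun x hx => ?_) hg'm hC₃
      fun x hx => ?_
    · rw [abs_mul]
      nlinarith [hg1 x (le_of_lt hx), hC₃ x hx, abs_nonneg (g' x), abs_nonneg (g x)]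
    · have e1 : g x ^ 2 ≤ 1 := sq_le_one_iff_abs_le_one _ |>.2 (hg1 x (le_of_lt hx))
      nlinarith [hV₁b x]
  have hHc := h₂.contf.mono hI
  have hfc := h₁.contf.mono hI
  have hgc := h₁.contg.mono hI
  have hφc' := hφc.mono hI
  have hwc := hw.cont
  have hV₁c : ContinuousOn V₁ (Ioi 0) := by fun_prop
  have hV₂c : ContinuousOn V₂ (Ioi 0) := by fun_prop
  have hVφ : IntegrableOn (fun x => V₂ x * φ x ^ 2) (Ioi 0) := by
    refine integrableOn_of_abs_le_exp (M := M * 4) (by fun_prop) fun x hx => ?_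
    have e1 : φ x ^ 2 ≤ 4 := by nlinarith [hφ0 x, hφ2 x (le_of_lt hx)]
    rw [abs_of_nonneg (mul_nonneg (hV₂b x).1 (sq_nonneg _))]
    nlinarith [hV₂b x]
  have hVg : IntegrableOn (fun x => V₂ x * g x ^ 2) (Ioi 0) := by
    refine integrableOn_of_abs_le_exp (M := M) (by fun_prop) fun x hx => ?_
    have e1 : g x ^ 2 ≤ 1 := sq_le_one_iff_abs_le_one _ |>.2 (hg1 x (le_of_lt hx))
    rw [abs_of_nonneg (mul_nonneg (hV₂b x).1 (sq_nonneg _))]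
    nlinarith [hV₂b x]
  have hstφ := hst φ p hφc hz dφ ((memLp_two_iff_integrable_sq hpm).2 hp2)
  have hstg := hst g g' h₁.contg h₁.g0 (fun x hx => (h₁.dg x hx).hasDerivWithinAt)
    ((memLp_two_iff_integrable_sq hg'm).2 hg2)
  have hi₁ : IntegrableOn (fun x => p x ^ 2 - V₂ x * φ x ^ 2) (Ioi 0) := hp2.sub hVφ
  have hi₂ : IntegrableOn (fun x => g' x ^ 2 - V₂ x * g x ^ 2) (Ioi 0) := hg2.sub hVg
  have hneg := integral_neg_of_le_deriv_right
    (B := fun x => 2 * (φ x * u' x) - φ x ^ 2 * (g' x / g x) + g x * g' x)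
    (R := fun x => (p x ^ 2 - V₂ x * φ x ^ 2) + (g' x ^ 2 - V₂ x * g x ^ 2))
    (Q := fun x => 2 * κ ^ 2 * φ x ^ 2 + (V₁ x - V₂ x) * (2 * f x * φ x + φ x ^ 2 - g x ^ 2))
    (S := fun x => 2 * (φ x * u' x) + g x * g' x)
    ?_ (fun x hx => (((dφu x hx).const_mul 2).sub (hasDerivWithinAt_sq_mul_logDeriv (dφ x hx)
      (h₁.dg x hx) (dg' x hx) (hg x hx))).add ((h₁.dg x hx).mul (dg' x hx)).hasDerivWithinAt)
    (fun x hx => ?_) (hi₁.add hi₂) (by fun_prop) (fun x hx => ?_) ?_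
    (fun x hx => ?_) ?_
  · rw [integral_add hi₁ hi₂, integral_sub hp2 hVφ,
      integral_sub hg2 hVg] at hneg
    linarith
  · refine ((continuousOn_const.mul (hφc'.mul hu'c)).sub
      ((hφc'.pow 2).mul (hg'c.div hgc fun x hx => (hg x hx).ne'))).add (hgc.mul hg'c)
  · have e1 : φ x * ((κ ^ 2 - V₂ x) * H x - (κ ^ 2 - V₁ x) * f x) =
        (κ ^ 2 - V₂ x) * φ x ^ 2 + (V₁ x - V₂ x) * f x * φ x := by
      rw [← hφu]; simp only [hu]; ring
    rw [e1]
    nlinarith [sq_nonneg (p x - φ x * (g' x / g x))]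
  · exact pot_comparison_pos hw (mul_pos hlam (Real.exp_pos _)) hκ (hH x (le_of_lt hx)) (hg x hx)
      (hρ x (le_of_lt hx))
  · have t0 : Tendsto (fun x : ℝ => x) (𝓝[>] 0) (𝓝 0) :=
      tendsto_nhdsWithin_of_tendsto_nhds tendsto_id
    have t1 : Tendsto φ (𝓝[>] 0) (𝓝 0) := by
      simpa [hz] using (hφc 0 self_mem_Ici).tendsto.mono_left (nhdsWithin_mono 0 hI)
    have t2 : Tendsto g (𝓝[>] 0) (𝓝 0) := by
      simpa [h₁.g0] using (h₁.contg 0 self_mem_Ici).tendsto.mono_left (nhdsWithin_mono 0 hI)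
    have t3 := tendsto_mul_zero_of_abs_le t1 (v := u') (C := C)
      (eventually_nhdsWithin_of_forall hu'b)
    have t4 := tendsto_mul_zero_of_abs_le t2 (v := g') (C := C₃)
      (eventually_nhdsWithin_of_forall hC₃)
    have t5 : Tendsto (fun x => φ x ^ 2 * (g' x / g x)) (𝓝[>] 0) (𝓝 0) := by
      refine squeeze_zero' (g := fun x => C ^ 2 * x) ?_ ?_ (by simpa using t0.const_mul (C ^ 2))
      · exact eventually_nhdsWithin_of_forall fun x hx =>
          mul_nonneg (sq_nonneg _) (h₁.logDeriv_nonneg hlam.le hw hg hx)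
      · refine eventually_nhdsWithin_of_forall fun x hx => ?_
        have hx' : 0 < x := hx
        calc φ x ^ 2 * (g' x / g x) ≤ (C * x) ^ 2 * (1 / x) := by
              have := h₁.logDeriv_le hlam.le hw hg hx
              have := h₁.logDeriv_nonneg hlam.le hw hg hx
              have := hφx x hx'.le
              have := hφ0 x
              gcongr
          _ = C ^ 2 * x := by field_simp
    simpa using ((t3.const_mul 2).sub t5).add t4
  · have := mul_nonneg (sq_nonneg (φ x)) (h₁.logDeriv_nonneg hlam.le hw hg hx)
    linarith
  · have t1 := tendsto_mul_zero_of_abs_le hu'l (v := φ) (C := 2)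
      ((eventually_ge_atTop 0).mono fun x hx => by rw [abs_of_nonneg (hφ0 x)]; exact hφ2 x hx)
    have t2 := tendsto_mul_zero_of_abs_le hl₃ (v := g) (C := 1)
      ((eventually_ge_atTop 0).mono fun x hx => hg1 x hx)
    simpa [mul_comm] using (t1.const_mul 2).add t2

end Exclusion

section Threshold
open Filter Topology

variable {w : ℝ → ℝ} {lam κ : ℝ}

lemma IsProfile.comp_add {f f' g g' : ℝ → ℝ} (h : IsProfile w lam κ f f' g g') {c : ℝ}
    (hc : 0 ≤ c) (hg : ∀ x ≥ 0, g x = 0) :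
    IsProfile w (lam * Real.exp (-2 * c)) κ (fun x => f (x + c)) (fun x => f' (x + c))
      (fun _ => 0) fun _ => 0 := by
  have hpot : ∀ x > 0, lam * Real.exp (-2 * (x + c)) * w (1 - f (x + c) ^ 2 - g (x + c) ^ 2) =
      lam * Real.exp (-2 * c) * Real.exp (-2 * x) * w (1 - f (x + c) ^ 2 - 0 ^ 2) :=
    fun x hx => by
      rw [hg _ (by linarith), mul_add, Real.exp_add]
      ring
  refine ⟨h.contf.comp (by fun_prop) fun x hx => add_nonneg hx hc, continuousOn_const,
    fun x hx => (h.df (x + c) (by linarith)).comp_add_const x c, fun x hx => ?_,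
    fun x _ => hasDerivAt_const x 0, fun x _ => (hasDerivAt_const x 0).congr_deriv (by simp), rfl,
    h.limf.comp (tendsto_atTop_add_const_right _ _ tendsto_id), ⟨0, tendsto_const_nhds⟩, ?_⟩
  · rw [← hpot x hx]
    exact (h.ddf (x + c) (by linarith)).comp_add_const x c
  · obtain ⟨M, hM⟩ := h.wbdd
    refine ⟨M, fun x hx => ?_⟩
    have := hM (x + c) (by linarith)
    rwa [hg _ (by linarith)] at this

lemma prof_zero_zero_zero (x : ℝ) : prof 0 0 0 x = 0 := by simp [prof]

theorem HasPosProfile.not_isMinimizer {lam' : ℝ} {q : HilbertL2} (h : HasPosProfile w lam κ)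
    (hw : IsPot w) (hκ : 1 ≤ κ) (hlam : 0 < lam) (hle : lam ≤ lam') :
    ¬ IsMinimizer w lam' κ q 0 := by
  intro hq
  obtain ⟨f, f', g, g', hP, hf, hg⟩ := h
  have hlam' : 0 < lam' := hlam.trans_le hle
  have hκ0 : 0 < κ := by linarith
  set c := Real.log (lam' / lam) / 2 with hc
  have hc0 : 0 ≤ c := div_nonneg (Real.log_nonneg ((one_le_div hlam).2 hle)) zero_le_two
  have hlc : lam' * Real.exp (-2 * c) = lam := by
    rw [show -2 * c = -Real.log (lam' / lam) by rw [hc]; ring, Real.exp_neg,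
      Real.exp_log (div_pos hlam' hlam)]
    field_simp
  obtain ⟨F', G', hF⟩ := hq.exists_isProfile hw hlam'.le hκ
  have hS := hF.comp_add hc0 fun x _ => prof_zero_zero_zero x
  rw [hlc] at hS
  refine hP.not_stable hS hlam hκ0 hw hf hg ?_
    (fun x hx => (hq.pos_left hw hlam'.le hκ _ (add_nonneg hx hc0)).le)
    fun φ p hφ h0 hd hp => ?_
  · have := hF.sq_add_sq_le_one hlam'.le (fun t ht => (hw.zero t ht.le).le)
      (by rw [prof_zero]; norm_num) (0 + c) (by simpa using hc0)
    nlinarith [sq_nonneg (prof 0 0 0 (0 + c))]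
  · have := hq.stable_comp_add hw hlam'.le hκ0.le hc0 hφ h0 hd hp
    simpa only [mul_add, Real.exp_add, ← hlc, mul_assoc, mul_left_comm, mul_comm] using this

lemma exists_isMinimizer_of_tendsto (hw : IsPot w) (hlam : 0 ≤ lam) {lamn : ℕ → ℝ}
    (hl : Tendsto lamn atTop (𝓝 lam)) (hpos : ∀ n, 0 ≤ lamn n) {qn : ℕ → HilbertL2}
    (hq : ∀ n, IsMinimizer w (lamn n) κ (qn n) 0) : ∃ q, IsMinimizer w lam κ q 0 := by
  obtain ⟨q', p', h⟩ := exists_isMinimizer (κ := κ) hw hlam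
  have hA : Tendsto (fun n => energy w (lamn n) κ q' p') atTop (𝓝 (energy w lam κ q' p')) := by
    unfold energy
    exact (hl.mul_const _).const_add _
  obtain ⟨A, hAb⟩ := hA.bddAbove_range
  have hR : ∀ n, ‖qn n‖ ≤ Real.sqrt A := fun n => Real.le_sqrt_of_sq_le <|
    ((norm_sq_le_energy hw (hpos n) _ _).1.trans (hq n q' p')).trans (hAb ⟨n, rfl⟩)
  obtain ⟨q, p, hE, hp⟩ := exists_weak_limit (κ := κ) hw hl (qn := qn) (pn := fun _ => 0) hR
    (fun n => by simp) hA fun n => hq n q' p'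
  rw [hp fun _ => rfl] at hE
  exact ⟨q, fun q₁ p₁ => hE.trans (h q₁ p₁)⟩

/-- The exponential truncated to `(j, j + 1]`. -/
def expStep (κ : ℝ) (j : ℕ) : HilbertL2 :=
  expVec κ (j + 1) - Real.exp (-κ) • expVec κ j

lemma inner_expVec_expStep {κ a : ℝ} {j : ℕ} (ha : a ≤ j) :
    inner ℝ (expVec κ a) (expStep κ j) = 0 := by
  rw [expStep, inner_sub_right, inner_smul_right, inner_expVec_expVec, inner_expVec_expVec,
    min_eq_left ha, min_eq_left (by linarith), ← mul_assoc, ← Real.exp_add, sub_eq_zero]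
  congr 2
  ring

lemma norm_expStep_sq_le (hκ : 1 ≤ κ) (j : ℕ) : ‖expStep κ j‖ ^ 2 ≤ 1 := by
  have hj : (0 : ℝ) ≤ j := Nat.cast_nonneg j
  have h1 : ‖expStep κ j‖ ^ 2 = inner ℝ (expVec κ (j + 1)) (expStep κ j) := by
    rw [← real_inner_self_eq_norm_sq]
    nth_rewrite 1 [expStep]
    rw [inner_sub_left, real_inner_smul_left, inner_expVec_expStep le_rfl]
    ring
  rw [h1, expStep, inner_sub_right, inner_smul_right, inner_expVec_expVec, inner_expVec_expVec,
    min_self, min_eq_right (by linarith), max_eq_right hj, max_eq_right (by linarith)]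
  have h2 := mul_expPrim κ j
  have h3 := mul_expPrim κ (j + 1)
  have e1 : Real.exp (-κ) * (Real.exp (-κ * (j + 1 + j)) * expPrim κ j) =
      Real.exp (-κ * (j + 1 + (j + 1))) * expPrim κ j := by
    rw [← mul_assoc, ← Real.exp_add]; congr 2; ring
  have e2 : Real.exp (-κ * (j + 1 + (j + 1))) * Real.exp (2 * κ * (j + 1)) = 1 := by
    rw [← Real.exp_add, Real.exp_eq_one_iff]; ring
  rw [e1]
  set E := Real.exp (-κ * (j + 1 + (j + 1)))
  have hE : 0 < E := Real.exp_pos _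
  have e3 : 2 * κ * (E * expPrim κ (j + 1) - E * expPrim κ j) ≤ 1 := by
    have : 2 * κ * (E * expPrim κ (j + 1) - E * expPrim κ j) =
        1 - E * Real.exp (2 * κ * j) := by
      linear_combination E * h3 - E * h2 + e2
    rw [this]
    linarith [mul_pos hE (Real.exp_pos (2 * κ * j))]
  by_contra! hcon
  nlinarith

lemma exists_prof_ne_one (hκ : 1 ≤ κ) (q : HilbertL2) : ∃ x ≥ 0, prof 1 κ q x ≠ 1 := by
  by_contra! hcon
  have hin : ∀ x ≥ 0, inner ℝ (expVec κ x) q = 1 - Real.exp (-κ * x) := fun x hx => by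
    have := hcon x hx
    rw [prof] at this
    linarith
  set δ := 1 - Real.exp (-κ) with hδ
  have hδ0 : 0 < δ := sub_pos.2 (Real.exp_lt_one_iff.2 (by linarith))
  have hstep : ∀ j : ℕ, inner ℝ (expStep κ j) q = δ := fun j => by
    have hj : (0 : ℝ) ≤ j := Nat.cast_nonneg j
    rw [expStep, inner_sub_left, real_inner_smul_left, hin _ hj, hin _ (by linarith), hδ,
      mul_add, Real.exp_add]
    ring_nf
  set s : ℕ → HilbertL2 := fun N => ∑ j ∈ Finset.range N, expStep κ j
  have hs1 : ∀ N, inner ℝ (s N) q = N * δ := fun N => by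
    simp [s, sum_inner, hstep]
  have hs2 : ∀ N, ‖s N‖ ^ 2 ≤ N := fun N => by
    induction N with
    | zero => simp [s]
    | succ N ih =>
      have h0 : inner ℝ (s N) (expStep κ N) = 0 := by
        rw [sum_inner]
        refine Finset.sum_eq_zero fun j hj => ?_
        have hjN : (j : ℝ) + 1 ≤ N := by exact_mod_cast Finset.mem_range.1 hj
        have hj0 : (0 : ℝ) ≤ j := Nat.cast_nonneg j
        rw [expStep, inner_sub_left, real_inner_smul_left, inner_expVec_expStep hjN,
          inner_expVec_expStep (by linarith)]
        ring
      rw [show s (N + 1) = s N + expStep κ N from Finset.sum_range_succ _ _, norm_add_sq_real, h0]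
      push_cast
      linarith [norm_expStep_sq_le hκ N]
  obtain ⟨N, hN⟩ := exists_nat_gt (‖q‖ ^ 2 / δ ^ 2)
  have hN0 : (0 : ℝ) < N := (div_nonneg (sq_nonneg _) (sq_nonneg _)).trans_lt hN
  rw [div_lt_iff₀ (by positivity)] at hN
  have h1 := abs_real_inner_le_norm (s N) q
  rw [hs1, abs_of_nonneg (by positivity)] at h1
  have h2 : (N * δ) ^ 2 ≤ (‖s N‖ * ‖q‖) ^ 2 := by gcongr
  nlinarith [mul_le_mul_of_nonneg_right (hs2 N) (sq_nonneg ‖q‖)]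

lemma exists_energy_eq (hw : IsPot w) : ∃ (q p : HilbertL2) (A : ℝ),
    ∀ lam, energy w lam κ q p = A := by
  refine ⟨(κ * Real.exp κ) • expVec κ 1, expVec 0 1,
    ‖(κ * Real.exp κ) • expVec κ 1‖ ^ 2 + ‖expVec 0 1‖ ^ 2, fun lam => ?_⟩
  rw [energy, show potEnergy w κ ((κ * Real.exp κ) • expVec κ 1) (expVec 0 1) = 0 from ?_,
    mul_zero, add_zero]
  refine setIntegral_eq_zero_of_forall_eq_zero fun x hx => ?_
  have hx0 : 0 < x := hx
  rw [potDensity, hw.potential_eq_zero ?_, zero_mul]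
  rcases le_total x 1 with h1 | h1
  · have e1 : prof 1 κ ((κ * Real.exp κ) • expVec κ 1) x =
        (Real.exp (-(κ * x)) + Real.exp (κ * x)) / 2 := by
      have e2 : Real.exp κ * Real.exp (-κ * (x + 1)) = Real.exp (-(κ * x)) := by
        rw [← Real.exp_add]; ring_nf
      have e3 : Real.exp (-(κ * x)) * Real.exp (2 * κ * x) = Real.exp (κ * x) := by
        rw [← Real.exp_add]; ring_nf
      have e4 := mul_expPrim κ x
      rw [prof, inner_smul_right, inner_expVec_expVec, min_eq_left h1, max_eq_right hx0.le,
        neg_mul κ x]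
      linear_combination κ * expPrim κ x * e2 +
        Real.exp (-(κ * x)) * e4 / 2 + e3 / 2
    have e5 : 1 ≤ prof 1 κ ((κ * Real.exp κ) • expVec κ 1) x := by
      rw [e1, add_comm, ← Real.cosh_eq]
      exact Real.one_le_cosh _
    nlinarith [sq_nonneg (prof 0 0 (expVec 0 1) x)]
  · have e1 : prof 0 0 (expVec 0 1) x = 1 := by
      rw [prof, inner_expVec_expVec, min_eq_right h1]
      simp
    rw [e1]
    nlinarith [sq_nonneg (prof 1 κ ((κ * Real.exp κ) • expVec κ 1) x)]

lemma one_le_sq_of_potEnergy_eq_zero (hw : IsPot w) {q : HilbertL2}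
    (h : potEnergy w κ q 0 = 0) : ∀ x > 0, 1 ≤ prof 1 κ q x ^ 2 := by
  by_contra! hcon
  obtain ⟨x, hx, hlt⟩ := hcon
  have hc := continuous_potDensity (κ := κ) hw q 0
  refine (ne_of_gt ?_) h
  refine (setIntegral_pos_iff_support_of_nonneg_ae (ae_of_all _ fun y =>
    mul_nonneg (potDensity_nonneg hw q 0 y) (Real.exp_pos _).le)
    (integrableOn_potDensity hw q 0)).2 ?_
  refine IsOpen.measure_pos _ ?_ ⟨x, ?_, hx⟩
  · exact (Continuous.isOpen_support (by fun_prop)).inter isOpen_Ioi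
  · refine (mul_pos (hw.potential_pos ?_ ?_) (Real.exp_pos _)).ne'
    · rw [prof_zero_zero_zero]; linarith
    · nlinarith [sq_nonneg (prof 1 κ q x), sq_nonneg (prof 0 0 0 x)]

lemma exists_hasPosProfile (hw : IsPot w) (hκ : 1 ≤ κ) :
    ∃ lam > 0, HasPosProfile w lam κ := by
  by_contra! hcon
  have hlam : ∀ n : ℕ, (0 : ℝ) < n + 1 := fun n => by positivity
  have hmin : ∀ n : ℕ, ∃ q, IsMinimizer w (n + 1 : ℝ) κ q 0 := fun n =>
    (hasPosProfile_or_isMinimizer hw (hlam n).le hκ).resolve_left (hcon _ (hlam n))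
  choose qn hqn using hmin
  obtain ⟨q', p', A, hA⟩ := exists_energy_eq (κ := κ) hw
  have hE : ∀ n : ℕ, energy w (n + 1 : ℝ) κ (qn n) 0 ≤ A := fun n => (hqn n q' p').trans_eq (hA _)
  have hR : ∀ n, ‖qn n‖ ≤ Real.sqrt A := fun n => Real.le_sqrt_of_sq_le <|
    (norm_sq_le_energy hw (hlam n).le _ _).1.trans (hE n)
  obtain ⟨q, φ, hφ, hq⟩ := exists_weak_subseq_limit hR
  have hp0 : Tendsto (fun n => potEnergy w κ (qn (φ n)) 0) atTop (𝓝 0) := by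
    have h1 : Tendsto (fun n : ℕ => A * (1 / ((n : ℝ) + 1))) atTop (𝓝 0) := by
      simpa using tendsto_one_div_add_atTop_nhds_zero_nat.const_mul A
    refine squeeze_zero (fun n => potEnergy_nonneg hw _ _) (fun n => ?_)
      (h1.comp hφ.tendsto_atTop)
    have := hE (φ n)
    rw [energy] at this
    rw [Function.comp, mul_one_div, le_div_iff₀ (hlam _)]
    nlinarith [sq_nonneg ‖qn (φ n)‖, sq_nonneg ‖(0 : HilbertL2)‖]
  have hz : potEnergy w κ q 0 = 0 := tendsto_nhds_unique
    (tendsto_potEnergy hw hq fun v => tendsto_const_nhds) hp0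
  have hlim : ∀ x, Tendsto (fun n => prof 1 κ (qn (φ n)) x) atTop (𝓝 (prof 1 κ q x)) := fun x =>
    (hq _).const_add _
  have h1 : ∀ x ≥ 0, 0 ≤ prof 1 κ q x := fun x hx =>
    ge_of_tendsto' (hlim x) fun n => ((hqn _).pos_left hw (hlam _).le hκ x hx).le
  have h2 : ∀ x ≥ 0, prof 1 κ q x ≤ 1 := fun x hx =>
    le_of_tendsto' (hlim x) fun n => by
      obtain ⟨f', g', hP⟩ := (hqn (φ n)).exists_isProfile hw (hlam _).le hκ
      have := hP.sq_add_sq_le_one (hlam _).le (fun t ht => (hw.zero t ht.le).le)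
        (by rw [prof_zero]; norm_num) x hx
      nlinarith [sq_nonneg (prof 0 0 0 x)]
  obtain ⟨x, hx, hne⟩ := exists_prof_ne_one hκ q
  refine hne (le_antisymm (h2 x hx) ?_)
  rcases hx.eq_or_lt with rfl | hx'
  · exact (prof_zero 1 κ q).ge
  · nlinarith [one_le_sq_of_potEnergy_eq_zero hw hz x hx', h1 x hx]

/-- Profiles with positive second component exist exactly above a critical coupling. -/
theorem exists_threshold (hw : IsPot w) (hκ : 1 ≤ κ) :
    ∃ L > 0, ∀ lam > 0, HasPosProfile w lam κ ↔ L < lam := by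
  set S : Set ℝ := {lam | 0 < lam ∧ HasPosProfile w lam κ} with hS
  have hne : S.Nonempty := let ⟨l, hl, h⟩ := exists_hasPosProfile hw hκ; ⟨l, hl, h⟩
  have hw1 : 0 < w 1 := by
    rw [← hw.zero 0 le_rfl]
    exact hw.strict ⟨le_rfl, zero_le_one⟩ ⟨zero_le_one, le_rfl⟩ one_pos
  have hlow : ∀ l ∈ S, 4 / w 1 ≤ l := by
    rintro l ⟨hl, f, f', g, g', hP, -, hg⟩
    rw [div_le_iff₀ hw1]
    exact hP.four_le_of_pos hl.le hw hg
  have hbdd : BddBelow S := ⟨4 / w 1, hlow⟩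
  set L := sInf S
  have hL : 0 < L := (by positivity : 0 < 4 / w 1).trans_le (le_csInf hne hlow)
  have hLS : ¬ HasPosProfile w L κ := fun hcon => by
    have hl : ∀ n : ℕ, 0 < L - L * (1 / ((n + 1 : ℕ) + 1)) ∧
        L - L * (1 / ((n + 1 : ℕ) + 1)) < L := fun n => by
      have h1 : 1 / (((n + 1 : ℕ) : ℝ) + 1) < 1 := by
        rw [div_lt_one (by positivity)]; push_cast; linarith [(Nat.cast_nonneg n : (0 : ℝ) ≤ n)]
      have h2 : 0 < 1 / (((n + 1 : ℕ) : ℝ) + 1) := by positivity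
      constructor <;> nlinarith
    have hmin : ∀ n : ℕ, ∃ q, IsMinimizer w (L - L * (1 / ((n + 1 : ℕ) + 1))) κ q 0 := fun n =>
      (hasPosProfile_or_isMinimizer hw (hl n).1.le hκ).resolve_left fun h =>
        (hl n).2.not_ge (csInf_le hbdd ⟨(hl n).1, h⟩)
    choose qn hqn using hmin
    have hlim : Tendsto (fun n : ℕ => L - L * (1 / (((n + 1 : ℕ) : ℝ) + 1))) atTop (𝓝 L) := by
      simpa using ((tendsto_one_div_add_atTop_nhds_zero_nat (𝕜 := ℝ)).comp
        (tendsto_add_atTop_nat 1)).const_mul L |>.const_sub L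
    obtain ⟨q, hq⟩ := exists_isMinimizer_of_tendsto hw hL.le hlim (fun n => (hl n).1.le) hqn
    exact hcon.not_isMinimizer hw hκ hL le_rfl hq
  refine ⟨L, hL, fun lam hlam => ⟨fun h => ?_, fun h => ?_⟩⟩
  · refine lt_of_le_of_ne (csInf_le hbdd ⟨hlam, h⟩) fun he => hLS ?_
    rwa [he]
  · obtain ⟨l, ⟨hl, hPl⟩, hlt⟩ := exists_lt_of_csInf_lt hne h
    refine (hasPosProfile_or_isMinimizer hw hlam.le hκ).resolve_right ?_
    rintro ⟨q, hq⟩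
    exact hPl.not_isMinimizer hw hκ hl hlt.le hq

end Threshold

section Radial
open Filter Topology

/-- The potential derivative `W'` frozen outside `[0, 1]`. -/
def truncWd (W : ℝ → ℝ) (t : ℝ) : ℝ := Wd W (max 0 (min t 1))

lemma truncWd_of_mem {W : ℝ → ℝ} {t : ℝ} (ht : t ∈ Icc (0 : ℝ) 1) : truncWd W t = Wd W t := by
  rw [truncWd, min_eq_left ht.2, max_eq_right ht.1]

section Potential
variable {W : ℝ → ℝ}

lemma strictMonoOn_Wd (hW : ContDiffOn ℝ 1 W (Iic (1 : ℝ)))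
    (hWconv : StrictConvexOn ℝ (Iic (1 : ℝ)) W) : StrictMonoOn (Wd W) (Iic 1) :=
  hWconv.strictMonoOn_derivWithin (hW.differentiableOn one_ne_zero)

lemma continuousOn_Wd (hW : ContDiffOn ℝ 1 W (Iic (1 : ℝ))) : ContinuousOn (Wd W) (Iic 1) :=
  hW.continuousOn_derivWithin (uniqueDiffOn_Iic 1) le_rfl

lemma Wd_zero (hW0 : W 0 = 0) (hWpos : ∀ t ∈ Iic (1 : ℝ), t ≠ 0 → 0 < W t) : Wd W 0 = 0 := by
  have hn : Iic (1 : ℝ) ∈ 𝓝 0 := Iic_mem_nhds one_pos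
  rw [Wd, derivWithin_of_mem_nhds hn]
  refine IsLocalMin.deriv_eq_zero ?_
  filter_upwards [hn] with t ht
  rcases eq_or_ne t 0 with rfl | h
  · exact le_rfl
  · exact hW0.trans_le (hWpos t ht h).le

lemma isPot_truncWd (hW : ContDiffOn ℝ 1 W (Iic (1 : ℝ)))
    (hWconv : StrictConvexOn ℝ (Iic (1 : ℝ)) W) (h0 : Wd W 0 = 0) : IsPot (truncWd W) where
  cont := (continuousOn_Wd hW).comp_continuous (by fun_prop) fun t =>
    mem_Iic.2 <| max_le zero_le_one (min_le_right _ _)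
  mono s t hst := (strictMonoOn_Wd hW hWconv).monotoneOn
    (mem_Iic.2 <| max_le zero_le_one (min_le_right _ _))
    (mem_Iic.2 <| max_le zero_le_one (min_le_right _ _)) (by gcongr)
  zero t ht := by rw [truncWd, max_eq_left ((min_le_left _ _).trans ht), h0]
  strict s hs t ht hst := by
    rw [truncWd_of_mem hs, truncWd_of_mem ht]
    exact strictMonoOn_Wd hW hWconv hs.2 ht.2 hst

end Potential

lemma exp_neg_mem_Ioo {x : ℝ} (hx : 0 < x) : Real.exp (-x) ∈ Ioo (0 : ℝ) 1 :=
  ⟨Real.exp_pos _, Real.exp_lt_one_iff.2 (by linarith)⟩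

lemma exp_neg_mem_Icc {x : ℝ} (hx : 0 ≤ x) : Real.exp (-x) ∈ Icc (0 : ℝ) 1 :=
  ⟨(Real.exp_pos _).le, Real.exp_le_one_iff.2 (by linarith)⟩

lemma hasDerivAt_exp_neg (x : ℝ) :
    HasDerivAt (fun y : ℝ => Real.exp (-y)) (-Real.exp (-x)) x := by
  simpa using (hasDerivAt_neg x).exp

lemma hasDerivAt_deriv_of_contDiffOn {u : ℝ → ℝ} {r : ℝ} (hu : ContDiffOn ℝ 2 u (Ioo 0 1))
    (hr : r ∈ Ioo (0 : ℝ) 1) :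
    HasDerivAt u (deriv u r) r ∧ HasDerivAt (deriv u) (deriv (deriv u) r) r := by
  have h1 := hu.contDiffAt (Ioo_mem_nhds hr.1 hr.2)
  refine ⟨(h1.differentiableAt two_ne_zero).hasDerivAt, DifferentiableAt.hasDerivAt ?_⟩
  exact ((h1.derivWithin (m := 1) (by norm_num)).differentiableAt one_ne_zero)

lemma hasDerivAt_comp_exp_neg {u : ℝ → ℝ} {x : ℝ} (hu : ContDiffOn ℝ 2 u (Ioo 0 1))
    (hx : 0 < x) :
    HasDerivAt (fun y => u (Real.exp (-y))) (-Real.exp (-x) * deriv u (Real.exp (-x))) x ∧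
    HasDerivAt (fun y => -Real.exp (-y) * deriv u (Real.exp (-y)))
      (Real.exp (-x) * deriv u (Real.exp (-x)) +
        Real.exp (-x) ^ 2 * deriv (deriv u) (Real.exp (-x))) x := by
  obtain ⟨h1, h2⟩ := hasDerivAt_deriv_of_contDiffOn hu (exp_neg_mem_Ioo hx)
  have he := hasDerivAt_exp_neg x
  refine ⟨(h1.comp x he).congr_deriv (by ring), ?_⟩
  refine (he.neg.mul (h2.comp x he)).congr_deriv ?_
  simp only [Pi.neg_apply, Function.comp]
  ring

lemma tendsto_comp_exp_neg {u : ℝ → ℝ} (hu : ContinuousOn u (Icc 0 1)) :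
    Tendsto (fun x => u (Real.exp (-x))) atTop (𝓝 (u 0)) := by
  refine (hu 0 (by simp)).tendsto.comp (tendsto_nhdsWithin_iff.2
    ⟨Real.tendsto_exp_atBot.comp tendsto_neg_atTop_atBot, ?_⟩)
  filter_upwards [eventually_ge_atTop 0] with x hx using exp_neg_mem_Icc hx

lemma continuousOn_comp_exp_neg {u : ℝ → ℝ} (hu : ContinuousOn u (Icc 0 1)) :
    ContinuousOn (fun x => u (Real.exp (-x))) (Ici 0) :=
  hu.comp (by fun_prop) fun _ hx => exp_neg_mem_Icc hx

lemma SolvesSystem.isProfile {W : ℝ → ℝ} {ε : ℝ} {k : ℤ} {f g : ℝ → ℝ}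
    (hW : ContDiffOn ℝ 1 W (Iic (1 : ℝ))) (h : SolvesSystem W ε k f g) :
    IsProfile (Wd W) (1 / ε ^ 2) |(k : ℝ)| (fun x => f (Real.exp (-x)))
      (fun x => -Real.exp (-x) * deriv f (Real.exp (-x))) (fun x => g (Real.exp (-x)))
      (fun x => -Real.exp (-x) * deriv g (Real.exp (-x))) := by
  obtain ⟨cf, cg, df, dg, ef, eg, f0, f1, -, g1⟩ := h
  have hexp : ∀ x : ℝ, Real.exp (-2 * x) = Real.exp (-x) ^ 2 := fun x => by
    rw [← Real.exp_nat_mul]; congr 1; push_cast; ring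
  refine ⟨continuousOn_comp_exp_neg cf, continuousOn_comp_exp_neg cg,
    fun x hx => (hasDerivAt_comp_exp_neg df hx).1, fun x hx => ?_,
    fun x hx => (hasDerivAt_comp_exp_neg dg hx).1, fun x hx => ?_, by simpa using g1,
    by simpa [f0] using tendsto_comp_exp_neg cf, ⟨_, tendsto_comp_exp_neg cg⟩, ?_⟩
  · refine (hasDerivAt_comp_exp_neg df hx).2.congr_deriv ?_
    have e := ef _ (exp_neg_mem_Ioo hx)
    have hr := (Real.exp_pos (-x)).ne'
    rw [hexp, sq_abs]
    generalize Real.exp (-x) = r at *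
    have e1 := congrArg (fun y => r ^ 2 * y) e
    field_simp at e1 ⊢
    linear_combination -e1
  · refine (hasDerivAt_comp_exp_neg dg hx).2.congr_deriv ?_
    have e := eg _ (exp_neg_mem_Ioo hx)
    have hr := (Real.exp_pos (-x)).ne'
    rw [hexp]
    generalize Real.exp (-x) = r at *
    have e1 := congrArg (fun y => r ^ 2 * y) e
    field_simp at e1 ⊢
    linear_combination -e1
  · have hc : ContinuousOn (fun r => Wd W (1 - f r ^ 2 - g r ^ 2)) (Icc 0 1) :=
      (continuousOn_Wd hW).comp (by fun_prop) fun r _ => by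
        show 1 - f r ^ 2 - g r ^ 2 ≤ 1
        nlinarith [sq_nonneg (f r), sq_nonneg (g r)]
    obtain ⟨M, hM⟩ := isCompact_Icc.exists_bound_of_continuousOn hc
    exact ⟨M, fun x hx => hM _ (exp_neg_mem_Icc hx)⟩

lemma SolvesSystem.isProfile_truncWd {W : ℝ → ℝ} {ε : ℝ} {k : ℤ} {f g : ℝ → ℝ}
    (hW : ContDiffOn ℝ 1 W (Iic (1 : ℝ))) (hWconv : StrictConvexOn ℝ (Iic (1 : ℝ)) W)
    (h0 : Wd W 0 = 0) (h : SolvesSystem W ε k f g) :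
    IsProfile (truncWd W) (1 / ε ^ 2) |(k : ℝ)| (fun x => f (Real.exp (-x)))
      (fun x => -Real.exp (-x) * deriv f (Real.exp (-x))) (fun x => g (Real.exp (-x)))
      (fun x => -Real.exp (-x) * deriv g (Real.exp (-x))) := by
  have hP := h.isProfile hW
  have hle := hP.sq_add_sq_le_one (by positivity)
    (fun t ht => ((strictMonoOn_Wd hW hWconv (mem_Iic.2 (ht.le.trans zero_le_one))
      (mem_Iic.2 zero_le_one) ht).trans_eq h0).le)
    (by obtain ⟨-, -, -, -, -, -, -, f1, -⟩ := h; simp [f1])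
  refine hP.congr_pot fun x hx => truncWd_of_mem ⟨?_, ?_⟩
  · linarith [hle x hx]
  · nlinarith [sq_nonneg (f (Real.exp (-x))), sq_nonneg (g (Real.exp (-x)))]

/-- The radial function with profile `F` in the variable `-log r` and value `L` at the origin. -/
def radial (F : ℝ → ℝ) (L r : ℝ) : ℝ := if r ≤ 0 then L else F (-Real.log r)

lemma radial_zero (F : ℝ → ℝ) (L : ℝ) : radial F L 0 = L := if_pos le_rfl

lemma radial_of_pos {F : ℝ → ℝ} {L r : ℝ} (hr : 0 < r) : radial F L r = F (-Real.log r) :=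
  if_neg hr.not_ge

lemma radial_eventuallyEq {F : ℝ → ℝ} {L r : ℝ} (hr : 0 < r) :
    radial F L =ᶠ[𝓝 r] fun s => F (-Real.log s) := by
  filter_upwards [Ioi_mem_nhds hr] with s hs using radial_of_pos hs

lemma neg_log_pos_of_mem {r : ℝ} (hr : r ∈ Ioo (0 : ℝ) 1) : 0 < -Real.log r :=
  neg_pos.2 (Real.log_neg hr.1 hr.2)

lemma continuousOn_radial {F : ℝ → ℝ} {L : ℝ} (hF : ContinuousOn F (Ici 0))
    (hL : Tendsto F atTop (𝓝 L)) : ContinuousOn (radial F L) (Icc 0 1) := by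
  intro r hr
  rcases hr.1.eq_or_lt with rfl | hr0
  · have h1 : ContinuousWithinAt (radial F L) (insert 0 (Ioi 0)) 0 := by
      rw [continuousWithinAt_insert_self, ContinuousWithinAt, radial_zero]
      refine (hL.comp (tendsto_neg_atBot_atTop.comp Real.tendsto_log_nhdsGT_zero)).congr' ?_
      filter_upwards [self_mem_nhdsWithin] with s hs using (radial_of_pos hs).symm
    exact h1.mono fun s hs => hs.1.eq_or_lt.imp Eq.symm id
  · have h1 : ContinuousWithinAt (fun s => F (-Real.log s)) (Icc 0 1) r :=
      ContinuousWithinAt.comp (g := F) (f := fun s => -Real.log s) (t := Ici 0)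
        (hF _ (neg_nonneg.2 (Real.log_nonpos hr.1 hr.2)))
        (Real.continuousAt_log hr0.ne').neg.continuousWithinAt
        fun s hs => neg_nonneg.2 (Real.log_nonpos hs.1 hs.2)
    exact h1.congr_of_eventuallyEq ((radial_eventuallyEq hr0).filter_mono nhdsWithin_le_nhds)
      (radial_of_pos hr0)

lemma hasDerivAt_radial {F F' : ℝ → ℝ} {L r : ℝ} (hF : ∀ x > 0, HasDerivAt F (F' x) x)
    (hr : r ∈ Ioo (0 : ℝ) 1) :
    HasDerivAt (radial F L) (-(1 / r) * F' (-Real.log r)) r := by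
  have h := (hF _ (neg_log_pos_of_mem hr)).comp r (Real.hasDerivAt_log hr.1.ne').neg
  exact (h.congr_of_eventuallyEq (radial_eventuallyEq hr.1)).congr_deriv (by ring)

lemma hasDerivAt_deriv_radial {F F' F'' : ℝ → ℝ} {L r : ℝ}
    (hF : ∀ x > 0, HasDerivAt F (F' x) x) (hF' : ∀ x > 0, HasDerivAt F' (F'' x) x)
    (hr : r ∈ Ioo (0 : ℝ) 1) :
    HasDerivAt (deriv (radial F L))
      (1 / r ^ 2 * (F' (-Real.log r) + F'' (-Real.log r))) r := by
  have h := (hF' _ (neg_log_pos_of_mem hr)).comp r (Real.hasDerivAt_log hr.1.ne').neg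
  have h1 := (hasDerivAt_inv hr.1.ne').neg.mul h
  refine (h1.congr_of_eventuallyEq ?_).congr_deriv ?_
  · filter_upwards [Ioo_mem_nhds hr.1 hr.2] with s hs
    rw [(hasDerivAt_radial hF hs).deriv]
    simp
  · have := hr.1.ne'
    simp only [Pi.neg_apply, Function.comp]
    field_simp

lemma contDiffOn_radial {F F' F'' : ℝ → ℝ} {L : ℝ} (hF : ∀ x > 0, HasDerivAt F (F' x) x)
    (hF' : ∀ x > 0, HasDerivAt F' (F'' x) x) (hF'' : ContinuousOn F'' (Ioi 0)) :
    ContDiffOn ℝ 2 (radial F L) (Ioo 0 1) := by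
  have hd := fun r hr => (hasDerivAt_radial (L := L) hF (r := r) hr)
  have hdd := fun r hr => (hasDerivAt_deriv_radial (L := L) hF hF' (r := r) hr)
  have hlog : ContinuousOn (fun r => -Real.log r) (Ioo 0 1) := fun r hr =>
    (Real.continuousAt_log hr.1.ne').neg.continuousWithinAt
  have hmaps : MapsTo (fun r => -Real.log r) (Ioo 0 1) (Ioi 0) := fun r hr =>
    neg_log_pos_of_mem hr
  rw [show (2 : WithTop ℕ∞) = 1 + 1 by norm_num, contDiffOn_succ_iff_deriv_of_isOpen isOpen_Ioo]
  refine ⟨fun r hr => (hd r hr).differentiableAt.differentiableWithinAt, by simp, ?_⟩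
  rw [show (1 : WithTop ℕ∞) = 0 + 1 by norm_num, contDiffOn_succ_iff_deriv_of_isOpen isOpen_Ioo]
  refine ⟨fun r hr => (hdd r hr).differentiableAt.differentiableWithinAt, by simp, ?_⟩
  rw [contDiffOn_zero]
  have hcF' : ContinuousOn F' (Ioi 0) := fun x hx => (hF' x hx).continuousAt.continuousWithinAt
  refine ContinuousOn.congr (f := fun r => 1 / r ^ 2 * (F' (-Real.log r) + F'' (-Real.log r)))
    (ContinuousOn.mul (fun r hr => ContinuousAt.continuousWithinAt ?_)
      ((hcF'.comp hlog hmaps).add (hF''.comp hlog hmaps))) fun r hr => (hdd r hr).deriv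
  exact continuousAt_const.div (by fun_prop) (pow_ne_zero 2 hr.1.ne')

lemma exp_neg_two_mul_neg_log {r : ℝ} (hr : 0 < r) :
    Real.exp (-2 * -Real.log r) = r ^ 2 := by
  rw [show -2 * -Real.log r = (2 : ℕ) * Real.log r by push_cast; ring, Real.exp_nat_mul,
    Real.exp_log hr]

lemma IsProfile.solvesSystem {W : ℝ → ℝ} {ε L : ℝ} {k : ℤ} {f f' g g' : ℝ → ℝ}
    (h : IsProfile (truncWd W) (1 / ε ^ 2) |(k : ℝ)| f f' g g') (hw : IsPot (truncWd W))
    (hf : f 0 = 1) (hg : ∀ x > 0, 0 < g x) (hL : Tendsto g atTop (𝓝 L)) :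
    SolvesSystem W ε k (radial f 0) (radial g L) := by
  have hlam : 0 ≤ 1 / ε ^ 2 := by positivity
  have hle := h.sq_add_sq_le_one hlam (fun t ht => (hw.zero t ht.le).le) (by rw [hf]; norm_num)
  have hWd : ∀ x ≥ 0, truncWd W (1 - f x ^ 2 - g x ^ 2) = Wd W (1 - f x ^ 2 - g x ^ 2) :=
    fun x hx => truncWd_of_mem ⟨by linarith [hle x hx],
      by nlinarith [sq_nonneg (f x), sq_nonneg (g x)]⟩
  have hcf : ContinuousOn f (Ioi 0) := h.contf.mono Ioi_subset_Ici_self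
  have hcg : ContinuousOn g (Ioi 0) := h.contg.mono Ioi_subset_Ici_self
  have hcw : ContinuousOn (fun x => truncWd W (1 - f x ^ 2 - g x ^ 2)) (Ioi 0) :=
    hw.cont.comp_continuousOn (by fun_prop)
  refine ⟨continuousOn_radial h.contf h.limf, continuousOn_radial h.contg hL,
    contDiffOn_radial h.df h.ddf (by fun_prop), contDiffOn_radial h.dg h.ddg (by fun_prop),
    fun r hr => ?_, fun r hr => ?_, radial_zero _ _, ?_, ?_, ?_⟩
  · rw [(hasDerivAt_deriv_radial h.df h.ddf hr).deriv, (hasDerivAt_radial h.df hr).deriv,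
      radial_of_pos hr.1, radial_of_pos hr.1, ← hWd _ (neg_log_pos_of_mem hr).le,
      exp_neg_two_mul_neg_log hr.1, sq_abs]
    have := hr.1.ne'
    generalize 1 / ε ^ 2 = lam
    field_simp
    ring
  · rw [(hasDerivAt_deriv_radial h.dg h.ddg hr).deriv, (hasDerivAt_radial h.dg hr).deriv,
      radial_of_pos hr.1, radial_of_pos hr.1, ← hWd _ (neg_log_pos_of_mem hr).le,
      exp_neg_two_mul_neg_log hr.1]
    have := hr.1.ne'
    generalize 1 / ε ^ 2 = lam
    field_simp
    ring
  · rw [radial_of_pos one_pos, Real.log_one, neg_zero, hf]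
  · obtain ⟨hL0, hb⟩ := h.limit_sub_le hlam hw hg hL
    have hO : (fun r => radial g L r - L) =O[𝓝[Icc 0 1] 0] fun r => ‖r - 0‖ ^ 2 := by
      refine Asymptotics.IsBigO.of_bound (1 / ε ^ 2 * truncWd W 1 * L / 4) ?_
      filter_upwards [self_mem_nhdsWithin] with r hr
      rw [sub_zero, norm_pow, norm_norm, Real.norm_eq_abs, Real.norm_eq_abs, sq_abs]
      rcases hr.1.eq_or_lt with rfl | hr0
      · simp [radial_zero]
      · obtain ⟨b1, b2⟩ := hb _ (neg_nonneg.2 (Real.log_nonpos hr.1 hr.2))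
        rw [exp_neg_two_mul_neg_log hr0] at b2
        rw [radial_of_pos hr0, abs_of_nonpos (by linarith)]
        linarith
    have hd := (hO.hasFDerivWithinAt (by simp) one_lt_two).hasDerivWithinAt
    have hd' : HasDerivWithinAt (radial g L) 0 (Icc 0 1) 0 := by
      simpa using hd.add_const L
    exact hd'.derivWithin (uniqueDiffOn_Icc zero_lt_one 0 (by simp))
  · rw [radial_of_pos one_pos, Real.log_one, neg_zero, h.g0]

lemma SolvesSystem.unique {W : ℝ → ℝ} {ε : ℝ} {k : ℤ} {f₁ g₁ f₂ g₂ : ℝ → ℝ}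
    (hW : ContDiffOn ℝ 1 W (Iic (1 : ℝ))) (hWconv : StrictConvexOn ℝ (Iic (1 : ℝ)) W)
    (h0 : Wd W 0 = 0) (hε : 0 < ε) (hk : k ≠ 0) (h₁ : SolvesSystem W ε k f₁ g₁)
    (h₂ : SolvesSystem W ε k f₂ g₂) (hg₁ : ∀ r ∈ Ioo (0 : ℝ) 1, 0 < g₁ r)
    (hg₂ : ∀ r ∈ Ioo (0 : ℝ) 1, 0 < g₂ r) :
    EqOn f₁ f₂ (Icc 0 1) ∧ EqOn g₁ g₂ (Icc 0 1) := by
  have hP₁ := h₁.isProfile_truncWd hW hWconv h0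
  have hP₂ := h₂.isProfile_truncWd hW hWconv h0
  obtain ⟨cf₁, cg₁, -, -, -, -, -, f1₁, -, -⟩ := h₁
  obtain ⟨cf₂, cg₂, -, -, -, -, -, f1₂, -, -⟩ := h₂
  have key := hP₁.unique hP₂ (by positivity) (abs_pos.2 (Int.cast_ne_zero.2 hk))
    (isPot_truncWd hW hWconv h0) (by simpa using f1₁) (by simpa using f1₂)
    (fun x hx => hg₁ _ (exp_neg_mem_Ioo hx)) (fun x hx => hg₂ _ (exp_neg_mem_Ioo hx))
  have hIoo : ∀ r ∈ Ioo (0 : ℝ) 1, f₁ r = f₂ r ∧ g₁ r = g₂ r := fun r hr => by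
    have := key _ (neg_log_pos_of_mem hr)
    simpa only [neg_neg, Real.exp_log hr.1] using this
  have hcl : Icc (0 : ℝ) 1 ⊆ closure (Ioo 0 1) := (closure_Ioo zero_ne_one).ge
  exact ⟨EqOn.of_subset_closure (fun r hr => (hIoo r hr).1) cf₁ cf₂ Ioo_subset_Icc_self hcl,
    EqOn.of_subset_closure (fun r hr => (hIoo r hr).2) cg₁ cg₂ Ioo_subset_Icc_self hcl⟩

end Radial

/-- Theorem 1.1(2): there is a critical value `ε_k > 0` such that the
radial system has a unique solution with `g > 0` for `ε ∈ (0, ε_k)`, and no such solution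
for `ε ∈ [ε_k, ∞)`. -/
theorem statement_1
    (W : ℝ → ℝ) (hW : ContDiffOn ℝ 1 W (Iic (1:ℝ))) (hW0 : W 0 = 0)
    (hWpos : ∀ t ∈ Iic (1:ℝ), t ≠ 0 → 0 < W t)
    (hWconv : StrictConvexOn ℝ (Iic (1:ℝ)) W)
    (k : ℤ) (hk : k ≠ 0) :
    ∃ εk : ℝ, 0 < εk ∧
      (∀ ε : ℝ, 0 < ε → ε < εk →
        ∃ f g : ℝ → ℝ, (SolvesSystem W ε k f g ∧ ∀ r ∈ Ioo (0:ℝ) 1, 0 < g r) ∧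
          ∀ f' g' : ℝ → ℝ, SolvesSystem W ε k f' g' → (∀ r ∈ Ioo (0:ℝ) 1, 0 < g' r) →
            EqOn f' f (Icc 0 1) ∧ EqOn g' g (Icc 0 1)) ∧
      (∀ ε : ℝ, εk ≤ ε →
        ¬ ∃ f g : ℝ → ℝ, SolvesSystem W ε k f g ∧ ∀ r ∈ Ioo (0:ℝ) 1, 0 < g r) := by
  have h0 := Wd_zero hW0 hWpos
  have hw := isPot_truncWd hW hWconv h0
  have hκ : 1 ≤ |(k : ℝ)| := by exact_mod_cast Int.one_le_abs hk
  obtain ⟨L, hL, hiff⟩ := exists_threshold hw hκ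
  refine ⟨1 / Real.sqrt L, by positivity, fun ε hε hεk => ?_, fun ε hε => ?_⟩
  · have hlt : L < 1 / ε ^ 2 := by
      rw [lt_div_iff₀ (Real.sqrt_pos.2 hL)] at hεk
      rw [lt_div_iff₀ (by positivity)]
      nlinarith [Real.sq_sqrt hL.le, mul_pos hε (Real.sqrt_pos.2 hL)]
    obtain ⟨f, f', g, g', hP, hf, hg⟩ := (hiff _ (by positivity)).2 hlt
    obtain ⟨l, hl⟩ := hP.limg
    have hS := hP.solvesSystem hw hf hg hl
    have hpos : ∀ r ∈ Ioo (0 : ℝ) 1, 0 < radial g l r := fun r hr => by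
      rw [radial_of_pos hr.1]
      exact hg _ (neg_log_pos_of_mem hr)
    exact ⟨_, _, ⟨hS, hpos⟩, fun u v hu hv => hu.unique hW hWconv h0 hε hk hS hv hpos⟩
  · rintro ⟨f, g, hS, hg⟩
    have hε0 : 0 < ε := (by positivity : 0 < 1 / Real.sqrt L).trans_le hε
    have hP := hS.isProfile_truncWd hW hWconv h0
    obtain ⟨-, -, -, -, -, -, -, f1, -, -⟩ := hS
    have hlt := (hiff (1 / ε ^ 2) (by positivity)).1
      ⟨_, _, _, _, hP, by simpa using f1, fun x hx => hg _ (exp_neg_mem_Ioo hx)⟩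
    rw [div_le_iff₀ (Real.sqrt_pos.2 hL)] at hε
    rw [lt_div_iff₀ (by positivity)] at hlt
    nlinarith [Real.sq_sqrt hL.le, mul_pos hε0 (Real.sqrt_pos.2 hL)]
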